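/- Under the null hypothesis (i.e. when the sample is i.i.d. uniform on [0,1]), for any fixed x > 0, the probability P(M_n^+ < x / (2 log n · log log n)) converges to 1 - e^{-x} as n → ∞, and the same limit holds for M_n^-. -/

import Mathlib

open MeasureTheory Filter Set

noncomputable section

/-- Density of the Beta(a,b) distribution on [0,1]. -/
def betaPDF (a b x : ℝ) : ℝ :=
  x ^ (a - 1) * (1 - x) ^ (b - 1) / (Real.Gamma a * Real.Gamma b / Real.Gamma (a + b))

/-- Regularized incomplete beta function `I_x(a,b) = P(Beta(a,b) < x)`. -/
def regIncBeta (a b x : ℝ) : ℝ := ∫ t in Set.Ioc (0:ℝ) x, betaPDF a b t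

/-- The `i`-th order statistic (0-based) of the sample `u`. -/
def orderStat {n : ℕ} (u : Fin n → ℝ) (i : Fin n) : ℝ := u (Tuple.sort u i)

/-- `p_{(i)} = P(Beta(i, n-i+1) < u_{(i)})` (with 1-based index `i = (i : Fin n) + 1`). -/
def pOrd {n : ℕ} (u : Fin n → ℝ) (i : Fin n) : ℝ :=
  regIncBeta ((i : ℕ) + 1 : ℝ) ((n : ℝ) - (i : ℕ)) (orderStat u i)

/-- One-sided exact Berk-Jones statistic `M_n^+`. -/
def MnPlus {n : ℕ} (u : Fin n → ℝ) : ℝ := ⨅ i, pOrd u i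

/-- One-sided exact Berk-Jones statistic `M_n^-`. -/
def MnMinus {n : ℕ} (u : Fin n → ℝ) : ℝ := ⨅ i, (1 - pOrd u i)

/-- Two-sided exact Berk-Jones statistic `M_n`. -/
def Mn {n : ℕ} (u : Fin n → ℝ) : ℝ := min (MnPlus u) (MnMinus u)

/-- Joint law of `n` i.i.d. `U[0,1]` random variables (the null hypothesis). -/
def nullMeasure (n : ℕ) : Measure (Fin n → ℝ) :=
  Measure.pi fun _ => MeasureTheory.volume.restrict (Set.Icc (0:ℝ) 1)

end

open MeasureTheory Filter Set

namespace BJ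

noncomputable section

/-- number of points of the configuration `u` which are strictly below `t` -/
def cnt {ι : Type*} [Fintype ι] (u : ι → ℝ) (t : ℝ) : ℕ :=
  (Finset.univ.filter (fun j => u j < t)).card

/-- the no-crossing event -/
def NC {ι : Type*} [Fintype ι] (J : Finset ℕ) (y : ℕ → ℝ) (i : ℕ) : Set (ι → ℝ) :=
  {u | ∀ j ∈ J, cnt u (y j) + i < j}

/-- uniform law on `[a,d)` -/
def uni (a d : ℝ) : Measure ℝ := (ENNReal.ofReal (d - a))⁻¹ • volume.restrict (Ico a d)

instance (a d : ℝ) : IsFiniteMeasure (uni a d) := by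
  constructor
  unfold uni
  rcases le_or_gt d a with h | h
  · simp [h]
  · simp only [Measure.smul_apply, Measure.restrict_apply_univ, Real.volume_Ico, smul_eq_mul]
    exact ENNReal.mul_lt_top (by simp [h]) (by simp)

lemma uni_prob {a d : ℝ} (h : a < d) : IsProbabilityMeasure (uni a d) := by
  constructor
  simp only [uni, Measure.smul_apply, Measure.restrict_apply_univ, Real.volume_Ico, smul_eq_mul]
  exact ENNReal.inv_mul_cancel (by simp [h]) (by simp)

/-- probability of the event `E` for `m` i.i.d. uniform points on `[a,d)` -/
def pr (m : ℕ) (a d : ℝ) (E : Set (Fin m → ℝ)) : ℝ :=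
  (Measure.pi (fun _ : Fin m => uni a d)).real E

/-- binomial weights -/
def binpmf (n : ℕ) (p : ℝ) (k : ℕ) : ℝ := (n.choose k : ℝ) * p ^ k * (1 - p) ^ (n - k)

lemma measurable_cnt {ι : Type*} [Fintype ι] (t : ℝ) :
    Measurable (fun u : ι → ℝ => cnt u t) := by
  classical
  have : (fun u : ι → ℝ => cnt u t) = fun u => ∑ j, if u j < t then 1 else 0 := by
    funext u; simp [cnt]
  rw [this]
  refine Finset.measurable_sum _ fun j _ => ?_
  refine Measurable.ite ?_ measurable_const measurable_const
  exact measurableSet_lt (measurable_pi_apply j) measurable_const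

lemma measurableSet_NC {ι : Type*} [Fintype ι] (J : Finset ℕ) (y : ℕ → ℝ) (i : ℕ) :
    MeasurableSet (NC J y i : Set (ι → ℝ)) := by
  have : (NC J y i : Set (ι → ℝ)) = ⋂ j ∈ J, {u | cnt u (y j) + i < j} := by
    ext u; simp [NC]
  rw [this]
  refine Finset.measurableSet_biInter _ fun j _ => ?_
  have := measurable_cnt (ι := ι) (y j)
  exact this (measurableSet_lt (f := fun k : ℕ => k + i) (g := fun _ => j) (by fun_prop) (by fun_prop))

lemma measurableSet_cnt {ι : Type*} [Fintype ι] (t : ℝ) (s : Set ℕ) :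
    MeasurableSet {u : ι → ℝ | cnt u t ∈ s} := measurable_cnt t (MeasurableSet.of_discrete)

lemma pi_smul' {ι : Type*} [Fintype ι] (c : ENNReal) (hc : c ≠ ⊤) (μ : Measure ℝ) [IsFiniteMeasure μ] :
    Measure.pi (fun _ : ι => c • μ) = c ^ (Fintype.card ι) • Measure.pi (fun _ : ι => μ) := by
  have : IsFiniteMeasure (c • μ) := by
    constructor
    simp only [Measure.smul_apply, smul_eq_mul]
    exact ENNReal.mul_lt_top hc.lt_top (measure_lt_top _ _)
  apply Measure.pi_eq
  intro s hs
  simp only [Measure.smul_apply, Measure.pi_pi, smul_eq_mul, Finset.prod_mul_distrib]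
  simp

lemma reindex {ι : Type*} [Fintype ι] (k : ℕ) (hk : Fintype.card ι = k) (μ : Measure ℝ)
    [IsFiniteMeasure μ] (Φ : (ℝ → ℕ) → Prop) :
    (Measure.pi (fun _ : ι => μ)) {u | Φ (cnt u)} =
      (Measure.pi (fun _ : Fin k => μ)) {u | Φ (cnt u)} := by
  classical
  let e : ι ≃ Fin k := Fintype.equivFinOfCardEq hk
  have h := measurePreserving_piCongrLeft (fun _ : Fin k => μ) e
  rw [← h.measure_preimage_equiv]
  congr 1
  ext u
  have : cnt ((MeasurableEquiv.piCongrLeft (fun _ : Fin k => ℝ) e) u) = cnt u := by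
    funext t
    unfold cnt
    symm
    apply Finset.card_bij (fun j _ => e j)
    · intro j hj
      simp only [Finset.mem_filter, Finset.mem_univ, true_and] at hj ⊢
      have := MeasurableEquiv.piCongrLeft_apply_apply (β := fun _ : Fin k => ℝ) e u j
      rw [this]; exact hj
    · intro a _ b _ hab; exact e.injective hab
    · intro j hj
      refine ⟨e.symm j, ?_, by simp⟩
      simp only [Finset.mem_filter, Finset.mem_univ, true_and] at hj ⊢
      have := MeasurableEquiv.piCongrLeft_apply_apply (β := fun _ : Fin k => ℝ) e u (e.symm j)
      simp at this
      rw [← this]; exact hj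
  simp [this]

lemma uni_restrict_left {a b d : ℝ} (hab : a < b) (hbd : b < d) :
    (uni a d).restrict (Iio b) = ENNReal.ofReal ((b - a) / (d - a)) • uni a b := by
  unfold uni
  rw [Measure.restrict_smul, Measure.restrict_restrict measurableSet_Iio, smul_smul]
  have : Iio b ∩ Ico a d = Ico a b := by ext z; simp; constructor <;> rintro ⟨_, _⟩ <;> grind
  rw [this]
  congr 1
  rw [ENNReal.ofReal_div_of_pos (by linarith), ENNReal.div_eq_inv_mul, mul_assoc,
    ENNReal.mul_inv_cancel (by simp [hab]) (by simp), mul_one]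

lemma uni_restrict_right {a b d : ℝ} (hab : a < b) (hbd : b < d) :
    (uni a d).restrict (Ici b) = ENNReal.ofReal ((d - b) / (d - a)) • uni b d := by
  unfold uni
  rw [Measure.restrict_smul, Measure.restrict_restrict measurableSet_Ici, smul_smul]
  have : Ici b ∩ Ico a d = Ico b d := by
    ext z; simp only [mem_inter_iff, mem_Ici, mem_Ico]; constructor <;> intro h <;> grind
  rw [this]
  congr 1
  rw [ENNReal.ofReal_div_of_pos (by linarith), ENNReal.div_eq_inv_mul, mul_assoc,
    ENNReal.mul_inv_cancel (by simp [hbd]) (by simp), mul_one]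

lemma pi_restrict_left {ι : Type*} [Fintype ι] {a b d : ℝ} (hab : a < b) (hbd : b < d)
    (E : Set (ι → ℝ)) :
    (Measure.pi (fun _ : ι => uni a d)) (E ∩ {v | ∀ j, v j < b}) =
      ENNReal.ofReal ((b - a) / (d - a)) ^ (Fintype.card ι) *
        (Measure.pi (fun _ : ι => uni a b)) E := by
  have h1 : {v : ι → ℝ | ∀ j, v j < b} = Set.univ.pi (fun _ => Iio b) := by
    ext v; simp
  have h2 : MeasurableSet (Set.univ.pi (fun _ : ι => Iio b)) :=
    MeasurableSet.univ_pi fun _ => measurableSet_Iio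
  rw [h1, ← Measure.restrict_apply' h2, Measure.restrict_pi_pi]
  simp_rw [uni_restrict_left hab hbd]
  rw [pi_smul' _ (by simp)]
  simp

lemma pi_restrict_right {ι : Type*} [Fintype ι] {a b d : ℝ} (hab : a < b) (hbd : b < d)
    (E : Set (ι → ℝ)) :
    (Measure.pi (fun _ : ι => uni a d)) (E ∩ {v | ∀ j, b ≤ v j}) =
      ENNReal.ofReal ((d - b) / (d - a)) ^ (Fintype.card ι) *
        (Measure.pi (fun _ : ι => uni b d)) E := by
  have h1 : {v : ι → ℝ | ∀ j, b ≤ v j} = Set.univ.pi (fun _ => Ici b) := by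
    ext v; simp only [mem_setOf_eq, Set.mem_univ_pi, mem_Ici]
  have h2 : MeasurableSet (Set.univ.pi (fun _ : ι => Ici b)) :=
    MeasurableSet.univ_pi fun _ => measurableSet_Ici
  rw [h1, ← Measure.restrict_apply' h2, Measure.restrict_pi_pi]
  simp_rw [uni_restrict_right hab hbd]
  rw [pi_smul' _ (by simp)]
  simp

end

end BJ

open MeasureTheory Filter Set

namespace BJ

noncomputable section

lemma split_one {ι : Type*} [Fintype ι] [DecidableEq ι] {a b d : ℝ} (hab : a < b) (hbd : b < d)
    (S : Finset ι) (p : ι → Prop) [DecidablePred p] (hp : ∀ j, j ∈ S ↔ p j)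
    (k m : ℕ) (hk : S.card = k) (hm : Fintype.card ι = k + m)
    (Φ Ψ : (ℝ → ℕ) → Prop) :
    (Measure.pi (fun _ : ι => uni a d))
      ({u | (Finset.univ.filter (fun j => u j < b)) = S} ∩
        {u | Φ (fun t => cnt u (min t b)) ∧ Ψ (fun t => cnt u (max t b) - k)}) =
    ENNReal.ofReal ((b - a) / (d - a)) ^ k * ENNReal.ofReal ((d - b) / (d - a)) ^ m *
      ((Measure.pi (fun _ : Fin k => uni a b)) {v | Φ (cnt v)} *
       (Measure.pi (fun _ : Fin m => uni b d)) {v | Ψ (cnt v)}) := by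
  have hc1 : Fintype.card {x // p x} = k := by
    rw [← hk, Fintype.card_subtype]; congr 1; ext j; simp [hp]
  have hc2 : Fintype.card {x // ¬ p x} = m := by
    rw [Fintype.card_subtype_compl, hc1, hm]; simp
  have h := measurePreserving_piEquivPiSubtypeProd (fun _ : ι => uni a d) p
  have key : ({u | (Finset.univ.filter (fun j => u j < b)) = S} ∩
        {u | Φ (fun t => cnt u (min t b)) ∧ Ψ (fun t => cnt u (max t b) - k)}) =
      (MeasurableEquiv.piEquivPiSubtypeProd (fun _ : ι => ℝ) p) ⁻¹'
        (({v | Φ (cnt v)} ∩ {v | ∀ j, v j < b}) ×ˢ ({v | Ψ (cnt v)} ∩ {v | ∀ j, b ≤ v j})) := by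
    ext u
    simp only [mem_inter_iff, mem_preimage, mem_prod, mem_ofPred_eq]
    have e1 : ((MeasurableEquiv.piEquivPiSubtypeProd (fun _ : ι => ℝ) p) u).1 =
      fun j : {x // p x} => u j := rfl
    have e2 : ((MeasurableEquiv.piEquivPiSubtypeProd (fun _ : ι => ℝ) p) u).2 =
      fun j : {x // ¬ p x} => u j := rfl
    rw [e1, e2]
    have hS : (Finset.univ.filter (fun j => u j < b)) = S ↔
        (∀ j : {x // p x}, u j < b) ∧ (∀ j : {x // ¬ p x}, b ≤ u j) := by
      rw [Finset.ext_iff]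
      simp only [Finset.mem_filter, Finset.mem_univ, true_and, Subtype.forall, hp]
      constructor
      · intro hh
        exact ⟨fun j hj => (hh j).2 hj, fun j hj => not_lt.1 fun h' => hj ((hh j).1 h')⟩
      · rintro ⟨h1, h2⟩ j
        exact ⟨fun h' => by by_contra hj; exact absurd h' (not_lt.2 (h2 j hj)), fun hj => h1 j hj⟩
    have aux : (∀ j : {x // p x}, u j < b) ∧ (∀ j : {x // ¬ p x}, b ≤ u j) →
        (fun t => cnt u (min t b)) = cnt (fun j : {x // p x} => u j) ∧
        (fun t => cnt u (max t b) - k) = cnt (fun j : {x // ¬ p x} => u j) := by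
      rintro ⟨h1, h2⟩
      constructor
      · funext t
        unfold cnt
        symm
        apply Finset.card_bij (fun j _ => j.1)
        · intro j hj
          simp only [Finset.mem_filter, Finset.mem_univ, true_and, lt_min_iff] at hj ⊢
          exact ⟨hj, h1 j⟩
        · intro j _ j' _ hh; exact Subtype.ext hh
        · intro j hj
          simp only [Finset.mem_filter, Finset.mem_univ, true_and, lt_min_iff] at hj
          refine ⟨⟨j, ?_⟩, ?_, rfl⟩
          · by_contra hjS
            exact absurd hj.2 (not_lt.2 (h2 ⟨j, hjS⟩))
          · simp [hj.1]
      · funext t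
        have : cnt u (max t b) = S.card + cnt (fun j : {x // ¬ p x} => u j) t := by
          unfold cnt
          have : (Finset.univ.filter (fun j => u j < max t b)) =
            S ∪ (Finset.univ.filter (fun j : {x // ¬ p x} => u j < t)).map
              (Function.Embedding.subtype _) := by
            ext j
            simp only [Finset.mem_filter, Finset.mem_univ, true_and, lt_max_iff, Finset.mem_union,
              Finset.mem_map, Function.Embedding.subtype_apply, Subtype.exists, exists_and_left,
              exists_prop, exists_eq_right_right]
            by_cases hjS : p j
            · simp [hjS, hp, h1 ⟨j, hjS⟩]
            · simp [hjS, hp, h2 ⟨j, hjS⟩]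
          rw [this, Finset.card_union_of_disjoint, Finset.card_map]
          rw [Finset.disjoint_left]
          intro j hj
          simp [(hp j).1 hj]
        simp [this, hk]
    rw [hS]
    constructor
    · rintro ⟨hh, h1, h2⟩
      obtain ⟨a1, a2⟩ := aux hh
      rw [a1] at h1; rw [a2] at h2
      exact ⟨⟨h1, hh.1⟩, h2, hh.2⟩
    · rintro ⟨⟨h1, h3⟩, h2, h4⟩
      obtain ⟨a1, a2⟩ := aux ⟨h3, h4⟩
      rw [a1, a2]
      exact ⟨⟨h3, h4⟩, h1, h2⟩
  rw [key, h.measure_preimage_equiv, Measure.prod_prod, pi_restrict_left hab hbd,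
    pi_restrict_right hab hbd, reindex k hc1 _ Φ, reindex m hc2 _ Ψ, hc1, hc2]
  ring

lemma binpmf_nonneg {n : ℕ} {p : ℝ} (h0 : 0 ≤ p) (h1 : p ≤ 1) (k : ℕ) : 0 ≤ binpmf n p k := by
  unfold binpmf
  have : 0 ≤ 1 - p := by linarith
  positivity

/-- the splitting lemma -/
lemma split {a b d : ℝ} (hab : a < b) (hbd : b < d) (n k : ℕ) (hkn : k ≤ n)
    (Φ Ψ : (ℝ → ℕ) → Prop) :
    pr n a d {u | cnt u b = k ∧ Φ (fun t => cnt u (min t b)) ∧ Ψ (fun t => cnt u (max t b) - k)} =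
      binpmf n ((b - a) / (d - a)) k * pr k a b {v | Φ (cnt v)} * pr (n - k) b d {v | Ψ (cnt v)} := by
  classical
  set μ := Measure.pi (fun _ : Fin n => uni a d) with hμ
  have hm : ∀ S : Finset (Fin n), MeasurableSet
      {u : Fin n → ℝ | (Finset.univ.filter (fun j => u j < b)) = S} := by
    intro S
    have : {u : Fin n → ℝ | (Finset.univ.filter (fun j => u j < b)) = S} =
      ⋂ j, {u | u j < b ↔ j ∈ S} := by
      ext u; simp [Finset.ext_iff]
    rw [this]
    refine MeasurableSet.iInter fun j => ?_
    by_cases hj : j ∈ S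
    · simp only [hj, iff_true]
      exact measurableSet_lt (measurable_pi_apply j) measurable_const
    · simp only [hj, iff_false, not_lt]
      exact measurableSet_le measurable_const (measurable_pi_apply j)
  set F : Set (Fin n → ℝ) :=
    {u | Φ (fun t => cnt u (min t b)) ∧ Ψ (fun t => cnt u (max t b) - k)} with hF
  have h1 := sum_measure_preimage_singleton (μ := μ.restrict F)
    (Finset.powersetCard k (Finset.univ : Finset (Fin n)))
    (f := fun u : Fin n → ℝ => (Finset.univ.filter (fun j => u j < b))) (fun S _ => hm S)
  have h2 : (fun u : Fin n → ℝ => (Finset.univ.filter (fun j => u j < b))) ⁻¹'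
      ↑(Finset.powersetCard k (Finset.univ : Finset (Fin n))) = {u | cnt u b = k} := by
    ext u; simp [cnt]
  rw [h2, Measure.restrict_apply (show MeasurableSet {u : Fin n → ℝ | cnt u b = k} from
    measurableSet_cnt b {k})] at h1
  have h3 : {u : Fin n → ℝ | cnt u b = k ∧ Φ (fun t => cnt u (min t b)) ∧
      Ψ (fun t => cnt u (max t b) - k)} = {u | cnt u b = k} ∩ F := rfl
  unfold pr
  rw [h3, measureReal_def, ← h1, Finset.sum_congr rfl (g := fun _ => ENNReal.ofReal ((b - a) / (d - a)) ^ k *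
    ENNReal.ofReal ((d - b) / (d - a)) ^ (n - k) *
      ((Measure.pi (fun _ : Fin k => uni a b)) {v | Φ (cnt v)} *
       (Measure.pi (fun _ : Fin (n - k) => uni b d)) {v | Ψ (cnt v)}))]
  · rw [Finset.sum_const, Finset.card_powersetCard]
    simp only [Finset.card_univ, Fintype.card_fin, nsmul_eq_mul, ENNReal.toReal_mul,
      ENNReal.toReal_natCast, ENNReal.toReal_pow, measureReal_def, binpmf]
    rw [ENNReal.toReal_ofReal (by apply div_nonneg <;> linarith),
      ENNReal.toReal_ofReal (by apply div_nonneg <;> linarith)]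
    have : 1 - (b - a) / (d - a) = (d - b) / (d - a) := by
      have : d - a ≠ 0 := by linarith
      field_simp; ring
    rw [this]; ring
  · intro S hS
    have hS' : S.card = k := (Finset.mem_powersetCard.1 hS).2
    have := split_one hab hbd S (fun j => j ∈ S) (fun _ => Iff.rfl) k (n - k) hS' (by simp; omega) Φ Ψ
    rw [← this]
    exact Measure.restrict_apply (hm S)

lemma pr_univ {a d : ℝ} (h : a < d) (m : ℕ) : pr m a d univ = 1 := by
  have := uni_prob h
  simp [pr]

lemma pr_true {a d : ℝ} (h : a < d) (m : ℕ) : pr m a d {_u | True} = 1 := by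
  rw [show {_u : Fin m → ℝ | True} = univ from by ext; simp, pr_univ h]

lemma pr_nonneg (m : ℕ) (a d : ℝ) (E : Set (Fin m → ℝ)) : 0 ≤ pr m a d E := measureReal_nonneg

lemma pr_le_one {a d : ℝ} (h : a < d) (m : ℕ) (E : Set (Fin m → ℝ)) : pr m a d E ≤ 1 := by
  have := uni_prob h
  exact measureReal_le_one

lemma pr_mono {m : ℕ} {a d : ℝ} {E F : Set (Fin m → ℝ)} (h : E ⊆ F) : pr m a d E ≤ pr m a d F :=
  measureReal_mono h

lemma pr_compl {m : ℕ} {a d : ℝ} (h : a < d) {E : Set (Fin m → ℝ)} (hE : MeasurableSet E) :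
    pr m a d Eᶜ = 1 - pr m a d E := by
  have := uni_prob h
  unfold pr
  rw [probReal_compl_eq_one_sub hE]

lemma pr_union_le {m : ℕ} {a d : ℝ} (E F : Set (Fin m → ℝ)) :
    pr m a d (E ∪ F) ≤ pr m a d E + pr m a d F := measureReal_union_le E F

lemma pr_cnt {a b d : ℝ} (hab : a < b) (hbd : b < d) (n k : ℕ) (hkn : k ≤ n) :
    pr n a d {u | cnt u b = k} = binpmf n ((b - a) / (d - a)) k := by
  have := split hab hbd n k hkn (fun _ => True) (fun _ => True)
  simp only [and_true] at this
  rw [this, pr_true hab, pr_true hbd]; ring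

lemma cnt_le {n : ℕ} (u : Fin n → ℝ) (t : ℝ) : cnt u t ≤ n := by
  unfold cnt
  exact (Finset.card_filter_le _ _).trans (by simp)

lemma cnt_mono {ι : Type*} [Fintype ι] (u : ι → ℝ) {s t : ℝ} (h : s ≤ t) : cnt u s ≤ cnt u t := by
  unfold cnt
  exact Finset.card_le_card (fun j hj => by
    simp only [Finset.mem_filter, Finset.mem_univ, true_and] at hj ⊢; linarith)

/-- split, specialised to `NC` -/
lemma split_NC {a b d : ℝ} (hab : a < b) (hbd : b < d) (n k : ℕ) (hkn : k ≤ n)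
    (J : Finset ℕ) (y : ℕ → ℝ) (hy : ∀ j ∈ J, b ≤ y j) (i : ℕ) :
    pr n a d {u | cnt u b = k ∧ u ∈ NC J y i} =
      binpmf n ((b - a) / (d - a)) k * pr (n - k) b d (NC J y (i + k)) := by
  have := split hab hbd n k hkn (fun _ => True) (fun N => ∀ j ∈ J, N (y j) + (i + k) < j)
  rw [pr_true hab, mul_one] at this
  rw [show (NC J y (i + k) : Set (Fin (n-k) → ℝ)) = {v | ∀ j ∈ J, cnt v (y j) + (i + k) < j} from rfl,
    ← this]
  congr 1
  ext u
  simp only [mem_ofPred_eq, NC, true_and]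
  refine and_congr_right fun hu => forall₂_congr fun j hj => ?_
  rw [max_eq_left (hy j hj)]
  have := cnt_mono u (hy j hj)
  omega

lemma split_NC2 {a b d t0 : ℝ} (hab : a < b) (hbd : b < d) (ht0 : t0 ≤ b) (n k : ℕ) (hkn : k ≤ n)
    (m0 : ℝ) (J : Finset ℕ) (y : ℕ → ℝ) (hy : ∀ j ∈ J, b ≤ y j) (i : ℕ) :
    pr n a d {u | m0 ≤ cnt u t0 ∧ cnt u b = k ∧ u ∈ NC J y i} =
      pr k a b {v | m0 ≤ cnt v t0} * pr n a d {u | cnt u b = k ∧ u ∈ NC J y i} := by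
  have := split hab hbd n k hkn (fun N => m0 ≤ N t0) (fun N => ∀ j ∈ J, N (y j) + (i + k) < j)
  rw [split_NC hab hbd n k hkn J y hy i]
  rw [show (NC J y (i + k) : Set (Fin (n-k) → ℝ)) = {v | ∀ j ∈ J, cnt v (y j) + (i + k) < j} from rfl]
  trans binpmf n ((b - a) / (d - a)) k * pr k a b {v | m0 ≤ cnt v t0} *
    pr (n - k) b d {v | ∀ j ∈ J, cnt v (y j) + (i + k) < j}
  swap
  · ring
  rw [← this]
  congr 1
  ext u
  simp only [mem_ofPred_eq, NC, min_eq_left ht0]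
  constructor
  · rintro ⟨h1, h2, h3⟩
    refine ⟨h2, h1, fun j hj => ?_⟩
    rw [max_eq_left (hy j hj)]
    have := cnt_mono u (hy j hj)
    have := h3 j hj
    omega
  · rintro ⟨h1, h2, h3⟩
    refine ⟨h2, h1, fun j hj => ?_⟩
    have h4 := h3 j hj
    rw [max_eq_left (hy j hj)] at h4
    have := cnt_mono u (hy j hj)
    omega

end

end BJ

open MeasureTheory Filter Set

namespace BJ

noncomputable section

lemma binpmf_sum (n : ℕ) (p : ℝ) : ∑ k ∈ Finset.range (n + 1), binpmf n p k = 1 := by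
  have := add_pow p (1 - p) n
  simp only [add_sub_cancel, one_pow] at this
  rw [this]
  refine Finset.sum_congr rfl fun k _ => ?_
  unfold binpmf; ring

lemma binpmf_var (n : ℕ) (p : ℝ) :
    ∑ k ∈ Finset.range (n + 1), ((k : ℝ) - n * p) ^ 2 * binpmf n p k = n * p * (1 - p) := by
  have := congrArg (Polynomial.eval p) (bernsteinPolynomial.variance ℝ n)
  rw [Polynomial.eval_finsetSum] at this
  simp only [nsmul_eq_mul, Polynomial.eval_mul, Polynomial.eval_pow, Polynomial.eval_sub,
    Polynomial.eval_natCast, Polynomial.eval_X, Polynomial.eval_one, bernsteinPolynomial] at this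
  rw [← this]
  refine Finset.sum_congr rfl fun k _ => ?_
  unfold binpmf; ring

lemma pr_cnt_mem {a b d : ℝ} (hab : a < b) (hbd : b < d) (n : ℕ) (P : ℕ → Prop) [DecidablePred P] :
    pr n a d {u | P (cnt u b)} =
      ∑ k ∈ (Finset.range (n + 1)).filter P, binpmf n ((b - a) / (d - a)) k := by
  have h1 : {u : Fin n → ℝ | P (cnt u b)} =
      ⋃ k ∈ (Finset.range (n + 1)).filter P, {u | cnt u b = k} := by
    ext u
    simp only [mem_ofPred_eq, mem_iUnion, Finset.mem_filter, Finset.mem_range, exists_prop]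
    constructor
    · intro h; exact ⟨_, ⟨Nat.lt_succ_of_le (cnt_le u b), h⟩, rfl⟩
    · rintro ⟨k, ⟨_, h⟩, rfl⟩; exact h
  unfold pr
  rw [h1, measureReal_biUnion_finset]
  · refine Finset.sum_congr rfl fun k hk => ?_
    rw [← pr_cnt hab hbd n k (by simp at hk; omega)]
    rfl
  · intro k _ k' _ hkk'
    rw [Function.onFun, Set.disjoint_left]
    intro u hu hu'
    exact hkk' (hu.symm.trans hu')
  · intro k _
    exact measurableSet_cnt b {k}

lemma cheb_aux (n : ℕ) {p : ℝ} (h0 : 0 ≤ p) (h1 : p ≤ 1) (P : ℕ → Prop) [DecidablePred P] {r : ℝ}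
    (hr : 0 < r) (hP : ∀ k, k ≤ n → P k → r ≤ |(k : ℝ) - n * p|) :
    ∑ k ∈ (Finset.range (n + 1)).filter P, binpmf n p k ≤ n * p * (1 - p) / r ^ 2 := by
  rw [le_div_iff₀ (by positivity), ← binpmf_var, Finset.sum_mul]
  calc _ ≤ ∑ k ∈ (Finset.range (n + 1)).filter P, ((k : ℝ) - n * p) ^ 2 * binpmf n p k := by
        refine Finset.sum_le_sum fun k hk => ?_
        simp only [Finset.mem_filter, Finset.mem_range] at hk
        have := hP k (by omega) hk.2
        have h2 : r ^ 2 ≤ ((k : ℝ) - n * p) ^ 2 := by rw [← sq_abs ((k : ℝ) - n * p)]; gcongr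
        rw [mul_comm]
        exact mul_le_mul_of_nonneg_right h2 (binpmf_nonneg h0 h1 k)
    _ ≤ _ := by
        refine Finset.sum_le_sum_of_subset_of_nonneg (Finset.filter_subset _ _) fun k _ _ => ?_
        exact mul_nonneg (sq_nonneg _) (binpmf_nonneg h0 h1 k)

lemma frac_mem {a b d : ℝ} (hab : a < b) (hbd : b < d) : 0 < (b - a) / (d - a) ∧ (b - a) / (d - a) < 1 := by
  constructor
  · apply div_pos <;> linarith
  · rw [div_lt_one (by linarith)]; linarith

/-- upper tail Chebyshev -/
lemma cheb_upper {a b d : ℝ} (hab : a < b) (hbd : b < d) (n : ℕ) {m0 : ℝ}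
    (hm : n * ((b - a) / (d - a)) < m0) :
    pr n a d {u | m0 ≤ cnt u b} ≤
      n * ((b - a) / (d - a)) * (1 - (b - a) / (d - a)) / (m0 - n * ((b - a) / (d - a))) ^ 2 := by
  classical
  obtain ⟨h0, h1⟩ := frac_mem hab hbd
  rw [pr_cnt_mem hab hbd n (fun k => m0 ≤ k)]
  refine cheb_aux n h0.le h1.le _ (by linarith) fun k _ hk => ?_
  exact (by linarith : _ ≤ (k : ℝ) - _).trans (le_abs_self _)

lemma cheb_lower {a b d : ℝ} (hab : a < b) (hbd : b < d) (n : ℕ) {m0 : ℝ}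
    (hm : m0 < n * ((b - a) / (d - a))) :
    pr n a d {u | (cnt u b : ℝ) < m0} ≤
      n * ((b - a) / (d - a)) * (1 - (b - a) / (d - a)) / (n * ((b - a) / (d - a)) - m0) ^ 2 := by
  classical
  obtain ⟨h0, h1⟩ := frac_mem hab hbd
  rw [pr_cnt_mem hab hbd n (fun k => (k : ℝ) < m0)]
  refine cheb_aux n h0.le h1.le _ (by linarith) fun k _ hk => ?_
  exact (by linarith : _ ≤ -((k : ℝ) - _)).trans (neg_le_abs _)

lemma NC_mono {ι : Type*} [Fintype ι] {J J' : Finset ℕ} {y y' : ℕ → ℝ} {i i' : ℕ} (hJ : J' ⊆ J)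
    (hy : ∀ j ∈ J', y' j ≤ y j) (hi : i' ≤ i) : (NC J y i : Set (ι → ℝ)) ⊆ NC J' y' i' := by
  intro u hu j hj
  have h1 := hu j (hJ hj)
  have h2 := cnt_mono u (hy j hj)
  omega

lemma NC_union {ι : Type*} [Fintype ι] [DecidableEq ℕ] (J J' : Finset ℕ) (y : ℕ → ℝ) (i : ℕ) :
    (NC (J ∪ J') y i : Set (ι → ℝ)) = NC J y i ∩ NC J' y i := by
  ext u
  simp only [NC, mem_ofPred_eq, mem_inter_iff, Finset.mem_union]
  constructor
  · intro h; exact ⟨fun j hj => h j (Or.inl hj), fun j hj => h j (Or.inr hj)⟩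
  · rintro ⟨h1, h2⟩ j (hj | hj)
    · exact h1 j hj
    · exact h2 j hj

/-- last crossing decomposition -/
lemma last_crossing {N i s : ℕ} {a d : ℝ} (his : i ≤ s) (y : ℕ → ℝ)
    (hy : ∀ j j', s < j → j ≤ j' → j' ≤ N + i → y j ≤ y j')
    (A : Set (Fin N → ℝ)) (hA : MeasurableSet A) :
    pr N a d (A ∩ (NC (Finset.Ioc s (N + i)) y i)ᶜ) =
      ∑ j ∈ Finset.Ioc s (N + i),
        pr N a d (A ∩ {u | cnt u (y j) = j - i ∧ u ∈ NC (Finset.Ioc j (N + i)) y i}) := by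
  have h1 : A ∩ (NC (Finset.Ioc s (N + i)) y i)ᶜ = ⋃ j ∈ Finset.Ioc s (N + i),
      (A ∩ {u | cnt u (y j) = j - i ∧ u ∈ NC (Finset.Ioc j (N + i)) y i}) := by
    ext u
    simp only [mem_inter_iff, mem_compl_iff, mem_iUnion, exists_prop, mem_ofPred_eq]
    constructor
    · rintro ⟨hA, hu⟩
      let T := (Finset.Ioc s (N + i)).filter (fun j => j ≤ cnt u (y j) + i)
      have hT : T.Nonempty := by
        simp only [NC, mem_ofPred_eq, not_forall] at hu
        obtain ⟨j, hj, hj'⟩ := hu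
        exact ⟨j, Finset.mem_filter.2 ⟨hj, not_lt.1 hj'⟩⟩
      have hmem := Finset.mem_filter.1 (T.max'_mem hT)
      set j := T.max' hT with hj
      have hnc : ∀ j' ∈ Finset.Ioc j (N + i), cnt u (y j') + i < j' := by
        intro j' hj'
        by_contra hcon
        have : j' ∈ T := by
          refine Finset.mem_filter.2 ⟨?_, not_lt.1 hcon⟩
          simp only [Finset.mem_Ioc] at hj' hmem ⊢
          omega
        have := T.le_max' j' this
        simp only [Finset.mem_Ioc] at hj'
        omega
      refine ⟨j, hmem.1, hA, ?_, hnc⟩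
      have hm := hmem.1
      simp only [Finset.mem_Ioc] at hm
      rcases Nat.lt_or_ge j (N + i) with hlt | hge
      · have h2 := hnc (j + 1) (by simp; omega)
        have h3 := cnt_mono u (hy j (j + 1) hm.1 (by omega) (by omega))
        have := hmem.2
        omega
      · have := cnt_le u (y j)
        have := hmem.2
        omega
    · rintro ⟨j, hj, hA, hc, hu⟩
      refine ⟨hA, fun hcon => ?_⟩
      have := hcon j hj
      simp only [Finset.mem_Ioc] at hj
      omega
  unfold pr
  rw [h1, measureReal_biUnion_finset]
  · have key : ∀ j j', j ∈ Finset.Ioc s (N + i) → j' ∈ Finset.Ioc s (N + i) → j < j' →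
      Disjoint (A ∩ {u | cnt u (y j) = j - i ∧ u ∈ NC (Finset.Ioc j (N + i)) y i})
        (A ∩ {u | cnt u (y j') = j' - i ∧ u ∈ NC (Finset.Ioc j' (N + i)) y i}) := by
      intro j j' hj hj' hlt
      rw [Set.disjoint_left]
      rintro u ⟨_, hu⟩ ⟨_, hu'⟩
      simp only [Finset.mem_Ioc] at hj hj'
      have h3 := hu.2 j' (by simp; omega)
      have h4 := hu'.1
      omega
    intro j hj j' hj' hne
    rcases lt_or_gt_of_ne hne with h | h
    · exact key j j' hj hj' h
    · exact (key j' j hj' hj h).symm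
  · intro j _
    exact hA.inter ((measurableSet_cnt (y j) {j - i}).inter (measurableSet_NC _ _ _))

lemma NC_cap {ι : Type*} [Fintype ι] {s e E i : ℕ} (hse : s < e) (heE : e ≤ E) (y : ℕ → ℝ) :
    (NC (Finset.Ioc s e) y i : Set (ι → ℝ)) = NC (Finset.Ioc s E) (fun j => y (min j e)) i := by
  ext u
  constructor
  · intro h j hj
    simp only [Finset.mem_Ioc] at hj
    rcases le_total j e with hje | hje
    · have := h j (by simp; omega)
      simpa [min_eq_left hje] using this
    · have := h e (by simp; omega)
      simp only [min_eq_right hje]; omega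
  · intro h j hj
    simp only [Finset.mem_Ioc] at hj
    have := h j (by simp; omega)
    simpa [min_eq_left hj.2] using this

/-- Ottaviani type inequality -/
lemma ottaviani {N i s e : ℕ} {a d t0 m0 : ℝ} (his : i ≤ s) (heN : e ≤ N + i) (y : ℕ → ℝ)
    (hat : a < t0) (hy : ∀ j j', s < j → j ≤ j' → j' ≤ e → y j ≤ y j')
    (hty : ∀ j, s < j → j ≤ e → t0 < y j) (hyd : ∀ j, s < j → j ≤ e → y j < d) (hm0 : 0 ≤ m0)
    (hmu : ∀ j, s < j → j ≤ e → m0 < ((j : ℝ) - i) * ((t0 - a) / (y j - a)))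
    (hvar : ∀ j, s < j → j ≤ e →
      ((j : ℝ) - i) * ((t0 - a) / (y j - a)) * (1 - (t0 - a) / (y j - a)) ≤
        (((j : ℝ) - i) * ((t0 - a) / (y j - a)) - m0) ^ 2 / 2) :
    pr N a d (NC (Finset.Ioc s e) y i)ᶜ ≤ 2 * pr N a d {u | m0 ≤ cnt u t0} := by
  rcases Nat.lt_or_ge s e with hse | hse
  swap
  · have : (NC (Finset.Ioc s e) y i : Set (Fin N → ℝ)) = univ := by
      ext u; simp [NC, Finset.Ioc_eq_empty_of_le hse]
    rw [this]
    have := pr_nonneg N a d {u | m0 ≤ cnt u t0}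
    simp only [compl_univ]
    have h0 : pr N a d (∅ : Set (Fin N → ℝ)) = 0 := by simp [pr]
    rw [h0]; linarith
  rw [NC_cap hse heN]
  set z : ℕ → ℝ := fun j => y (min j e) with hz
  have hzy : ∀ j j', s < j → j ≤ j' → j' ≤ N + i → z j ≤ z j' := by
    intro j j' h1 h2 _
    exact hy _ _ (by omega) (by omega) (by omega)
  have hA : MeasurableSet {u : Fin N → ℝ | m0 ≤ cnt u t0} :=
    measurableSet_cnt t0 {k : ℕ | m0 ≤ (k : ℝ)}
  have h1 := last_crossing (N := N) (i := i) (s := s) (a := a) (d := d) his z hzy univ MeasurableSet.univ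
  have h2 := last_crossing (N := N) (i := i) (s := s) (a := a) (d := d) his z hzy _ hA
  simp only [univ_inter] at h1
  rw [h1]
  have h3 : pr N a d ({u | m0 ≤ cnt u t0} ∩ (NC (Finset.Ioc s (N + i)) z i)ᶜ) ≤
    pr N a d {u | m0 ≤ cnt u t0} := pr_mono inter_subset_left
  rw [h2] at h3
  refine le_trans ?_ (mul_le_mul_of_nonneg_left h3 (by norm_num))
  rw [Finset.mul_sum]
  refine Finset.sum_le_sum fun j hj => ?_
  simp only [Finset.mem_Ioc] at hj
  have hs1 : s < min j e := by omega
  have hs2 : min j e ≤ e := by omega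
  have hzt : t0 < z j := hty _ hs1 hs2
  have hzd : z j < d := hyd _ hs1 hs2
  have h4 := split_NC2 (hat.trans hzt) hzd hzt.le N (j - i) (by omega) m0 (Finset.Ioc j (N + i)) z
    (fun j' hj' => by
      simp only [Finset.mem_Ioc] at hj'
      exact hzy j j' hj.1 (by omega) hj'.2) i
  have h5 : ({u : Fin N → ℝ | m0 ≤ cnt u t0} ∩
      {u | cnt u (z j) = j - i ∧ u ∈ NC (Finset.Ioc j (N + i)) z i}) =
      {u | m0 ≤ cnt u t0 ∧ cnt u (z j) = j - i ∧ u ∈ NC (Finset.Ioc j (N + i)) z i} := rfl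
  rw [h5, h4]
  have h6 : (1:ℝ)/2 ≤ pr (j - i) a (z j) {v | m0 ≤ cnt v t0} := by
    have hc : {v : Fin (j - i) → ℝ | m0 ≤ cnt v t0} = {v | (cnt v t0 : ℝ) < m0}ᶜ := by
      ext v; simp
    have hmeas : MeasurableSet {v : Fin (j - i) → ℝ | (cnt v t0 : ℝ) < m0} :=
      measurableSet_cnt t0 {k : ℕ | (k : ℝ) < m0}
    rw [hc, pr_compl (hat.trans hzt) hmeas]
    obtain ⟨p0, p1⟩ := frac_mem hat hzt
    set p := (t0 - a) / (z j - a) with hp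
    have hcast : ((j - i : ℕ) : ℝ) = (j : ℝ) - i := by
      rw [Nat.cast_sub (by omega)]
    set μ0 : ℝ := (((min j e : ℕ) : ℝ) - i) * p with hμ0
    have hmu' : m0 < μ0 := hmu _ hs1 hs2
    have hvar' : μ0 * (1 - p) ≤ (μ0 - m0) ^ 2 / 2 := hvar _ hs1 hs2
    have hle : μ0 ≤ ((j - i : ℕ) : ℝ) * p := by
      rw [hcast]
      have : ((min j e : ℕ) : ℝ) ≤ j := by exact_mod_cast min_le_left j e
      exact mul_le_mul_of_nonneg_right (by linarith) p0.le
    have hch := cheb_lower hat hzt (j - i) (m0 := m0) (by linarith)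
    rw [← hp] at hch
    set μ1 : ℝ := ((j - i : ℕ) : ℝ) * p with hμ1
    have : μ1 * (1 - p) / (μ1 - m0) ^ 2 ≤ 1 / 2 := by
      rw [div_le_iff₀ (by nlinarith)]
      -- (μ1 - m0)^2/μ1 is increasing
      have hmupos : 0 < μ0 := lt_of_le_of_lt hm0 hmu'
      have key : μ1 * (μ0 - m0) ^ 2 ≤ μ0 * (μ1 - m0) ^ 2 := by
        have : μ0 * (μ1 - m0) ^ 2 - μ1 * (μ0 - m0) ^ 2 = (μ1 - μ0) * (μ0 * μ1 - m0 ^ 2) := by ring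
        have h8 : m0 ^ 2 ≤ μ0 * μ1 := by nlinarith
        nlinarith [mul_nonneg (sub_nonneg.2 hle) (sub_nonneg.2 h8)]
      have h9 : μ0 * (μ1 * (1 - p)) ≤ μ0 * (1 / 2 * (μ1 - m0) ^ 2) := by
        have : μ1 * (μ0 * (1 - p)) ≤ μ1 * ((μ0 - m0) ^ 2 / 2) :=
          mul_le_mul_of_nonneg_left hvar' (by linarith)
        nlinarith
      exact le_of_mul_le_mul_left h9 hmupos
    linarith
  have := pr_nonneg N a d {u | cnt u (z j) = j - i ∧ u ∈ NC (Finset.Ioc j (N + i)) z i}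
  nlinarith

/-- Ottaviani with Chebyshev -/
lemma ottaviani_cheb {N i s e : ℕ} {a d t0 m0 : ℝ} (his : i ≤ s) (heN : e ≤ N + i) (y : ℕ → ℝ)
    (hat : a < t0) (htd : t0 < d) (hy : ∀ j j', s < j → j ≤ j' → j' ≤ e → y j ≤ y j')
    (hty : ∀ j, s < j → j ≤ e → t0 < y j) (hyd : ∀ j, s < j → j ≤ e → y j < d) (hm0 : 0 ≤ m0)
    (hN : N * ((t0 - a) / (d - a)) < m0)
    (hmu : ∀ j, s < j → j ≤ e → m0 < ((j : ℝ) - i) * ((t0 - a) / (y j - a)))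
    (hvar : ∀ j, s < j → j ≤ e →
      ((j : ℝ) - i) * ((t0 - a) / (y j - a)) * (1 - (t0 - a) / (y j - a)) ≤
        (((j : ℝ) - i) * ((t0 - a) / (y j - a)) - m0) ^ 2 / 2) :
    1 - 2 * (N * ((t0 - a) / (d - a)) * (1 - (t0 - a) / (d - a)) /
        (m0 - N * ((t0 - a) / (d - a))) ^ 2) ≤ pr N a d (NC (Finset.Ioc s e) y i) := by
  have h1 := ottaviani (d := d) his heN y hat hy hty hyd hm0 hmu hvar
  have h2 := cheb_upper hat htd N hN
  rw [pr_compl (hat.trans htd) (measurableSet_NC _ _ _)] at h1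
  linarith

end

end BJ

open MeasureTheory Filter Set

namespace BJ

noncomputable section

lemma harris1 (μ : Measure ℝ) [IsProbabilityMeasure μ] (f g : ℝ → ℝ) (hf : Monotone f)
    (hg : Monotone g) (hf0 : ∀ x, 0 ≤ f x ∧ f x ≤ 1) (hg0 : ∀ x, 0 ≤ g x ∧ g x ≤ 1) :
    (∫ x, f x ∂μ) * (∫ x, g x ∂μ) ≤ ∫ x, f x * g x ∂μ := by
  have mf : Measurable f := hf.measurable
  have mg : Measurable g := hg.measurable
  have bdd : ∀ h : ℝ → ℝ, Measurable h → (∀ x, 0 ≤ h x ∧ h x ≤ 1) → Integrable h μ := by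
    intro h mh h0
    refine Integrable.of_bound mh.aestronglyMeasurable 1 (Eventually.of_forall fun x => ?_)
    rw [Real.norm_eq_abs, abs_le]; constructor <;> linarith [(h0 x).1, (h0 x).2]
  have If := bdd f mf hf0
  have Ig := bdd g mg hg0
  have Ifg : Integrable (fun x => f x * g x) μ := bdd _ (mf.mul mg) fun x =>
    ⟨mul_nonneg (hf0 x).1 (hg0 x).1, mul_le_one₀ (hf0 x).2 (hg0 x).1 (hg0 x).2⟩
  set F := ∫ x, f x ∂μ
  set G := ∫ x, g x ∂μ
  set H := ∫ x, f x * g x ∂μ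
  have h1 : ∀ x, 0 ≤ f x * g x - f x * G - F * g x + H := by
    intro x
    have : 0 ≤ ∫ y, (f x - f y) * (g x - g y) ∂μ := by
      refine integral_nonneg fun y => ?_
      rcases le_total x y with h | h
      · have := hf h; have := hg h
        show 0 ≤ (f x - f y) * (g x - g y)
        nlinarith
      · have := hf h; have := hg h
        show 0 ≤ (f x - f y) * (g x - g y)
        nlinarith
    have e : (fun y => (f x - f y) * (g x - g y)) =
      fun y => f x * g x - f x * g y - f y * g x + f y * g y := by funext y; ring
    rw [e, integral_add, integral_sub, integral_sub,
      integral_const_mul (f x) g, integral_mul_const (g x) f] at this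
    · simp only [integral_const, probReal_univ, smul_eq_mul, one_mul] at this
      exact this
    · exact integrable_const _
    · exact Ig.const_mul _
    · exact (integrable_const _).sub (Ig.const_mul _)
    · exact If.mul_const _
    · exact ((integrable_const _).sub (Ig.const_mul _)).sub (If.mul_const _)
    · exact Ifg
  have h2 : 0 ≤ ∫ x, (f x * g x - f x * G - F * g x + H) ∂μ := integral_nonneg h1
  rw [integral_add, integral_sub, integral_sub, integral_const_mul, integral_mul_const] at h2
  · simp only [integral_const, probReal_univ, smul_eq_mul, one_mul] at h2
    change 0 ≤ H - F * G - F * G + H at h2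
    linarith
  · exact Ifg
  · exact If.mul_const _
  · exact Ifg.sub (If.mul_const _)
  · exact Ig.const_mul _
  · exact (Ifg.sub (If.mul_const _)).sub (Ig.const_mul _)
  · exact integrable_const _

lemma harris (μ : Measure ℝ) [IsProbabilityMeasure μ] : ∀ (m : ℕ) (f g : (Fin m → ℝ) → ℝ),
    Monotone f → Monotone g → Measurable f → Measurable g →
    (∀ x, 0 ≤ f x ∧ f x ≤ 1) → (∀ x, 0 ≤ g x ∧ g x ≤ 1) →
    (∫ x, f x ∂(Measure.pi fun _ => μ)) * (∫ x, g x ∂(Measure.pi fun _ => μ)) ≤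
      ∫ x, f x * g x ∂(Measure.pi fun _ => μ) := by
  intro m
  induction m with
  | zero =>
    intro f g _ _ _ _ _ _
    have h : ∀ h : (Fin 0 → ℝ) → ℝ, (∫ x, h x ∂(Measure.pi fun _ => μ)) = h default := by
      intro h
      have : h = fun _ => h default := by funext x; congr 1; exact Subsingleton.elim _ _
      rw [this]; simp
    rw [h, h, h]
  | succ m ih =>
    intro f g hf hg mf mg hf0 hg0
    have hp := (measurePreserving_piFinSuccAbove (fun _ : Fin (m + 1) => μ) 0).symm
    have emb := (MeasurableEquiv.piFinSuccAbove (fun _ : Fin (m + 1) => ℝ) 0).symm.measurableEmbedding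
    set e := (MeasurableEquiv.piFinSuccAbove (fun _ : Fin (m + 1) => ℝ) 0).symm with he
    have bdd : ∀ h : ℝ × (Fin m → ℝ) → ℝ, Measurable h → (∀ x, 0 ≤ h x ∧ h x ≤ 1) →
        Integrable h (μ.prod (Measure.pi fun _ => μ)) := by
      intro h mh h0
      refine Integrable.of_bound mh.aestronglyMeasurable 1 (Eventually.of_forall fun x => ?_)
      rw [Real.norm_eq_abs, abs_le]; constructor <;> linarith [(h0 x).1, (h0 x).2]
    have bdd' : ∀ h : (Fin m → ℝ) → ℝ, Measurable h → (∀ x, 0 ≤ h x ∧ h x ≤ 1) →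
        Integrable h (Measure.pi fun _ => μ) := by
      intro h mh h0
      refine Integrable.of_bound mh.aestronglyMeasurable 1 (Eventually.of_forall fun x => ?_)
      rw [Real.norm_eq_abs, abs_le]; constructor <;> linarith [(h0 x).1, (h0 x).2]
    have key : ∀ h : (Fin (m + 1) → ℝ) → ℝ, Measurable h → (∀ x, 0 ≤ h x ∧ h x ≤ 1) →
        ∫ x, h x ∂(Measure.pi fun _ => μ) = ∫ x, ∫ v, h (e (x, v)) ∂(Measure.pi fun _ => μ) ∂μ := by
      intro h mh h0
      rw [← hp.integral_comp emb]
      exact integral_prod _ (bdd _ (mh.comp e.measurable) fun x => h0 _)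
    have mono_e : Monotone e := by
      intro p q hpq j
      refine Fin.cases ?_ (fun j => ?_) j
      · exact hpq.1
      · exact hpq.2 j
    have mfg : Measurable (fun x => f x * g x) := mf.mul mg
    have hfg0 : ∀ x, 0 ≤ f x * g x ∧ f x * g x ≤ 1 := fun x =>
      ⟨mul_nonneg (hf0 x).1 (hg0 x).1, mul_le_one₀ (hf0 x).2 (hg0 x).1 (hg0 x).2⟩
    rw [key f mf hf0, key g mg hg0, key _ mfg hfg0]
    have sec : ∀ x : ℝ, Measurable (fun v => e (x, v)) := fun x =>
      e.measurable.comp measurable_prodMk_left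
    have bnd : ∀ h : (Fin (m + 1) → ℝ) → ℝ, Measurable h → (∀ x, 0 ≤ h x ∧ h x ≤ 1) → ∀ x,
        0 ≤ ∫ v, h (e (x, v)) ∂(Measure.pi fun _ => μ) ∧
        ∫ v, h (e (x, v)) ∂(Measure.pi fun _ => μ) ≤ 1 := by
      intro h mh h0 x
      refine ⟨integral_nonneg fun v => (h0 _).1, ?_⟩
      calc _ ≤ ∫ v : Fin m → ℝ, (1:ℝ) ∂(Measure.pi fun _ => μ) :=
            integral_mono (bdd' _ (mh.comp (sec x)) fun v => h0 _) (integrable_const _)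
              fun v => (h0 _).2
        _ = 1 := by simp
    have mon : ∀ h : (Fin (m + 1) → ℝ) → ℝ, Monotone h → Measurable h → (∀ x, 0 ≤ h x ∧ h x ≤ 1) →
        Monotone fun x => ∫ v, h (e (x, v)) ∂(Measure.pi fun _ => μ) := by
      intro h hh mh h0 x x' hxx
      exact integral_mono (bdd' _ (mh.comp (sec x)) fun v => h0 _)
        (bdd' _ (mh.comp (sec x')) fun v => h0 _) fun v => hh (mono_e ⟨hxx, le_refl _⟩)
    refine (harris1 μ _ _ (mon f hf mf hf0) (mon g hg mg hg0) (bnd f mf hf0) (bnd g mg hg0)).trans ?_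
    refine integral_mono_of_nonneg (Eventually.of_forall fun x =>
      mul_nonneg (bnd f mf hf0 x).1 (bnd g mg hg0 x).1) ?_ (Eventually.of_forall fun x => ?_)
    · exact (bdd _ (mfg.comp e.measurable) fun x => hfg0 _).integral_prod_left
    · exact ih _ _ (fun v w hvw => hf (mono_e ⟨le_refl _, hvw⟩))
        (fun v w hvw => hg (mono_e ⟨le_refl _, hvw⟩)) (mf.comp (sec x)) (mg.comp (sec x))
        (fun v => hf0 _) (fun v => hg0 _)

lemma cnt_anti {ι : Type*} [Fintype ι] {u v : ι → ℝ} (h : u ≤ v) (t : ℝ) : cnt v t ≤ cnt u t := by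
  unfold cnt
  exact Finset.card_le_card (fun j hj => by
    simp only [Finset.mem_filter, Finset.mem_univ, true_and] at hj ⊢; exact (h j).trans_lt hj)

lemma harris_NC {m : ℕ} {a d : ℝ} (had : a < d) (J J' : Finset ℕ) (y y' : ℕ → ℝ) (i i' : ℕ) :
    pr m a d (NC J y i) * pr m a d (NC J' y' i') ≤ pr m a d (NC J y i ∩ NC J' y' i') := by
  classical
  have := uni_prob had
  have mono : ∀ (J : Finset ℕ) (y : ℕ → ℝ) (i : ℕ),
      Monotone ((NC J y i : Set (Fin m → ℝ)).indicator (fun _ => (1:ℝ))) := by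
    intro J y i u v huv
    by_cases hu : u ∈ (NC J y i : Set (Fin m → ℝ))
    · have hv : v ∈ (NC J y i : Set (Fin m → ℝ)) := by
        intro j hj
        have h1 := hu j hj
        have h2 := cnt_anti huv (y j)
        omega
      simp [hu, hv]
    · simp only [indicator_of_notMem hu]
      exact indicator_nonneg (fun _ _ => zero_le_one) _
  have bd : ∀ (S : Set (Fin m → ℝ)) x, 0 ≤ S.indicator (fun _ => (1:ℝ)) x ∧
      S.indicator (fun _ => (1:ℝ)) x ≤ 1 := by
    intro S x
    refine ⟨indicator_nonneg (fun _ _ => zero_le_one) _, ?_⟩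
    by_cases h : x ∈ S <;> simp [h]
  have h := harris (uni a d) m _ _ (mono J y i) (mono J' y' i')
    (measurable_const.indicator (measurableSet_NC J y i))
    (measurable_const.indicator (measurableSet_NC J' y' i')) (bd _) (bd _)
  have e : (fun x => (NC J y i : Set (Fin m → ℝ)).indicator (fun _ => (1:ℝ)) x *
      (NC J' y' i' : Set (Fin m → ℝ)).indicator (fun _ => (1:ℝ)) x) =
      (NC J y i ∩ NC J' y' i').indicator (fun _ => (1:ℝ)) := by
    funext x
    by_cases h1 : x ∈ (NC J y i : Set (Fin m → ℝ)) <;>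
      by_cases h2 : x ∈ (NC J' y' i' : Set (Fin m → ℝ)) <;> simp [h1, h2]
  rw [e, integral_indicator_const _ (measurableSet_NC J y i),
    integral_indicator_const _ (measurableSet_NC J' y' i'),
    integral_indicator_const _ ((measurableSet_NC J y i).inter (measurableSet_NC J' y' i'))] at h
  simpa [pr] using h

lemma drop_point (N : ℕ) {a d : ℝ} (had : a < d) (J : Finset ℕ) (y : ℕ → ℝ) (i : ℕ) :
    pr N a d (NC J y (i + 1)) ≤ pr (N + 1) a d (NC J y i) := by
  have := uni_prob had
  have hp := (measurePreserving_piFinSuccAbove (fun _ : Fin (N + 1) => uni a d) 0)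
  have h1 : pr N a d (NC J y (i + 1)) = (Measure.pi fun _ : Fin (N + 1) => uni a d).real
      ((MeasurableEquiv.piFinSuccAbove (fun _ : Fin (N + 1) => ℝ) 0) ⁻¹' (univ ×ˢ NC J y (i + 1))) := by
    rw [measureReal_def, hp.measure_preimage_equiv]
    simp [pr, measureReal_def]
  rw [h1]
  refine measureReal_mono ?_
  intro u hu j hj
  have h2 := hu.2 j hj
  have h3 : cnt u (y j) ≤ cnt ((MeasurableEquiv.piFinSuccAbove (fun _ : Fin (N + 1) => ℝ) 0) u).2 (y j)
      + 1 := by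
    have e : ((MeasurableEquiv.piFinSuccAbove (fun _ : Fin (N + 1) => ℝ) 0) u).2 = fun j => u j.succ := rfl
    rw [e]
    unfold cnt
    rw [Finset.card_filter, Finset.card_filter, Fin.sum_univ_succ]
    dsimp only
    split_ifs <;> omega
  omega

lemma binpmf_shift (N k : ℕ) {p : ℝ} (hp : p ≠ 0) :
    binpmf N p k = binpmf (N + 1) p (k + 1) * ((k + 1 : ℕ) / ((N + 1) * p)) := by
  unfold binpmf
  have h := Nat.add_one_mul_choose_eq N k
  have h' : ((N : ℝ) + 1) * (N.choose k) = ((N + 1).choose (k + 1)) * (k + 1) := by exact_mod_cast h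
  have : N + 1 - (k + 1) = N - k := by omega
  rw [this]
  have hN : (N : ℝ) + 1 ≠ 0 := by positivity
  field_simp
  push_cast
  linear_combination p ^ (k + 1) * (1 - p) ^ (N - k) * h'

lemma pr_NC_eq_sum {a t d : ℝ} (hat : a < t) (htd : t < d) (n : ℕ) (J : Finset ℕ) (y : ℕ → ℝ)
    (hy : ∀ j ∈ J, t ≤ y j) (i : ℕ) :
    pr n a d (NC J y i) = ∑ k ∈ Finset.range (n + 1),
      binpmf n ((t - a) / (d - a)) k * pr (n - k) t d (NC J y (i + k)) := by
  have h1 : (NC J y i : Set (Fin n → ℝ)) = ⋃ k ∈ Finset.range (n + 1), {u | cnt u t = k ∧ u ∈ NC J y i} := by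
    ext u
    simp only [mem_iUnion, Finset.mem_range, exists_prop, mem_ofPred_eq]
    constructor
    · intro h; exact ⟨_, Nat.lt_succ_of_le (cnt_le u t), rfl, h⟩
    · rintro ⟨k, _, _, h⟩; exact h
  rw [pr, h1, measureReal_biUnion_finset]
  · refine Finset.sum_congr rfl fun k hk => ?_
    rw [← split_NC hat htd n k (by simp at hk; omega) J y hy i]
    rfl
  · intro k _ k' _ hkk'
    rw [Function.onFun, Set.disjoint_left]
    intro u hu hu'
    exact hkk' (hu.1.symm.trans hu'.1)
  · intro k _
    exact (measurableSet_cnt t {k}).inter (measurableSet_NC _ _ _)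

lemma mixing {a t d : ℝ} (hat : a < t) (htd : t < d) (N : ℕ) (J : Finset ℕ) (y : ℕ → ℝ)
    (hy : ∀ j ∈ J, t ≤ y j) (i : ℕ) :
    pr (N + 1) a d (NC J y i) - pr N a d (NC J y (i + 1)) ≤
      √((1 - (t - a) / (d - a)) / ((N + 1) * ((t - a) / (d - a)))) := by
  obtain ⟨p0, p1⟩ := frac_mem hat htd
  rw [pr_NC_eq_sum hat htd (N + 1) J y hy, pr_NC_eq_sum hat htd N J y hy]
  set p := (t - a) / (d - a) with hp
  have hN : (0:ℝ) < (N + 1) * p := by positivity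
  have h1 : ∑ k ∈ Finset.range (N + 1), binpmf N p k * pr (N - k) t d (NC J y (i + 1 + k)) =
      ∑ k ∈ Finset.range (N + 1 + 1), binpmf (N + 1) p k * (k / ((N + 1) * p)) *
        pr (N + 1 - k) t d (NC J y (i + k)) := by
    rw [Finset.sum_range_succ' _ (N + 1)]
    simp only [Nat.cast_zero, zero_div, mul_zero, zero_mul, add_zero]
    refine Finset.sum_congr rfl fun k _ => ?_
    rw [binpmf_shift N k p0.ne']
    have e1 : N + 1 - (k + 1) = N - k := by omega
    have e2 : i + (k + 1) = i + 1 + k := by ring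
    rw [e1, e2]
  rw [h1, ← Finset.sum_sub_distrib]
  have h2 : ∀ k ∈ Finset.range (N + 1 + 1),
      binpmf (N + 1) p k * pr (N + 1 - k) t d (NC J y (i + k)) -
      binpmf (N + 1) p k * (k / ((N + 1) * p)) * pr (N + 1 - k) t d (NC J y (i + k)) ≤
      (√(binpmf (N + 1) p k)) * (√(binpmf (N + 1) p k) * |(k : ℝ) - (N + 1 : ℕ) * p|) / ((N + 1) * p) := by
    intro k _
    have hb := binpmf_nonneg (n := N + 1) p0.le p1.le k
    rw [← mul_assoc, Real.mul_self_sqrt hb]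
    have hq0 := pr_nonneg (N + 1 - k) t d (NC J y (i + k))
    have hq1 := pr_le_one htd (N + 1 - k) (NC J y (i + k))
    set q := pr (N + 1 - k) t d (NC J y (i + k))
    have : binpmf (N + 1) p k * q - binpmf (N + 1) p k * (k / ((N + 1) * p)) * q =
      binpmf (N + 1) p k * (q * (((N + 1) * p) - k)) / ((N + 1) * p) := by
      field_simp
    rw [this]
    gcongr
    push_cast
    rw [abs_sub_comm]
    calc q * ((N + 1) * p - k) ≤ q * |(N + 1) * p - k| := by gcongr; exact le_abs_self _
      _ ≤ 1 * |(N + 1) * p - k| := by gcongr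
      _ = _ := one_mul _
  refine (Finset.sum_le_sum h2).trans ?_
  rw [← Finset.sum_div]
  have h3 := Finset.sum_mul_sq_le_sq_mul_sq (Finset.range (N + 1 + 1))
    (fun k => √(binpmf (N + 1) p k)) (fun k => √(binpmf (N + 1) p k) * |(k : ℝ) - (N + 1 : ℕ) * p|)
  have h4 : ∑ k ∈ Finset.range (N + 1 + 1), √(binpmf (N + 1) p k) ^ 2 = 1 := by
    rw [← binpmf_sum (N + 1) p]
    exact Finset.sum_congr rfl fun k _ => Real.sq_sqrt (binpmf_nonneg p0.le p1.le k)
  have h5 : ∑ k ∈ Finset.range (N + 1 + 1), (√(binpmf (N + 1) p k) * |(k : ℝ) - (N + 1 : ℕ) * p|) ^ 2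
      = (N + 1) * p * (1 - p) := by
    have := binpmf_var (N + 1) p
    push_cast at this ⊢
    rw [← this]
    refine Finset.sum_congr rfl fun k _ => ?_
    rw [mul_pow, Real.sq_sqrt (binpmf_nonneg p0.le p1.le k), sq_abs]
    ring
  rw [h4, h5, one_mul] at h3
  have h6 := Real.le_sqrt_of_sq_le h3
  rw [div_le_iff₀ hN]
  refine h6.trans (le_of_eq ?_)
  rw [Real.sqrt_eq_iff_mul_self_eq (by have : 0 ≤ 1 - p := by linarith
                                       positivity) (by positivity)]
  rw [show ∀ r : ℝ, r * ((N + 1) * p) * (r * ((N + 1) * p)) = r * r * ((N+1)*p)^2 by intro r; ring]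
  rw [Real.mul_self_sqrt (by have : 0 ≤ 1 - p := by linarith
                             positivity)]
  field_simp

end

end BJ

open MeasureTheory Filter Set

namespace BJ

noncomputable section

/-- the weights in the Abel identity -/
def abelw (ρ h : ℝ) (k : ℕ) : ℝ := if k = 0 then 1 else ρ * (ρ + k * h) ^ (k - 1)

lemma abel_zero (ρ : ℝ) {h : ℝ} (hh : h ≠ 0) (m : ℕ) (hm : 0 < m) :
    ∑ k ∈ Finset.range (m + 1), (m.choose k : ℝ) * abelw ρ h k * (-ρ - k * h) ^ (m - k) = 0 := by
  have h1 := fwdDiff_iter_pow_eq_zero_of_lt (R := ℝ) (j := m - 1) (n := m) (by omega)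
  have key : ∑ k ∈ Finset.range (m + 1), ((-1:ℝ)^(m-k) * m.choose k) * (ρ + k * h) ^ (m - 1) = 0 := by
    have h2 := congrFun h1 (ρ / h)
    rw [fwdDiff_iter_eq_sum_shift] at h2
    simp only [zsmul_eq_mul, nsmul_eq_mul, mul_one, Pi.zero_apply] at h2
    push_cast at h2
    have h3 : ∀ k ∈ Finset.range (m + 1), ((-1:ℝ)^(m-k) * m.choose k) * (ρ + k * h) ^ (m - 1) =
        h ^ (m - 1) * (((-1:ℝ)^(m-k) * m.choose k) * (ρ / h + k) ^ (m - 1)) := by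
      intro k _
      have : ρ + k * h = h * (ρ / h + k) := by field_simp
      rw [this, mul_pow]; ring
    rw [Finset.sum_congr rfl h3, ← Finset.mul_sum, h2, mul_zero]
  have : ∀ k ∈ Finset.range (m + 1), (m.choose k : ℝ) * abelw ρ h k * (-ρ - k * h) ^ (m - k) =
     ρ * (((-1:ℝ)^(m-k) * m.choose k) * (ρ + k * h) ^ (m - 1)) := by
    intro k hk
    simp only [Finset.mem_range] at hk
    have e : -ρ - k * h = (-1) * (ρ + k * h) := by ring
    rw [e, mul_pow]
    unfold abelw
    split_ifs with h0
    · subst h0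
      simp only [Nat.choose_zero_right, Nat.cast_one, Nat.cast_zero, zero_mul, add_zero, Nat.sub_zero]
      obtain ⟨m', rfl⟩ : ∃ m', m = m' + 1 := ⟨m - 1, by omega⟩
      simp only [Nat.add_sub_cancel, pow_succ]; ring
    · have : m - 1 = (k - 1) + (m - k) := by omega
      rw [this, pow_add]; ring
  rw [Finset.sum_congr rfl this, ← Finset.mul_sum, key, mul_zero]

lemma abel (ρ : ℝ) {h : ℝ} (hh : h ≠ 0) : ∀ (m : ℕ) (y : ℝ),
    ∑ k ∈ Finset.range (m + 1), (m.choose k : ℝ) * abelw ρ h k * (y - k * h) ^ (m - k) =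
      (ρ + y) ^ m := by
  intro m
  induction m with
  | zero => intro y; simp [abelw]
  | succ m ih =>
    intro y
    let F : ℝ → ℝ := fun y => ∑ k ∈ Finset.range (m + 1 + 1),
      ((m + 1).choose k : ℝ) * abelw ρ h k * (y - k * h) ^ (m + 1 - k) - (ρ + y) ^ (m + 1)
    have hd : ∀ y, HasDerivAt F 0 y := by
      intro y
      have h1 : HasDerivAt F (∑ k ∈ Finset.range (m + 1 + 1),
        ((m + 1).choose k : ℝ) * abelw ρ h k * (((m + 1 - k : ℕ) : ℝ) * (y - k * h) ^ (m + 1 - k - 1))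
          - ((m + 1 : ℕ) : ℝ) * (ρ + y) ^ m) y := by
        refine HasDerivAt.sub (HasDerivAt.fun_sum fun k _ => ?_) ?_
        · refine HasDerivAt.const_mul _ ?_
          have := ((hasDerivAt_id y).sub_const (k * h)).fun_pow (m + 1 - k)
          simpa using this
        · have := ((hasDerivAt_id y).const_add ρ).fun_pow (m + 1)
          simpa using this
      convert h1 using 1
      rw [Finset.sum_range_succ]
      simp only [Nat.sub_self, Nat.cast_zero, zero_mul, mul_zero, add_zero]
      rw [← ih y, Finset.mul_sum, ← Finset.sum_sub_distrib]
      symm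
      refine Finset.sum_eq_zero fun k hk => ?_
      simp only [Finset.mem_range] at hk
      have e : m + 1 - k - 1 = m - k := by omega
      rw [e]
      have h2 := Nat.choose_mul_succ_eq m k
      have h2' : (m.choose k : ℝ) * (m + 1) = ((m + 1).choose k) * ((m + 1 - k : ℕ) : ℝ) := by
        exact_mod_cast h2
      push_cast
      linear_combination (-(abelw ρ h k) * (y - k * h) ^ (m - k)) * h2'
    have hc := is_const_of_deriv_eq_zero (fun y => (hd y).differentiableAt) (fun y => (hd y).deriv) y (-ρ)
    have h0 : F (-ρ) = 0 := by
      show _ - _ = _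
      rw [abel_zero ρ hh (m + 1) (by omega)]
      simp
    rw [h0] at hc
    exact sub_eq_zero.1 hc

lemma daniels {h : ℝ} (hh : 0 < h) : ∀ (N i : ℕ) (a d : ℝ), a + N * h < d →
    pr N a d (NC (Finset.Ioc i (N + i)) (fun j => a + ((j : ℝ) - i) * h) i) = 1 - N * h / (d - a) := by
  intro N
  induction N using Nat.strong_induction_on with
  | _ N ih =>
  intro i a d had
  have hNh : 0 ≤ N * h := by positivity
  have had' : a < d := by linarith
  set y : ℕ → ℝ := fun j => a + ((j : ℝ) - i) * h with hy
  have hymono : ∀ j j', i < j → j ≤ j' → j' ≤ N + i → y j ≤ y j' := by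
    intro j j' _ h2 _
    have : (j : ℝ) ≤ j' := by exact_mod_cast h2
    simp only [hy]; gcongr
  have h1 := last_crossing (N := N) (a := a) (d := d) (le_refl i) y hymono univ MeasurableSet.univ
  simp only [univ_inter] at h1
  rw [pr_compl had' (measurableSet_NC _ _ _)] at h1
  have h2 : ∑ j ∈ Finset.Ioc i (N + i),
      pr N a d {u | cnt u (y j) = j - i ∧ u ∈ NC (Finset.Ioc j (N + i)) y i} = N * h / (d - a) := by
    set ℓ := d - a with hℓ
    have hℓ0 : 0 < ℓ := by linarith
    have h3 : ∀ j ∈ Finset.Ioc i (N + i),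
      pr N a d {u | cnt u (y j) = j - i ∧ u ∈ NC (Finset.Ioc j (N + i)) y i} =
        binpmf N (((j - i : ℕ) : ℝ) * h / ℓ) (j - i) *
          (1 - ((N - (j - i) : ℕ) : ℝ) * h / (ℓ - ((j - i : ℕ) : ℝ) * h)) := by
      intro j hj
      simp only [Finset.mem_Ioc] at hj
      set k := j - i with hk
      have hkj : j = k + i := by omega
      have hkc : (j : ℝ) - i = k := by rw [hkj]; push_cast; ring
      have hk0 : (0:ℝ) < k := by exact_mod_cast (by omega : 0 < k)
      have hkN : (k : ℝ) ≤ N := by exact_mod_cast (by omega : k ≤ N)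
      have hay : a < y j := by simp only [hy, hkc]; have := mul_pos hk0 hh; linarith
      have hyd : y j < d := by
        simp only [hy, hkc]
        have : (k : ℝ) * h ≤ N * h := by gcongr
        linarith
      rw [split_NC hay hyd N k (by omega) _ _ (fun j' hj' => by
        simp only [Finset.mem_Ioc] at hj'; exact hymono _ _ hj.1 hj'.1.le hj'.2)]
      have e1 : i + k = j := by omega
      have e2 : (y j - a) / ℓ = k * h / ℓ := by simp only [hy, hkc]; ring
      have e3 : d - y j = ℓ - k * h := by simp only [hy, hkc, hℓ]; ring
      have hcast : ((N - k : ℕ) : ℝ) = N - k := by rw [Nat.cast_sub (by omega)]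
      have := ih (N - k) (by omega) j (y j) d (by
        rw [hcast]; simp only [hy, hkc]; linarith)
      have e4 : N - k + j = N + i := by omega
      have e5 : (fun j' : ℕ => y j + ((j' : ℝ) - j) * h) = y := by
        funext j'; simp only [hy]; ring
      rw [e4, e5, e3] at this
      rw [e1, ← e2, ← hℓ, this]
    rw [Finset.sum_congr rfl h3]
    have h4 : ∑ j ∈ Finset.Ioc i (N + i), binpmf N (((j - i : ℕ) : ℝ) * h / ℓ) (j - i) *
          (1 - ((N - (j - i) : ℕ) : ℝ) * h / (ℓ - ((j - i : ℕ) : ℝ) * h)) =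
        ∑ k ∈ Finset.Ioc 0 N, binpmf N ((k : ℝ) * h / ℓ) k *
          (1 - ((N - k : ℕ) : ℝ) * h / (ℓ - (k : ℝ) * h)) := by
      symm
      apply Finset.sum_bij (fun k _ => k + i)
      · intro k hk; simp only [Finset.mem_Ioc] at hk ⊢; omega
      · intro k _ k' _ hkk; omega
      · intro j hj; simp only [Finset.mem_Ioc] at hj
        exact ⟨j - i, by simp only [Finset.mem_Ioc]; omega, by omega⟩
      · intro k _; simp
    rw [h4]
    have h5 : ∑ k ∈ Finset.Ioc 0 N, binpmf N ((k : ℝ) * h / ℓ) k *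
          (1 - ((N - k : ℕ) : ℝ) * h / (ℓ - (k : ℝ) * h)) =
        ∑ k ∈ Finset.Ioc 0 N, ((N.choose (N - k) : ℝ) * abelw (ℓ - N * h) h (N - k) *
          (N * h - (N - k : ℕ) * h) ^ (N - (N - k))) / ℓ ^ N := by
      refine Finset.sum_congr rfl fun k hk => ?_
      simp only [Finset.mem_Ioc] at hk
      have hcast : ((N - k : ℕ) : ℝ) = N - k := by rw [Nat.cast_sub (by omega)]
      have hkN : (k : ℝ) * h ≤ N * h := by
        have : (k : ℝ) ≤ N := by exact_mod_cast hk.2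
        gcongr
      have hpos : 0 < ℓ - k * h := by linarith
      rw [Nat.choose_symm hk.2, hcast, show N - (N - k) = k by omega]
      unfold binpmf abelw
      have e1 : 1 - (k : ℝ) * h / ℓ = (ℓ - k * h) / ℓ := by field_simp
      have e2 : 1 - ((N : ℝ) - k) * h / (ℓ - k * h) = (ℓ - N * h) / (ℓ - k * h) := by
        field_simp; ring
      have e3 : ℓ ^ N = ℓ ^ k * ℓ ^ (N - k) := by rw [← pow_add]; congr 1; omega
      rw [e1, e2, e3, div_pow, div_pow]
      split_ifs with h0
      · have : k = N := by omega
        subst this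
        have : ℓ - k * h ≠ 0 := hpos.ne'
        simp only [Nat.sub_self, pow_zero]
        field_simp
        ring
      · have e4 : (ℓ - k * h) ^ (N - k) = (ℓ - k * h) ^ (N - k - 1) * (ℓ - k * h) := by
          rw [← pow_succ]; congr 1; omega
        rw [e4, hcast]
        have e5 : ℓ - N * h + (N - k) * h = ℓ - k * h := by ring
        have e6 : (N:ℝ) * h - (N - k) * h = k * h := by ring
        rw [e5, e6]
        have : ℓ - k * h ≠ 0 := hpos.ne'
        field_simp
    rw [h5, ← Finset.sum_div]
    have h6 := abel (ℓ - N * h) hh.ne' N (N * h)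
    rw [Finset.sum_range_succ] at h6
    have h7 : ∑ k ∈ Finset.Ioc 0 N, ((N.choose (N - k) : ℝ) * abelw (ℓ - N * h) h (N - k) *
          (N * h - (N - k : ℕ) * h) ^ (N - (N - k))) =
        ∑ k ∈ Finset.range N, (N.choose k : ℝ) * abelw (ℓ - N * h) h k * (N * h - k * h) ^ (N - k) := by
      apply Finset.sum_bij (fun k _ => N - k)
      · intro k hk; simp only [Finset.mem_Ioc, Finset.mem_range] at hk ⊢; omega
      · intro k hk k' hk' hkk; simp only [Finset.mem_Ioc] at hk hk'; omega
      · intro j hj; simp only [Finset.mem_range] at hj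
        exact ⟨N - j, by simp only [Finset.mem_Ioc]; omega, by omega⟩
      · intro k _; rfl
    rw [h7]
    simp only [Nat.choose_self, Nat.cast_one, one_mul, Nat.sub_self, pow_zero, mul_one,
      sub_add_cancel] at h6
    rw [eq_sub_of_add_eq h6]
    unfold abelw
    split_ifs with h0
    · subst h0; simp
    · rw [sub_add_cancel]
      obtain ⟨N', rfl⟩ : ∃ N', N = N' + 1 := ⟨N - 1, by omega⟩
      simp only [Nat.add_sub_cancel, pow_succ]
      field_simp
      ring
  rw [h2] at h1
  linarith

end

end BJ

open MeasureTheory Filter Set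

namespace BJ

noncomputable section

/-- upper binomial tail -/
def B (n j : ℕ) (t : ℝ) : ℝ := ∑ k ∈ Finset.Icc j n, binpmf n t k

lemma B_eq_pr {n j : ℕ} {t : ℝ} (h0 : 0 < t) (h1 : t < 1) : B n j t = pr n 0 1 {u | j ≤ cnt u t} := by
  classical
  rw [pr_cnt_mem h0 h1 n (fun k => j ≤ k)]
  simp only [sub_zero, div_one]
  unfold B
  refine Finset.sum_congr ?_ fun _ _ => rfl
  ext k; simp; omega

lemma hasDerivAt_binpmf (n k : ℕ) (hk : k ≤ n) (hk0 : 0 < k) (t : ℝ) :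
    HasDerivAt (fun t => binpmf (n + 1) t k) ((n + 1) * (binpmf n t (k - 1) - binpmf n t k)) t := by
  have h1 : HasDerivAt (fun t : ℝ => binpmf (n + 1) t k)
      (((n + 1).choose k * (k * t ^ (k - 1))) * (1 - t) ^ (n + 1 - k) +
       ((n + 1).choose k * t ^ k) * (((n + 1 - k : ℕ) : ℝ) * (1 - t) ^ (n + 1 - k - 1) * (-1))) t := by
    unfold binpmf
    refine HasDerivAt.mul ?_ ?_
    · exact (hasDerivAt_pow k t).const_mul _
    · have := ((hasDerivAt_id t).const_sub 1).fun_pow (n + 1 - k)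
      simpa using this
  convert h1 using 1
  obtain ⟨k, rfl⟩ : ∃ k', k = k' + 1 := ⟨k - 1, by omega⟩
  have h2 : ((n : ℝ) + 1) * (n.choose k) = ((n + 1).choose (k + 1)) * (k + 1) := by
    exact_mod_cast Nat.add_one_mul_choose_eq n k
  have h3 : (n.choose (k + 1) : ℝ) * (n + 1) = ((n + 1).choose (k + 1)) * ((n + 1 - (k + 1) : ℕ) : ℝ) := by
    exact_mod_cast Nat.choose_mul_succ_eq n (k + 1)
  unfold binpmf
  have e1 : n + 1 - (k + 1) = n - k := by omega
  have e2 : n + 1 - (k + 1) - 1 = n - (k + 1) := by omega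
  rw [e2]
  rw [e1] at h3 ⊢
  simp only [Nat.add_sub_cancel]
  push_cast
  linear_combination t ^ k * (1 - t) ^ (n - k) * h2 - t ^ (k + 1) * (1 - t) ^ (n - (k + 1)) * h3

lemma hasDerivAt_B (n : ℕ) (j : ℕ) (hj0 : 0 < j) (hjn : j ≤ n + 1) (t : ℝ) :
    HasDerivAt (B (n + 1) j) ((n + 1) * binpmf n t (j - 1)) t := by
  revert hj0
  refine Nat.decreasingInduction' (P := fun j => 0 < j → HasDerivAt (B (n + 1) j)
    ((n + 1) * binpmf n t (j - 1)) t) ?_ hjn ?_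
  · intro k hk _ ih hk0
    have h1 : B (n + 1) k = fun t => binpmf (n + 1) t k + B (n + 1) (k + 1) t := by
      funext t
      unfold B
      rw [← Finset.insert_Icc_add_one_left_eq_Icc (by omega : k ≤ n + 1), Finset.sum_insert (by simp)]
    rw [h1]
    have := (hasDerivAt_binpmf n k (by omega) hk0 t).add (ih (by omega))
    rw [Nat.add_sub_cancel] at this
    exact this.congr_deriv (by ring)
  · intro _
    have h1 : B (n + 1) (n + 1) = fun t => t ^ (n + 1) := by
      funext t; simp [B, binpmf]
    rw [h1]
    exact (hasDerivAt_pow (n + 1) t).congr_deriv (by simp [binpmf])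

lemma B_zero {n j : ℕ} (hj : 0 < j) : B n j 0 = 0 := by
  unfold B
  refine Finset.sum_eq_zero fun k hk => ?_
  simp only [Finset.mem_Icc] at hk
  unfold binpmf
  rw [zero_pow (by omega)]; simp

lemma B_one {n j : ℕ} (hj : j ≤ n) : B n j 1 = 1 := by
  unfold B
  rw [Finset.sum_eq_single n]
  · simp [binpmf]
  · intro k hk hne
    simp only [Finset.mem_Icc] at hk
    unfold binpmf
    rw [sub_self, zero_pow (by omega)]; simp
  · intro h; simp at h; omega

lemma continuous_B (n j : ℕ) : Continuous (B n j) := by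
  unfold B binpmf; fun_prop

lemma binpmf_pos {n : ℕ} {p : ℝ} (h0 : 0 < p) (h1 : p < 1) {k : ℕ} (hk : k ≤ n) : 0 < binpmf n p k := by
  unfold binpmf
  have : 0 < 1 - p := by linarith
  have : 0 < n.choose k := Nat.choose_pos hk
  positivity

lemma B_strictMono {n j : ℕ} (hj0 : 0 < j) (hjn : j ≤ n) : StrictMonoOn (B n j) (Icc 0 1) := by
  obtain ⟨n, rfl⟩ : ∃ m, n = m + 1 := ⟨n - 1, by omega⟩
  refine strictMonoOn_of_deriv_pos (convex_Icc 0 1) (continuous_B _ _).continuousOn fun t ht => ?_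
  rw [interior_Icc] at ht
  rw [(hasDerivAt_B n j hj0 hjn t).deriv]
  have := binpmf_pos ht.1 ht.2 (by omega : j - 1 ≤ n)
  positivity

/-- the critical values -/
def bq (c : ℝ) (n j : ℕ) : ℝ := by
  classical
  exact if h : ∃ t ∈ Ioo (0:ℝ) 1, B n j t = c then h.choose else 0

lemma bq_spec {c : ℝ} {n j : ℕ} (hc0 : 0 < c) (hc1 : c < 1) (hj0 : 0 < j) (hjn : j ≤ n) :
    0 < bq c n j ∧ bq c n j < 1 ∧ B n j (bq c n j) = c := by
  have h : ∃ t ∈ Ioo (0:ℝ) 1, B n j t = c := by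
    have := intermediate_value_Ioo (zero_le_one (α := ℝ)) (continuous_B n j).continuousOn
    rw [B_zero hj0, B_one hjn] at this
    exact this ⟨hc0, hc1⟩
  unfold bq
  rw [dif_pos h]
  exact ⟨h.choose_spec.1.1, h.choose_spec.1.2, h.choose_spec.2⟩

lemma B_anti_j {n j : ℕ} {t : ℝ} (h0 : 0 < t) (h1 : t < 1) (hjn : j ≤ n) : B n (j + 1) t < B n j t := by
  have : B n j t = binpmf n t j + B n (j + 1) t := by
    unfold B
    rw [← Finset.insert_Icc_add_one_left_eq_Icc hjn, Finset.sum_insert (by simp)]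
  have := binpmf_pos h0 h1 hjn
  linarith

lemma bq_lt_succ {c : ℝ} {n j : ℕ} (hc0 : 0 < c) (hc1 : c < 1) (hj0 : 0 < j) (hjn : j < n) :
    bq c n j < bq c n (j + 1) := by
  obtain ⟨a1, a2, a3⟩ := bq_spec hc0 hc1 hj0 hjn.le
  obtain ⟨b1, b2, b3⟩ := bq_spec hc0 hc1 (by omega : 0 < j + 1) (by omega : j + 1 ≤ n)
  by_contra hcon
  have h1 := (B_strictMono (by omega : 0 < j + 1) (by omega : j + 1 ≤ n)).monotoneOn
    ⟨b1.le, b2.le⟩ ⟨a1.le, a2.le⟩ (not_lt.1 hcon)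
  have h2 := B_anti_j a1 a2 hjn.le
  linarith

lemma bq_strictMono {c : ℝ} {n : ℕ} (hc0 : 0 < c) (hc1 : c < 1) {j j' : ℕ} (hj0 : 0 < j) (hjj : j < j')
    (hjn : j' ≤ n) : bq c n j < bq c n j' := by
  induction j', hjj using Nat.le_induction with
  | base => exact bq_lt_succ hc0 hc1 hj0 (by omega)
  | succ k hk ih => exact (ih (by omega)).trans (bq_lt_succ hc0 hc1 (by omega) (by omega))

lemma bq_mono {c : ℝ} {n : ℕ} (hc0 : 0 < c) (hc1 : c < 1) {j j' : ℕ} (hj0 : 0 < j) (hjj : j ≤ j')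
    (hjn : j' ≤ n) : bq c n j ≤ bq c n j' := by
  rcases hjj.eq_or_lt with h | h
  · rw [h]
  · exact (bq_strictMono hc0 hc1 hj0 h hjn).le

lemma B_lt_iff {c : ℝ} {n j : ℕ} (hc0 : 0 < c) (hc1 : c < 1) (hj0 : 0 < j) (hjn : j ≤ n) {t : ℝ}
    (ht : t ∈ Icc (0:ℝ) 1) : B n j t < c ↔ t < bq c n j := by
  obtain ⟨a1, a2, a3⟩ := bq_spec hc0 hc1 hj0 hjn
  rw [← (B_strictMono hj0 hjn).lt_iff_lt ht ⟨a1.le, a2.le⟩, a3]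

lemma lt_B_iff {c : ℝ} {n j : ℕ} (hc0 : 0 < c) (hc1 : c < 1) (hj0 : 0 < j) (hjn : j ≤ n) {t : ℝ}
    (ht : t ∈ Icc (0:ℝ) 1) : c < B n j t ↔ bq c n j < t := by
  obtain ⟨a1, a2, a3⟩ := bq_spec hc0 hc1 hj0 hjn
  rw [← (B_strictMono hj0 hjn).lt_iff_lt ⟨a1.le, a2.le⟩ ht, a3]

lemma regIncBeta_eq {n : ℕ} (i : Fin n) {t : ℝ} (ht : t ∈ Icc (0:ℝ) 1) :
    regIncBeta ((i : ℕ) + 1 : ℝ) ((n : ℝ) - (i : ℕ)) t = B n (i + 1) t := by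
  obtain ⟨i, hi⟩ := i
  obtain ⟨n, rfl⟩ : ∃ m, n = m + 1 := ⟨n - 1, by omega⟩
  simp only
  unfold regIncBeta
  have h1 : ∀ s, betaPDF ((i : ℕ) + 1 : ℝ) (((n + 1 : ℕ) : ℝ) - (i : ℕ)) s = (n + 1) * binpmf n s i := by
    intro s
    unfold betaPDF
    have e1 : ((n + 1 : ℕ) : ℝ) - i = ((n - i : ℕ) : ℝ) + 1 := by
      rw [Nat.cast_sub (by omega)]; push_cast; ring
    have e2 : ((i : ℝ) + 1) + (((n + 1 : ℕ) : ℝ) - i) = ((n + 1 : ℕ) : ℝ) + 1 := by ring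
    rw [e2, e1, Real.Gamma_nat_eq_factorial, Real.Gamma_nat_eq_factorial, Real.Gamma_nat_eq_factorial]
    simp only [add_sub_cancel_right, Real.rpow_natCast]
    unfold binpmf
    have h := Nat.choose_mul_factorial_mul_factorial (by omega : i ≤ n)
    have h' : (n.choose i : ℝ) * i.factorial * (n - i).factorial = n.factorial := by exact_mod_cast h
    have f1 : (i.factorial : ℝ) ≠ 0 := by positivity
    have f2 : ((n - i).factorial : ℝ) ≠ 0 := by positivity
    have f3 : ((n + 1).factorial : ℝ) = (n + 1) * n.factorial := by
      rw [Nat.factorial_succ]; push_cast; ring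
    rw [f3, ← h']
    field_simp
  simp_rw [h1]
  rw [← intervalIntegral.integral_of_le ht.1,
    intervalIntegral.integral_eq_sub_of_hasDerivAt (f := B (n + 1) (i + 1))]
  · rw [B_zero (by omega), sub_zero]
  · intro s _
    have := hasDerivAt_B n (i + 1) (by omega) (by omega) s
    simpa using this
  · apply Continuous.intervalIntegrable
    unfold binpmf; fun_prop

lemma cnt_comp_perm {n : ℕ} (u : Fin n → ℝ) (σ : Equiv.Perm (Fin n)) (t : ℝ) :
    cnt (u ∘ σ) t = cnt u t := by
  unfold cnt
  apply Finset.card_bij (fun j _ => σ j)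
  · intro j hj; simpa using hj
  · intro a _ b _ h; exact σ.injective h
  · intro j hj; exact ⟨σ.symm j, by simpa using hj, by simp⟩

lemma mono_cnt {n : ℕ} (v : Fin n → ℝ) (hv : Monotone v) (i : Fin n) (t : ℝ) :
    v i < t ↔ (i : ℕ) + 1 ≤ cnt v t := by
  constructor
  · intro h
    have : (Finset.Iic i).card ≤ cnt v t := by
      unfold cnt
      refine Finset.card_le_card fun j hj => ?_
      simp only [Finset.mem_Iic, Finset.mem_filter, Finset.mem_univ, true_and] at hj ⊢
      exact (hv hj).trans_lt h
    simpa using this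
  · intro h
    by_contra hcon
    have : cnt v t ≤ (Finset.Iio i).card := by
      unfold cnt
      refine Finset.card_le_card fun j hj => ?_
      simp only [Finset.mem_Iio, Finset.mem_filter, Finset.mem_univ, true_and] at hj ⊢
      by_contra hij
      have := hv (not_lt.1 hij)
      linarith
    simp at this
    omega

lemma orderStat_lt {n : ℕ} (u : Fin n → ℝ) (i : Fin n) (t : ℝ) :
    orderStat u i < t ↔ (i : ℕ) + 1 ≤ cnt u t := by
  have := mono_cnt (u ∘ Tuple.sort u) (Tuple.monotone_sort u) i t
  rw [cnt_comp_perm] at this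
  exact this

lemma orderStat_gt {n : ℕ} (u : Fin n → ℝ) (i : Fin n) (t : ℝ) :
    1 - t < orderStat u i ↔ n - (i : ℕ) ≤ cnt (fun j => 1 - u j) t := by
  have h := mono_cnt (fun j => 1 - (u ∘ Tuple.sort u) (Fin.rev j))
    (fun j j' hjj => by
      have := Tuple.monotone_sort u (Fin.rev_le_rev.2 hjj)
      simp only; linarith) (Fin.rev i) t
  have e : cnt (fun j => 1 - (u ∘ Tuple.sort u) (Fin.rev j)) t = cnt (fun j => 1 - u j) t :=
    cnt_comp_perm (fun j => 1 - u j) (Fin.revPerm.trans (Tuple.sort u)) t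
  rw [e] at h
  simp only [Fin.rev_rev, Function.comp_apply, Fin.val_rev] at h
  have : n - (i + 1 : ℕ) + 1 = n - i := by omega
  rw [this] at h
  rw [← h]
  unfold orderStat
  constructor <;> intro h <;> linarith

lemma orderStat_mem {n : ℕ} {u : Fin n → ℝ} (hu : ∀ j, u j ∈ Icc (0:ℝ) 1) (i : Fin n) :
    orderStat u i ∈ Icc (0:ℝ) 1 := hu _

lemma MnPlus_lt {n : ℕ} (hn : 0 < n) {c : ℝ} (hc0 : 0 < c) (hc1 : c < 1) {u : Fin n → ℝ}
    (hu : ∀ j, u j ∈ Icc (0:ℝ) 1) : MnPlus u < c ↔ u ∉ (NC (Finset.Ioc 0 n) (bq c n) 0 : Set (Fin n → ℝ)) := by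
  have : Nonempty (Fin n) := ⟨⟨0, hn⟩⟩
  unfold MnPlus
  rw [ciInf_lt_iff (Finite.bddBelow_range _)]
  have h1 : ∀ i : Fin n, pOrd u i < c ↔ (i : ℕ) + 1 ≤ cnt u (bq c n (i + 1)) := by
    intro i
    unfold pOrd
    rw [regIncBeta_eq i (orderStat_mem hu i), B_lt_iff hc0 hc1 (by omega) (by omega) (orderStat_mem hu i),
      orderStat_lt]
  simp only [h1, NC, mem_ofPred_eq, not_forall, not_lt, Finset.mem_Ioc, exists_prop, add_zero]
  constructor
  · rintro ⟨i, hi⟩; exact ⟨i + 1, ⟨by omega, by omega⟩, hi⟩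
  · rintro ⟨j, ⟨h2, h3⟩, h4⟩
    refine ⟨⟨j - 1, by omega⟩, ?_⟩
    simp only [Nat.sub_add_cancel h2]; exact h4

lemma B_symm {n i : ℕ} (hi : i < n) (t : ℝ) : 1 - B n (i + 1) t = B n (n - i) (1 - t) := by
  have h1 := binpmf_sum n t
  have h2 : ∑ k ∈ Finset.range (n + 1), binpmf n t k = ∑ k ∈ Finset.range (i + 1), binpmf n t k + B n (i + 1) t := by
    unfold B
    rw [Finset.range_eq_Ico, Finset.range_eq_Ico,
      ← Finset.sum_Ico_consecutive _ (by omega : 0 ≤ i + 1) (by omega : i + 1 ≤ n + 1)]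
    rfl
  have h3 : ∑ k ∈ Finset.range (i + 1), binpmf n t k = B n (n - i) (1 - t) := by
    unfold B
    apply Finset.sum_bij (fun k _ => n - k)
    · intro k hk; simp only [Finset.mem_range, Finset.mem_Icc] at hk ⊢; omega
    · intro k hk k' hk' h; simp only [Finset.mem_range] at hk hk'; omega
    · intro j hj; simp only [Finset.mem_Icc] at hj
      exact ⟨n - j, by simp only [Finset.mem_range]; omega, by omega⟩
    · intro k hk
      simp only [Finset.mem_range] at hk
      unfold binpmf
      rw [Nat.choose_symm (by omega), show n - (n - k) = k by omega, sub_sub_cancel]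
      ring
  linarith

lemma MnMinus_lt {n : ℕ} (hn : 0 < n) {c : ℝ} (hc0 : 0 < c) (hc1 : c < 1) {u : Fin n → ℝ}
    (hu : ∀ j, u j ∈ Icc (0:ℝ) 1) : MnMinus u < c ↔
      (fun j => 1 - u j) ∉ (NC (Finset.Ioc 0 n) (bq c n) 0 : Set (Fin n → ℝ)) := by
  have : Nonempty (Fin n) := ⟨⟨0, hn⟩⟩
  unfold MnMinus
  rw [ciInf_lt_iff (Finite.bddBelow_range _)]
  have h1 : ∀ i : Fin n, 1 - pOrd u i < c ↔ n - (i : ℕ) ≤ cnt (fun j => 1 - u j) (bq c n (n - i)) := by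
    intro i
    unfold pOrd
    have hm := orderStat_mem hu i
    rw [regIncBeta_eq i hm, B_symm i.2, B_lt_iff hc0 hc1 (by omega) (by omega)
      ⟨by linarith [hm.2], by linarith [hm.1]⟩, ← orderStat_gt]
    constructor <;> intro h <;> linarith
  simp only [h1, NC, mem_ofPred_eq, not_forall, not_lt, Finset.mem_Ioc, exists_prop, add_zero]
  constructor
  · rintro ⟨i, hi⟩; exact ⟨n - i, ⟨by omega, by omega⟩, hi⟩
  · rintro ⟨j, ⟨h2, h3⟩, h4⟩
    refine ⟨⟨n - j, by omega⟩, ?_⟩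
    simp only [show n - (n - j) = j by omega]; exact h4

lemma uni01 : uni 0 1 = volume.restrict (Icc (0:ℝ) 1) := by
  unfold uni
  simp only [sub_zero, ENNReal.ofReal_one, inv_one, one_smul]
  exact Measure.restrict_congr_set Ico_ae_eq_Icc

lemma null_eq (n : ℕ) : nullMeasure n = Measure.pi (fun _ : Fin n => uni 0 1) := by
  unfold nullMeasure
  rw [uni01]

lemma null_ae (n : ℕ) : ∀ᵐ u ∂(nullMeasure n), ∀ j, u j ∈ Icc (0:ℝ) 1 := by
  unfold nullMeasure
  have h : ∀ j : Fin n, ∀ᵐ u ∂(Measure.pi fun _ : Fin n => volume.restrict (Icc (0:ℝ) 1)),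
      u j ∈ Icc (0:ℝ) 1 := by
    intro j
    have hq := Measure.tendsto_eval_ae_ae (μ := fun _ : Fin n => volume.restrict (Icc (0:ℝ) 1)) (i := j)
    exact hq.eventually (ae_restrict_mem measurableSet_Icc)
  exact ae_all_iff.2 h

lemma trans_plus {n : ℕ} (hn : 0 < n) {c : ℝ} (hc0 : 0 < c) (hc1 : c < 1) :
    ((nullMeasure n) {u | MnPlus u < c}).toReal = 1 - pr n 0 1 (NC (Finset.Ioc 0 n) (bq c n) 0) := by
  rw [← pr_compl zero_lt_one (measurableSet_NC _ _ _), pr, measureReal_def, ← null_eq]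
  congr 1
  refine measure_congr ?_
  filter_upwards [null_ae n] with u hu
  exact propext (MnPlus_lt hn hc0 hc1 hu)

lemma reflect_uni : MeasurePreserving (fun x : ℝ => 1 - x) (uni 0 1) (uni 0 1) := by
  rw [uni01]
  have h := (Measure.measurePreserving_sub_left (volume : Measure ℝ) 1).restrict_preimage
    (s := Icc (0:ℝ) 1) measurableSet_Icc
  have e : (fun x : ℝ => 1 - x) ⁻¹' Icc (0:ℝ) 1 = Icc 0 1 := by
    ext x; simp
  rwa [e] at h

lemma trans_minus {n : ℕ} (hn : 0 < n) {c : ℝ} (hc0 : 0 < c) (hc1 : c < 1) :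
    ((nullMeasure n) {u | MnMinus u < c}).toReal = 1 - pr n 0 1 (NC (Finset.Ioc 0 n) (bq c n) 0) := by
  have hpi := measurePreserving_pi (fun _ : Fin n => uni 0 1) (fun _ : Fin n => uni 0 1)
    (fun _ => reflect_uni)
  rw [← pr_compl zero_lt_one (measurableSet_NC _ _ _), pr, measureReal_def,
    ← hpi.measure_preimage (measurableSet_NC _ _ _).compl.nullMeasurableSet, ← null_eq]
  congr 1
  refine measure_congr ?_
  filter_upwards [null_ae n] with u hu
  exact propext (MnMinus_lt hn hc0 hc1 hu)

end

end BJ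

open MeasureTheory Filter Set

namespace BJ

noncomputable section

lemma mgf_bound {b θ : ℝ} (hb0 : 0 ≤ b) (hb1 : b ≤ 1) (h0 : 0 ≤ θ) (h1 : θ ≤ 1) :
    1 - b + b * Real.exp θ ≤ Real.exp (b * θ + b * (1 - b) * θ ^ 2 * (1 + θ) / 2) := by
  have e1 : Real.exp (-(b * θ)) ≤ 1 - b * θ + (b * θ) ^ 2 / 2 := by
    have hx : 0 ≤ b * θ := by positivity
    have := Real.quadratic_le_exp_of_nonneg hx
    rw [Real.exp_neg]
    rw [inv_le_comm₀ (Real.exp_pos _) (by nlinarith)]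
    refine le_trans ?_ this
    rw [inv_le_iff_one_le_mul₀ (by nlinarith)]
    nlinarith [sq_nonneg ((b * θ) ^ 2)]
  have hx1 : (1 - b) * θ ≤ 1 := by nlinarith
  have hx0 : 0 ≤ (1 - b) * θ := mul_nonneg (by linarith) h0
  have e2 : Real.exp ((1 - b) * θ) ≤ 1 + (1 - b) * θ + ((1 - b) * θ) ^ 2 / 2 + ((1 - b) * θ) ^ 3 * (2 / 9) := by
    have := Real.exp_bound' hx0 hx1 (n := 3) (by norm_num)
    simp only [Finset.sum_range_succ, Finset.sum_range_zero, Nat.factorial] at this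
    norm_num at this
    linarith
  have e3 : 1 - b + b * Real.exp θ =
      Real.exp (b * θ) * ((1 - b) * Real.exp (-(b * θ)) + b * Real.exp ((1 - b) * θ)) := by
    have a1 : Real.exp (b * θ) * Real.exp (-(b * θ)) = 1 := by rw [← Real.exp_add]; simp
    have a2 : Real.exp (b * θ) * Real.exp ((1 - b) * θ) = Real.exp θ := by
      rw [← Real.exp_add]; congr 1; ring
    linear_combination -(1 - b) * a1 - b * a2
  rw [e3, Real.exp_add]
  refine mul_le_mul_of_nonneg_left ?_ (Real.exp_pos _).le
  refine le_trans ?_ (Real.add_one_le_exp _)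
  have hb : 0 ≤ 1 - b := by linarith
  have := mul_le_mul_of_nonneg_left e1 hb
  have := mul_le_mul_of_nonneg_left e2 hb0
  have h3 : b * ((1 - b) * θ) ^ 3 * (2 / 9) ≤ b * (1 - b) * θ ^ 3 * (1/2) := by
    have : (1 - b) ^ 2 ≤ 1 := by nlinarith
    have h4 : 0 ≤ b * (1 - b) * θ ^ 3 := by positivity
    have : b * ((1 - b) * θ) ^ 3 = b * (1 - b) * θ ^ 3 * (1 - b) ^ 2 := by ring
    rw [this]
    nlinarith
  nlinarith

lemma chernoff {n i : ℕ} {b θ : ℝ} (hb0 : 0 ≤ b) (hb1 : b ≤ 1) (h0 : 0 ≤ θ) (h1 : θ ≤ 1) :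
    B n i b ≤ Real.exp (-θ * (i - n * b) + n * b * (1 - b) * θ ^ 2 * (1 + θ) / 2) := by
  have s1 : B n i b ≤ ∑ k ∈ Finset.range (n + 1), binpmf n b k * Real.exp (θ * (k - i)) := by
    unfold B
    calc _ ≤ ∑ k ∈ Finset.Icc i n, binpmf n b k * Real.exp (θ * (k - i)) := by
          refine Finset.sum_le_sum fun k hk => ?_
          simp only [Finset.mem_Icc] at hk
          have hk' : (i : ℝ) ≤ k := by exact_mod_cast hk.1
          have : 1 ≤ Real.exp (θ * (k - i)) := Real.one_le_exp (mul_nonneg h0 (by linarith))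
          exact le_mul_of_one_le_right (binpmf_nonneg hb0 hb1 k) this
      _ ≤ _ := by
          refine Finset.sum_le_sum_of_subset_of_nonneg ?_ fun k _ _ =>
            mul_nonneg (binpmf_nonneg hb0 hb1 k) (Real.exp_pos _).le
          intro k hk
          simp only [Finset.mem_Icc, Finset.mem_range] at hk ⊢; omega
  have s2 : ∑ k ∈ Finset.range (n + 1), binpmf n b k * Real.exp (θ * (k - i)) =
      Real.exp (-θ * i) * (1 - b + b * Real.exp θ) ^ n := by
    rw [add_comm (1 - b), add_pow, Finset.mul_sum]
    refine Finset.sum_congr rfl fun k _ => ?_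
    have : Real.exp (θ * (k - i)) = Real.exp (-θ * i) * Real.exp θ ^ k := by
      rw [← Real.exp_nat_mul, ← Real.exp_add]; congr 1; ring
    rw [this, mul_pow]; unfold binpmf; ring
  rw [s2] at s1
  refine s1.trans ?_
  have h2 := mgf_bound hb0 hb1 h0 h1
  have h3 : 0 ≤ 1 - b + b * Real.exp θ := by
    have := Real.exp_pos θ
    have : 0 ≤ b * Real.exp θ := by positivity
    linarith
  have h4 := pow_le_pow_left₀ h3 h2 n
  calc _ ≤ Real.exp (-θ * i) * Real.exp (b * θ + b * (1 - b) * θ ^ 2 * (1 + θ) / 2) ^ n := by gcongr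
    _ = _ := by
      rw [← Real.exp_nat_mul, ← Real.exp_add]; congr 1; ring

lemma log_le_half {r : ℝ} (hr : 1 ≤ r) : Real.log r ≤ (r - 1 / r) / 2 := by
  have h0 : 0 < r := by linarith
  have := Real.self_le_sinh_iff.2 (Real.log_nonneg hr)
  rw [Real.sinh_eq, Real.exp_neg, Real.exp_log h0] at this
  rwa [one_div]

lemma kl_bound {b t : ℝ} (hb : 0 < b) (hbt : b < t) (ht : t < 1) :
    t * Real.log (t / b) - (1 - t) * Real.log ((1 - b) / (1 - t)) ≤ (t - b) ^ 2 / (2 * b * (1 - t)) := by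
  have ht0 : 0 < t := by linarith
  have ht1 : 0 < 1 - t := by linarith
  have h1 := log_le_half (r := t / b) (by rw [le_div_iff₀ hb]; linarith)
  have h2 : 2 * (t - b) / (2 - b - t) ≤ Real.log ((1 - b) / (1 - t)) := by
    have := Real.le_log_one_add_of_nonneg (x := (t - b) / (1 - t)) (by apply div_nonneg <;> linarith)
    have e : 1 + (t - b) / (1 - t) = (1 - b) / (1 - t) := by field_simp; ring
    rw [e] at this
    refine le_trans (le_of_eq ?_) this
    have : (2 - b - t) ≠ 0 := by linarith
    have : (t - b) / (1 - t) + 2 = (2 - b - t) / (1 - t) := by field_simp; ring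
    rw [this]; field_simp
  have h3 : t * Real.log (t / b) ≤ (t - b) * ((t + b) / (2 * b)) := by
    calc _ ≤ t * ((t / b - 1 / (t / b)) / 2) := by gcongr
      _ = _ := by field_simp; ring
  have h4 : (1 - t) * (2 * (t - b) / (2 - b - t)) ≤ (1 - t) * Real.log ((1 - b) / (1 - t)) := by gcongr
  have h5 : (1 - t) * (2 * (t - b) / (2 - b - t)) = (t - b) - (t - b) ^ 2 / (2 - b - t) := by
    have : (2 - b - t) ≠ 0 := by linarith
    field_simp; ring
  have h6 : (t - b) ^ 2 / (2 - b - t) ≤ (t - b) ^ 2 / (2 * (1 - t)) := by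
    gcongr; linarith
  have h7 : (t - b) * ((t + b) / (2 * b)) = (t - b) + (t - b) ^ 2 / (2 * b) := by field_simp; ring
  have h8 : (t - b) ^ 2 / (2 * b) + (t - b) ^ 2 / (2 * (1 - t)) ≤ (t - b) ^ 2 / (2 * b * (1 - t)) := by
    have : (t - b) ^ 2 / (2 * b) + (t - b) ^ 2 / (2 * (1 - t)) =
      (t - b) ^ 2 * (1 - t + b) / (2 * b * (1 - t)) := by field_simp
    rw [this]
    gcongr
    nlinarith [sq_nonneg (t - b)]
  linarith

lemma tilt {n i : ℕ} {b t r : ℝ} (hb : 0 < b) (hbt : b < t) (ht : t < 1) (hr : 0 ≤ r) :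
    (∑ k ∈ (Finset.Icc i n).filter (fun k : ℕ => (k : ℝ) ≤ n * t + r), binpmf n t k) *
      Real.exp (-(n * ((t - b) ^ 2 / (2 * b * (1 - t))) + r * ((t - b) / (b * (1 - t))))) ≤ B n i b := by
  have ht0 : 0 < t := by linarith
  have ht1 : 0 < 1 - t := by linarith
  have hb1 : 0 < 1 - b := by linarith
  have hkl := kl_bound hb hbt ht
  have hodd : Real.log (t / b) + Real.log ((1 - b) / (1 - t)) ≤ (t - b) / (b * (1 - t)) := by
    rw [← Real.log_mul (by positivity) (by positivity)]
    refine (Real.log_le_sub_one_of_pos (by positivity)).trans (le_of_eq ?_)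
    field_simp; ring
  have hodd0 : 0 ≤ Real.log (t / b) + Real.log ((1 - b) / (1 - t)) := by
    refine add_nonneg (Real.log_nonneg ?_) (Real.log_nonneg ?_)
    · rw [le_div_iff₀ hb]; linarith
    · rw [le_div_iff₀ ht1]; linarith
  unfold B
  rw [Finset.sum_mul]
  calc _ ≤ ∑ k ∈ (Finset.Icc i n).filter (fun k : ℕ => (k : ℝ) ≤ n * t + r), binpmf n b k := by
        refine Finset.sum_le_sum fun k hk => ?_
        simp only [Finset.mem_filter, Finset.mem_Icc] at hk
        have e1 : binpmf n b k = binpmf n t k *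
            Real.exp (-(k * Real.log (t / b) - ((n - k : ℕ) : ℝ) * Real.log ((1 - b) / (1 - t)))) := by
          have : Real.exp (-(k * Real.log (t / b) - ((n - k : ℕ) : ℝ) * Real.log ((1 - b) / (1 - t)))) =
              (b / t) ^ k * ((1 - b) / (1 - t)) ^ (n - k) := by
            rw [neg_sub, sub_eq_add_neg, Real.exp_add, mul_comm, ← mul_neg, ← Real.log_inv, inv_div,
              Real.exp_nat_mul, Real.exp_nat_mul, Real.exp_log (by positivity), Real.exp_log (by positivity)]
          rw [this]
          unfold binpmf
          rw [div_pow, div_pow]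
          field_simp
        rw [e1]
        refine mul_le_mul_of_nonneg_left (Real.exp_le_exp.2 (neg_le_neg ?_))
          (binpmf_nonneg ht0.le ht.le k)
        rw [Nat.cast_sub hk.1.2]
        set L1 := Real.log (t / b)
        set L2 := Real.log ((1 - b) / (1 - t))
        have h1 : (k : ℝ) * (L1 + L2) ≤ (n * t + r) * (L1 + L2) := by gcongr; exact hk.2
        have h2 : (n : ℝ) * (t * L1 - (1 - t) * L2) ≤ n * ((t - b) ^ 2 / (2 * b * (1 - t))) := by gcongr
        have h3 : r * (L1 + L2) ≤ r * ((t - b) / (b * (1 - t))) := by gcongr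
        linarith
    _ ≤ _ := by
        refine Finset.sum_le_sum_of_subset_of_nonneg (Finset.filter_subset _ _) fun k _ _ =>
          binpmf_nonneg hb.le (by linarith) k

/-- lower bound of the tail through tilting and Chebyshev -/
lemma tilt_cheb {n i : ℕ} {b t r : ℝ} (hb : 0 < b) (hbt : b < t) (ht : t < 1) (hr : 0 < r)
    (hi : (i : ℝ) ≤ n * t - r) (hvar : 2 * (n * t * (1 - t)) ≤ r ^ 2) :
    1 / 2 * Real.exp (-(n * ((t - b) ^ 2 / (2 * b * (1 - t))) + r * ((t - b) / (b * (1 - t))))) ≤ B n i b := by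
  refine le_trans ?_ (tilt hb hbt ht hr.le)
  gcongr
  have h0 : 0 ≤ t := by linarith
  have h1 := binpmf_sum n t
  have h2 := Finset.sum_filter_add_sum_filter_not (Finset.range (n + 1))
    (fun k : ℕ => r ≤ |(k : ℝ) - n * t|) (binpmf n t)
  have h3 := cheb_aux n h0 ht.le (fun k : ℕ => r ≤ |(k : ℝ) - n * t|) hr (fun k _ h => h)
  have h4 : n * t * (1 - t) / r ^ 2 ≤ 1 / 2 := by
    rw [div_le_iff₀ (by positivity)]; linarith
  have h5 : ∑ k ∈ (Finset.range (n + 1)).filter (fun k : ℕ => ¬ r ≤ |(k : ℝ) - n * t|), binpmf n t k ≤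
      ∑ k ∈ (Finset.Icc i n).filter (fun k : ℕ => (k : ℝ) ≤ n * t + r), binpmf n t k := by
    refine Finset.sum_le_sum_of_subset_of_nonneg ?_ fun k _ _ => binpmf_nonneg h0 ht.le k
    intro k hk
    simp only [Finset.mem_filter, Finset.mem_range, Finset.mem_Icc, not_le, abs_lt] at hk ⊢
    refine ⟨⟨?_, by omega⟩, by linarith [hk.2.2]⟩
    have : (i : ℝ) ≤ k := by linarith [hk.2.1]
    exact_mod_cast this
  linarith

end

end BJ

open MeasureTheory Filter Set

namespace BJ

noncomputable section

/-- standard deviation scale -/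
def S (n i : ℕ) : ℝ := Real.sqrt ((i : ℝ) * (n - i) / n)

/-- indices far away from the two ends -/
def Good (u : ℝ) (n i : ℕ) : Prop := u ^ 12 ≤ i ∧ u ^ 12 ≤ (n : ℝ) - i

/-- the quantiles as function of `u` -/
def bb (u : ℝ) (n i : ℕ) : ℝ := bq (Real.exp (-u ^ 2 / 2)) n i

/-- gap -/
def DD (u : ℝ) (n i : ℕ) : ℝ := i - n * bb u n i

lemma good_base {u : ℝ} (hu : 2 ≤ u) {n i : ℕ} (hg : Good u n i) :
    (0:ℝ) < i ∧ (0:ℝ) < (n:ℝ) - i ∧ (0:ℝ) < n ∧ 0 < S n i ∧ (S n i) ^ 2 * n = i * (n - i) ∧ (S n i) ^ 2 ≤ i ∧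
    (S n i) ^ 2 ≤ n - i ∧ u ^ 12 ≤ 2 * (S n i) ^ 2 ∧ u ^ 5 ≤ S n i ∧ 0 < i ∧ i < n := by
  obtain ⟨h1, h2⟩ := hg
  have hp : 0 < u ^ 12 := by positivity
  have hi : (0:ℝ) < i := by linarith
  have hni : (0:ℝ) < (n:ℝ) - i := by linarith
  have hn : (0:ℝ) < n := by linarith
  have hs2 : (S n i) ^ 2 = (i : ℝ) * (n - i) / n := by
    unfold S; rw [Real.sq_sqrt (by positivity)]
  have hs : 0 < S n i := by unfold S; positivity
  have a1 : (S n i) ^ 2 ≤ i := by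
    rw [hs2, div_le_iff₀ hn]; nlinarith
  have a2 : (S n i) ^ 2 ≤ (n:ℝ) - i := by
    rw [hs2, div_le_iff₀ hn]; nlinarith
  have a3 : u ^ 12 ≤ 2 * (S n i) ^ 2 := by
    rw [hs2, ← mul_div_assoc, le_div_iff₀ hn]
    have e : (n:ℝ) = i + (n - i) := by ring
    nlinarith [mul_nonneg (sub_nonneg.2 h1) hni.le, mul_nonneg (sub_nonneg.2 h2) hi.le]
  refine ⟨hi, hni, hn, hs, by rw [hs2]; field_simp, a1, a2, a3, ?_, by exact_mod_cast hi, ?_⟩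
  · refine le_of_sq_le_sq ?_ hs.le
    have : (4:ℝ) ≤ u ^ 2 := by nlinarith
    have h10 : 0 ≤ u ^ 10 := by positivity
    nlinarith
  · have : (i:ℝ) < n := by linarith
    exact_mod_cast this

lemma ev_inv {η : ℝ} (hη : 0 < η) : ∀ᶠ u : ℝ in atTop, 2 ≤ u ∧ 1 ≤ η * u := by
  filter_upwards [eventually_ge_atTop 2, eventually_ge_atTop (1 / η)] with u h1 h2
  refine ⟨h1, ?_⟩
  rw [div_le_iff₀ hη] at h2; linarith

/-- `u s ≤ η s²` -/
lemma good_us {u η : ℝ} (hu : 2 ≤ u) (h : 1 ≤ η * u) {n i : ℕ} (hg : Good u n i) :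
    u * S n i ≤ η * (S n i) ^ 2 := by
  obtain ⟨_, _, _, hs, _, _, _, _, h5, _, _⟩ := good_base hu hg
  have h1 : u ≤ η * S n i := by
    have hη : 0 < η := by by_contra hc; nlinarith
    have : u * u ≤ u ^ 5 := by
      have : 1 ≤ u ^ 3 := one_le_pow₀ (by linarith)
      nlinarith [sq_nonneg u]
    nlinarith
  nlinarith

lemma cexp {u : ℝ} (hu : 0 < u) : 0 < Real.exp (-u ^ 2 / 2) ∧ Real.exp (-u ^ 2 / 2) < 1 := by
  refine ⟨Real.exp_pos _, ?_⟩
  rw [Real.exp_lt_one_iff]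
  have : 0 < u ^ 2 := by positivity
  linarith

lemma E1_upper {ε : ℝ} (hε : 0 < ε) (hε1 : ε ≤ 1) : ∀ᶠ u : ℝ in atTop, ∀ n i : ℕ, Good u n i →
    DD u n i ≤ (1 + ε) * (u * S n i) := by
  filter_upwards [ev_inv (show 0 < ε / 8 by linarith)] with u ⟨hu, hu2⟩ n i hg
  have hus := good_us hu hu2 hg
  obtain ⟨hi, hni, hn, hs, hsn, hsi, hsni, hs12, hs5, hi0, hin⟩ := good_base hu hg
  obtain ⟨hc0, hc1⟩ := cexp (u := u) (by linarith)
  set s := S n i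
  have hu0 : 0 < u := by linarith
  have hus0 : 0 < u * s := by positivity
  set b := ((i:ℝ) - (1 + ε) * (u * s)) / n with hb
  have hnb : n * b = (i:ℝ) - (1 + ε) * (u * s) := by rw [hb]; field_simp
  have hb0 : 0 ≤ b := by
    apply div_nonneg _ hn.le
    nlinarith
  have hb1 : b ≤ 1 := by
    rw [hb, div_le_one hn]; nlinarith
  have hθ : u / s ≤ ε / 8 := by
    rw [div_le_iff₀ hs]; nlinarith
  have hθ0 : 0 ≤ u / s := by positivity
  have hch := chernoff (n := n) (i := i) hb0 hb1 hθ0 (by linarith)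
  have hv : n * b * (1 - b) ≤ s ^ 2 + (1 + ε) * (u * s) := by
    have : n * (n * b * (1 - b)) ≤ n * (s ^ 2 + (1 + ε) * (u * s)) := by
      have e : n * (n * b * (1 - b)) = (n * b) * (n - n * b) := by ring
      rw [e, hnb]
      nlinarith [mul_pos hni hus0, sq_nonneg ((1 + ε) * (u * s))]
    exact le_of_mul_le_mul_left this hn
  have hv2 : n * b * (1 - b) ≤ s ^ 2 * (1 + ε / 4) := by nlinarith
  have hlt : B n i b < Real.exp (-u ^ 2 / 2) := by
    refine lt_of_le_of_lt hch (Real.exp_lt_exp.2 ?_)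
    have e1 : -(u / s) * (i - n * b) = - (1 + ε) * u ^ 2 := by
      rw [hnb]; field_simp; ring
    have e2 : n * b * (1 - b) * (u / s) ^ 2 * (1 + u / s) / 2 ≤ u ^ 2 * ((1 + ε / 4) * (1 + ε / 8) / 2) := by
      have : n * b * (1 - b) * (u / s) ^ 2 * (1 + u / s) / 2 ≤
        s ^ 2 * (1 + ε / 4) * (u / s) ^ 2 * (1 + ε / 8) / 2 := by gcongr
      refine this.trans (le_of_eq ?_)
      field_simp
    rw [e1]
    have hu2 : 0 < u ^ 2 := by positivity
    have : (1 + ε / 4) * (1 + ε / 8) < 1 + 2 * ε := by nlinarith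
    nlinarith
  rw [B_lt_iff hc0 hc1 hi0 hin.le ⟨hb0, hb1⟩] at hlt
  have : n * b < n * bb u n i := mul_lt_mul_of_pos_left hlt hn
  unfold DD
  rw [hnb] at this; linarith

set_option maxHeartbeats 2000000 in
lemma E1_lower {ε : ℝ} (hε : 0 < ε) (hε1 : ε ≤ 1) : ∀ᶠ u : ℝ in atTop, ∀ n i : ℕ, Good u n i →
    (1 - ε) * (u * S n i) ≤ DD u n i := by
  filter_upwards [ev_inv (show 0 < ε / 8 by linarith)] with u ⟨hu, hu2⟩ n i hg
  have hus := good_us hu hu2 hg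
  obtain ⟨hi, hni, hn, hs, hsn, hsi, hsni, hs12, hs5, hi0, hin⟩ := good_base hu hg
  obtain ⟨hc0, hc1⟩ := cexp (u := u) (by linarith)
  set s := S n i
  have hu0 : 0 < u := by linarith
  have hus0 : 0 < u * s := by positivity
  have hs2 : 2 ≤ s := by
    have : u * 1 ≤ u ^ 5 := by
      have : 1 ≤ u ^ 4 := one_le_pow₀ (by linarith)
      nlinarith
    linarith
  set b := ((i:ℝ) - (1 - ε) * (u * s)) / n with hb
  set t := ((i:ℝ) + 2 * s) / n with ht
  have hnb : n * b = (i:ℝ) - (1 - ε) * (u * s) := by rw [hb]; field_simp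
  have hnt : n * t = (i:ℝ) + 2 * s := by rw [ht]; field_simp
  have hε' : 0 ≤ 1 - ε := by linarith
  have hbi : (i:ℝ) * (1 - ε / 8) ≤ n * b := by
    rw [hnb]; nlinarith
  have hb0 : 0 < b := by
    have : 0 < (i:ℝ) * (1 - ε / 8) := by apply mul_pos hi; linarith
    by_contra hc
    push Not at hc
    nlinarith
  have hti : ((n:ℝ) - i) * (1 - ε / 8) ≤ n - n * t := by
    rw [hnt]; nlinarith
  have ht1 : t < 1 := by
    have : 0 < ((n:ℝ) - i) * (1 - ε / 8) := by apply mul_pos hni; linarith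
    by_contra hc
    push Not at hc
    nlinarith
  have hbt : b < t := by
    rw [hb, ht]; apply div_lt_div_of_pos_right _ hn
    nlinarith
  have hvar : 2 * (n * t * (1 - t)) ≤ (2 * s) ^ 2 := by
    have : n * (2 * (n * t * (1 - t))) ≤ n * (2 * s) ^ 2 := by
      have e : n * (2 * (n * t * (1 - t))) = 2 * ((n * t) * (n - n * t)) := by ring
      rw [e, hnt]
      have : 0 ≤ n * s * (s - 2) := mul_nonneg (mul_nonneg hn.le hs.le) (by linarith)
      nlinarith [mul_pos hni hs, mul_pos hi hs]
    exact le_of_mul_le_mul_left this hn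
  have htc := tilt_cheb (n := n) (i := i) hb0 hbt ht1 (show 0 < 2 * s by positivity) (by rw [hnt]; linarith) hvar
  set w := 2 + (1 - ε) * u with hw
  have hw0 : 0 < w := by nlinarith
  have hden : s ^ 2 * (1 - ε / 8) ^ 2 ≤ n * (b * (1 - t)) := by
    have : n * (s ^ 2 * (1 - ε / 8) ^ 2) ≤ n * (n * (b * (1 - t))) := by
      have e : n * (n * (b * (1 - t))) = (n * b) * (n - n * t) := by ring
      have e' : n * (s ^ 2 * (1 - ε / 8) ^ 2) = (i * (1 - ε / 8)) * (((n:ℝ) - i) * (1 - ε / 8)) := by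
        linear_combination (1 - ε / 8) ^ 2 * hsn
      rw [e, e']
      have : 0 ≤ 1 - ε / 8 := by linarith
      gcongr
    exact le_of_mul_le_mul_left this hn
  have htb : n * (t - b) = s * w := by rw [mul_sub, hnt, hnb, hw]; ring
  have h1t : 0 < 1 - t := by linarith
  have hk : 0 < 1 - ε / 8 := by linarith
  have x1 : n * ((t - b) ^ 2 / (2 * b * (1 - t))) ≤ w ^ 2 / (2 * (1 - ε / 8) ^ 2) := by
    have : n * ((t - b) ^ 2 / (2 * b * (1 - t))) = (s * w) ^ 2 / (2 * (n * (b * (1 - t)))) := by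
      rw [← htb]; field_simp
    rw [this]
    calc _ ≤ (s * w) ^ 2 / (2 * (s ^ 2 * (1 - ε / 8) ^ 2)) := by gcongr
      _ = _ := by field_simp
  have x2 : 2 * s * ((t - b) / (b * (1 - t))) ≤ 4 * w / (2 * (1 - ε / 8) ^ 2) := by
    have : 2 * s * ((t - b) / (b * (1 - t))) = 2 * s * (s * w) / (n * (b * (1 - t))) := by
      rw [← htb]; field_simp
    rw [this]
    calc _ ≤ 2 * s * (s * w) / (s ^ 2 * (1 - ε / 8) ^ 2) := by gcongr
      _ = _ := by field_simp; ring
  have x3 : (w ^ 2 + 4 * w) / (2 * (1 - ε / 8) ^ 2) ≤ u ^ 2 / 2 - 1 := by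
    rw [div_le_iff₀ (by positivity)]
    have h1 : w + 2 ≤ (1 - ε / 2) * u := by rw [hw]; nlinarith
    have h2 : (w + 2) ^ 2 ≤ ((1 - ε / 2) * u) ^ 2 := by gcongr
    have h3 : (1 - ε / 2) ^ 2 ≤ (1 - ε / 8) ^ 2 := by
      apply pow_le_pow_left₀ <;> linarith
    have h4 : (1 - ε / 8) ^ 2 ≤ 1 := by apply pow_le_one₀ <;> linarith
    have h5 := mul_le_mul_of_nonneg_left h3 (sq_nonneg u)
    nlinarith
  have hlt : Real.exp (-u ^ 2 / 2) < B n i b := by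
    refine lt_of_lt_of_le ?_ htc
    have l2 : (1/2 : ℝ) > Real.exp (-1) := by
      rw [Real.exp_neg, gt_iff_lt, inv_lt_comm₀ (Real.exp_pos _) (by norm_num)]
      have := Real.exp_one_gt_d9
      norm_num; linarith
    calc Real.exp (-u ^ 2 / 2) = Real.exp (-1) * Real.exp (-(u ^ 2 / 2 - 1)) := by
          rw [← Real.exp_add]; congr 1; ring
      _ < 1 / 2 * Real.exp (-(u ^ 2 / 2 - 1)) := by
          apply mul_lt_mul_of_pos_right l2 (Real.exp_pos _)
      _ ≤ _ := by
          gcongr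
          rw [add_div] at x3
          linarith
  rw [lt_B_iff hc0 hc1 hi0 hin.le ⟨hb0.le, by linarith⟩] at hlt
  have : n * bb u n i < n * b := mul_lt_mul_of_pos_left hlt hn
  unfold DD
  rw [hnb] at this; linarith

/-- combined `E1` with all basic facts -/
lemma E1 {ε : ℝ} (hε : 0 < ε) : ∀ᶠ u : ℝ in atTop, ∀ n i : ℕ, Good u n i →
    (1 - ε) * (u * S n i) ≤ DD u n i ∧ DD u n i ≤ (1 + ε) * (u * S n i) := by
  have hm : 0 < min ε 1 := lt_min hε one_pos
  filter_upwards [E1_upper hm (min_le_right _ _), E1_lower hm (min_le_right _ _), eventually_ge_atTop 2]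
    with u h1 h2 hu n i hg
  have hs := (good_base hu hg).2.2.2.1
  have hus : 0 < u * S n i := by apply mul_pos _ hs; linarith
  have := h1 n i hg
  have := h2 n i hg
  have := min_le_left ε 1
  constructor <;> nlinarith

end

end BJ

open MeasureTheory Filter Set

namespace BJ

noncomputable section

/-- package of the facts on one good index -/
structure Pack (ε u : ℝ) (n i : ℕ) : Prop where
  hu : 2 ≤ u
  hueps : 1 ≤ ε * u
  hi : (0:ℝ) < i
  hni : (0:ℝ) < (n:ℝ) - i
  hn : (0:ℝ) < n
  hs : 0 < S n i
  hsn : (S n i) ^ 2 * n = i * (n - i)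
  hsi : (S n i) ^ 2 ≤ i
  hsni : (S n i) ^ 2 ≤ n - i
  hs12 : u ^ 12 ≤ 2 * (S n i) ^ 2
  hs5 : u ^ 5 ≤ S n i
  hi0 : 0 < i
  hin : i < n
  hc0 : 0 < Real.exp (-u ^ 2 / 2)
  hc1 : Real.exp (-u ^ 2 / 2) < 1
  hb0 : 0 < bb u n i
  hb1 : bb u n i < 1
  hB : B n i (bb u n i) = Real.exp (-u ^ 2 / 2)
  hDl : (1 - ε) * (u * S n i) ≤ DD u n i
  hDu : DD u n i ≤ (1 + ε) * (u * S n i)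
  hD0 : 0 < DD u n i
  hus : u * S n i ≤ ε * (S n i) ^ 2
  h1us : 1 ≤ ε * (u * S n i)
  hnb : (1 - ε) * i ≤ n * bb u n i
  hnb' : n * bb u n i ≤ i
  hn1b : n * (1 - bb u n i) ≤ (1 + ε) * (n - i)
  hn1b' : (n:ℝ) - i ≤ n * (1 - bb u n i)
  hsib : (S n i) ^ 2 ≤ i * (1 - bb u n i)
  hsib' : i * (1 - bb u n i) ≤ (1 + ε) * (S n i) ^ 2

set_option maxHeartbeats 2000000 in
lemma pack {ε : ℝ} (hε : 0 < ε) : ∀ᶠ u : ℝ in atTop, ∀ n i : ℕ, Good u n i → Pack ε u n i := by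
  have hm : 0 < min ε 1 / 2 := by have := lt_min hε one_pos; linarith
  filter_upwards [ev_inv hm, E1 hm] with u ⟨hu, hu2⟩ hE n i hg
  obtain ⟨hi, hni, hn, hs, hsn, hsi, hsni, hs12, hs5, hi0, hin⟩ := good_base hu hg
  obtain ⟨hc0, hc1⟩ := cexp (u := u) (by linarith)
  obtain ⟨hb0, hb1, hB⟩ := bq_spec hc0 hc1 hi0 hin.le
  change 0 < bb u n i at hb0
  change bb u n i < 1 at hb1
  change B n i (bb u n i) = _ at hB
  have hus := good_us hu hu2 hg
  obtain ⟨h1, h2⟩ := hE n i hg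
  have hmε := min_le_left ε 1
  have hm1 := min_le_right ε 1
  set m := min ε 1 / 2 with hmdef
  have hmε' : 2 * m ≤ ε := by linarith
  have hm1' : 2 * m ≤ 1 := by linarith
  have hus0 : 0 < u * S n i := by apply mul_pos _ hs; linarith
  have hD0 : 0 < DD u n i := by nlinarith
  have hDD : n * bb u n i = i - DD u n i := by unfold DD; ring
  have hDe : DD u n i ≤ ε * (S n i) ^ 2 := by nlinarith [sq_nonneg (S n i)]
  have hs2 : 0 ≤ S n i ^ 2 := sq_nonneg _
  have hS1 : 1 ≤ S n i := by
    have : 1 ≤ u ^ 5 := one_le_pow₀ (by linarith)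
    linarith
  have hn1b : n * (1 - bb u n i) ≤ (1 + ε) * (n - i) := by nlinarith
  have hn1b' : (n:ℝ) - i ≤ n * (1 - bb u n i) := by nlinarith
  refine ⟨hu, by nlinarith, hi, hni, hn, hs, hsn, hsi, hsni, hs12, hs5, hi0, hin, hc0, hc1, hb0, hb1, hB,
    by nlinarith, by nlinarith, hD0, by nlinarith, ?_, by nlinarith, by linarith, hn1b, hn1b', ?_, ?_⟩
  · calc (1:ℝ) ≤ m * u := hu2
      _ ≤ ε * (u * S n i) := by
        have : u ≤ u * S n i := by nlinarith
        have : 0 < u := by linarith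
        gcongr
        linarith
  · have : n * (S n i) ^ 2 ≤ n * (i * (1 - bb u n i)) := by nlinarith
    exact le_of_mul_le_mul_left this hn
  · have : n * (i * (1 - bb u n i)) ≤ n * ((1 + ε) * (S n i) ^ 2) := by
      have e : n * ((1 + ε) * (S n i) ^ 2) = (1 + ε) * (i * (n - i)) := by rw [← hsn]; ring
      rw [e]; nlinarith
    exact le_of_mul_le_mul_left this hn

lemma binpmf_ratio {n k : ℕ} (hk : k < n) (b : ℝ) :
    ((k:ℝ) + 1) * (1 - b) * binpmf n b (k + 1) = (n - k) * b * binpmf n b k := by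
  unfold binpmf
  have h1 : ((n.choose (k + 1) : ℝ)) * (k + 1) = n.choose k * (n - k) := by
    have := Nat.choose_succ_right_eq n k
    have h2 : ((n - k : ℕ) : ℝ) = n - k := by rw [Nat.cast_sub hk.le]
    rw [← h2]; exact_mod_cast this
  have h3 : (1 - b) ^ (n - k) = (1 - b) ^ (n - (k + 1)) * (1 - b) := by
    rw [← pow_succ]; congr 1; omega
  rw [h3, pow_succ]
  linear_combination (b ^ k * b * (1 - b) ^ (n - (k + 1)) * (1 - b)) * h1

lemma binpmf_big {n k : ℕ} (hk : n < k) (b : ℝ) : binpmf n b k = 0 := by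
  unfold binpmf; rw [Nat.choose_eq_zero_of_lt hk]; simp

lemma ratio_le {n i k : ℕ} {b : ℝ} (hb0 : 0 < b) (hb1 : b < 1) (hi : 0 < i) (hik : i ≤ k) :
    binpmf n b (k + 1) ≤ (1 - (i - n * b) / (i * (1 - b))) * binpmf n b k := by
  have hi' : (0:ℝ) < i := by exact_mod_cast hi
  have hik' : (i:ℝ) ≤ k := by exact_mod_cast hik
  have h1b : 0 < 1 - b := by linarith
  have e : 1 - (i - n * b) / (i * (1 - b)) = (n - i) * b / (i * (1 - b)) := by
    field_simp; ring
  have hP : 0 ≤ binpmf n b k := binpmf_nonneg hb0.le hb1.le k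
  have hP' : 0 ≤ binpmf n b (k+1) := binpmf_nonneg hb0.le hb1.le _
  rcases lt_or_ge k n with hk | hk
  · have hr := binpmf_ratio hk b
    have hkn : (k:ℝ) < n := by exact_mod_cast hk
    rw [e, div_mul_eq_mul_div, le_div_iff₀ (by positivity)]
    calc binpmf n b (k + 1) * (i * (1 - b)) ≤ ((k:ℝ) + 1) * (1 - b) * binpmf n b (k + 1) := by
          nlinarith [mul_nonneg hP' h1b.le]
      _ = (n - k) * b * binpmf n b k := hr
      _ ≤ _ := by gcongr
  · rw [binpmf_big (by omega)]
    rcases hk.eq_or_lt with h | h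
    · apply mul_nonneg _ hP
      rw [e]
      apply div_nonneg _ (by positivity)
      apply mul_nonneg _ hb0.le
      have : (i:ℝ) ≤ n := by rw [h]; exact hik'
      linarith
    · rw [binpmf_big h]; simp

lemma P_lower {n i : ℕ} {b : ℝ} (hb0 : 0 < b) (hb1 : b < 1) (hi : 0 < i) (hin : i ≤ n) :
    (i - n * b) / (i * (1 - b)) * B n i b ≤ binpmf n b i := by
  unfold B
  have key : ∑ k ∈ Finset.Icc i n, (binpmf n b k - binpmf n b (k+1)) = binpmf n b i := by
    rw [← Finset.Ico_add_one_right_eq_Icc]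
    have := Finset.sum_Ico_sub (binpmf n b) (show i ≤ n + 1 by omega)
    rw [← neg_inj, ← Finset.sum_neg_distrib]
    simp only [neg_sub]
    rw [this, binpmf_big (show n < n + 1 by omega)]; ring
  rw [← key, Finset.mul_sum]
  refine Finset.sum_le_sum fun k hk => ?_
  have := ratio_le (n := n) hb0 hb1 hi (Finset.mem_Icc.1 hk).1
  linarith

lemma P_upper {n i m : ℕ} {b : ℝ} (hb0 : 0 < b) (hb1 : b < 1) (hi : 0 < i) (him : i + m ≤ n)
    (hD : 0 ≤ i - n * b) :
    binpmf n b i * (1 - Real.exp (-(m * ((i - n * b) / (i * (1 - b)))))) ≤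
      (i - n * b + m + 1) / (i * (1 - b)) * B n i b := by
  have hi' : (0:ℝ) < i := by exact_mod_cast hi
  have h1b : 0 < 1 - b := by linarith
  set x := (i - n * b) / (i * (1 - b)) with hx
  have hPn : ∀ k, 0 ≤ binpmf n b k := fun k => binpmf_nonneg hb0.le hb1.le k
  have h1 : ∀ l, binpmf n b (i + l) ≤ Real.exp (-x) ^ l * binpmf n b i := by
    intro l
    induction l with
    | zero => simp
    | succ l ih =>
      calc binpmf n b (i + l + 1) ≤ (1 - x) * binpmf n b (i + l) := ratio_le hb0 hb1 hi (by omega)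
        _ ≤ Real.exp (-x) * binpmf n b (i + l) := by
          gcongr
          · exact hPn _
          · have := Real.add_one_le_exp (-x); linarith
        _ ≤ Real.exp (-x) * (Real.exp (-x) ^ l * binpmf n b i) := by gcongr
        _ = _ := by ring
  have h2 : binpmf n b i * (1 - Real.exp (-(m * x))) ≤ binpmf n b i - binpmf n b (i + m) := by
    have := h1 m
    rw [← Real.exp_nat_mul] at this
    have e : -(m * x) = m * -x := by ring
    rw [e]; nlinarith
  refine h2.trans ?_
  have key : ∑ k ∈ Finset.Ico i (i + m), (binpmf n b k - binpmf n b (k+1)) = binpmf n b i - binpmf n b (i+m) := by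
    have := Finset.sum_Ico_sub (binpmf n b) (show i ≤ i + m by omega)
    rw [← neg_inj, ← Finset.sum_neg_distrib]
    simp only [neg_sub]
    rw [this]
  rw [← key]
  have h3 : ∑ k ∈ Finset.Ico i (i + m), binpmf n b k ≤ B n i b := by
    unfold B
    refine Finset.sum_le_sum_of_subset_of_nonneg ?_ fun k _ _ => hPn k
    intro k hk
    simp only [Finset.mem_Ico, Finset.mem_Icc] at hk ⊢; omega
  calc _ ≤ ∑ k ∈ Finset.Ico i (i + m), (i - n * b + m + 1) / (i * (1 - b)) * binpmf n b k := by
        refine Finset.sum_le_sum fun k hk => ?_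
        simp only [Finset.mem_Ico] at hk
        have hr := binpmf_ratio (show k < n by omega) b
        have hk1 : (i:ℝ) ≤ k := by exact_mod_cast hk.1
        have hk2 : (k:ℝ) + 1 ≤ i + m := by exact_mod_cast hk.2
        have hk0 : (0:ℝ) < k + 1 := by linarith
        have e : binpmf n b (k+1) = (n - k) * b / ((k+1) * (1 - b)) * binpmf n b k := by
          field_simp
          linear_combination hr
        rw [e]
        have e2 : binpmf n b k - (n - k) * b / ((k+1) * (1 - b)) * binpmf n b k =
          ((k + 1 - (n+1) * b) / ((k + 1) * (1 - b))) * binpmf n b k := by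
          field_simp; ring
        rw [e2]
        apply mul_le_mul_of_nonneg_right _ (hPn k)
        have hm0 : (0:ℝ) ≤ m := by positivity
        calc (k + 1 - (n+1) * b) / ((k + 1) * (1 - b)) ≤ (i - n * b + m + 1) / ((k + 1) * (1 - b)) := by
              gcongr; linarith
          _ ≤ _ := by gcongr; linarith
    _ ≤ _ := by
        rw [← Finset.mul_sum]
        gcongr

end

end BJ

open MeasureTheory Filter Set

namespace BJ

noncomputable section

lemma E2_lower {ε : ℝ} (hε : 0 < ε) (hε1 : ε ≤ 1) : ∀ᶠ u : ℝ in atTop, ∀ n i : ℕ, Good u n i →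
    (1 - ε) * (Real.exp (-u ^ 2 / 2) * (u / S n i)) ≤ binpmf n (bb u n i) i := by
  filter_upwards [pack (show 0 < ε / 2 by linarith)] with u hpk n i hg
  have p := hpk n i hg
  have h := P_lower p.hb0 p.hb1 p.hi0 p.hin.le
  rw [p.hB] at h
  refine le_trans ?_ h
  change _ ≤ DD u n i / (i * (1 - bb u n i)) * _
  have h1b : 0 < 1 - bb u n i := by linarith [p.hb1]
  have hi := p.hi
  have hs := p.hs
  have : (1 - ε) * (u / S n i) ≤ DD u n i / (i * (1 - bb u n i)) := by
    rw [le_div_iff₀ (by positivity)]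
    have hus : 0 ≤ u / S n i := by have := p.hu; positivity
    calc (1 - ε) * (u / S n i) * (i * (1 - bb u n i)) ≤ (1 - ε) * (u / S n i) * ((1 + ε/2) * (S n i) ^ 2) := by
          apply mul_le_mul_of_nonneg_left p.hsib'
          apply mul_nonneg _ hus; linarith
      _ = (1 - ε) * (1 + ε/2) * (u * S n i) := by field_simp
      _ ≤ (1 - ε/2) * (u * S n i) := by
          have : 0 < u * S n i := by have := p.hu; positivity
          apply mul_le_mul_of_nonneg_right _ this.le
          nlinarith
      _ ≤ _ := p.hDl
  have hc := p.hc0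
  calc _ = (1 - ε) * (u / S n i) * Real.exp (-u ^ 2 / 2) := by ring
    _ ≤ _ := by gcongr

lemma E2_upper {ε : ℝ} (hε : 0 < ε) (hε1 : ε ≤ 1) : ∀ᶠ u : ℝ in atTop, ∀ n i : ℕ, Good u n i →
    binpmf n (bb u n i) i ≤ (1 + ε) * (Real.exp (-u ^ 2 / 2) * (u / S n i)) := by
  have hη : 0 < ε / 16 := by linarith
  have hexp : ∀ᶠ u : ℝ in atTop, Real.exp (-(ε / 16 * u ^ 2 / 4)) ≤ ε / 4 := by
    have : Tendsto (fun u : ℝ => Real.exp (-(ε / 16 * u ^ 2 / 4))) atTop (nhds 0) := by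
      apply Real.tendsto_exp_neg_atTop_nhds_zero.comp
      have := (tendsto_pow_atTop (α := ℝ) (n := 2) (by norm_num)).const_mul_atTop (show 0 < ε / 64 by linarith)
      refine this.congr fun u => by ring
    exact this.eventually_le_const (by linarith)
  filter_upwards [pack hη, hexp] with u hpk hexp n i hg
  have p := hpk n i hg
  have hu := p.hu
  have hu0 : 0 < u := by linarith
  have hs := p.hs
  have hus : 0 < u * S n i := by positivity
  set m := ⌈ε / 16 * (u * S n i)⌉₊ with hm
  have hm1 : ε / 16 * (u * S n i) ≤ m := Nat.le_ceil _
  have hm2 : (m:ℝ) ≤ ε / 16 * (u * S n i) + 1 := (Nat.ceil_lt_add_one (by positivity)).le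
  have h1us := p.h1us
  have hm3 : (m:ℝ) ≤ n - i := by
    have := p.hus; have := p.hsni
    have : (1:ℝ) ≤ u * S n i := by nlinarith
    nlinarith [sq_nonneg (S n i)]
  have him : i + m ≤ n := by
    have : (i:ℝ) + m ≤ n := by linarith
    exact_mod_cast this
  have h := P_upper (m := m) p.hb0 p.hb1 p.hi0 him (by have := p.hD0; unfold DD at this; exact this.le)
  rw [p.hB] at h
  change _ * (1 - Real.exp (-(m * (DD u n i / (i * (1 - bb u n i)))))) ≤ (DD u n i + m + 1) / (i * (1 - bb u n i)) * _ at h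
  have h1b : 0 < 1 - bb u n i := by linarith [p.hb1]
  have hi := p.hi
  have hc := p.hc0
  have hP : 0 ≤ binpmf n (bb u n i) i := binpmf_nonneg p.hb0.le p.hb1.le _
  have x1 : u / S n i / 4 ≤ DD u n i / (i * (1 - bb u n i)) := by
    rw [le_div_iff₀ (by positivity)]
    calc u / S n i / 4 * (i * (1 - bb u n i)) ≤ u / S n i / 4 * ((1 + ε/16) * (S n i) ^ 2) := by
          exact mul_le_mul_of_nonneg_left p.hsib' (by positivity)
      _ = (1 + ε/16)/4 * (u * S n i) := by field_simp
      _ ≤ (1 - ε/16) * (u * S n i) := by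
          apply mul_le_mul_of_nonneg_right _ hus.le
          linarith
      _ ≤ _ := p.hDl
  have x2 : Real.exp (-(m * (DD u n i / (i * (1 - bb u n i))))) ≤ ε / 4 := by
    refine le_trans (Real.exp_le_exp.2 (neg_le_neg ?_)) hexp
    calc ε / 16 * u ^ 2 / 4 = (ε / 16 * (u * S n i)) * (u / S n i / 4) := by field_simp
      _ ≤ _ := by gcongr
  have x3 : (DD u n i + m + 1) / (i * (1 - bb u n i)) ≤ (1 + ε / 4) * (u / S n i) := by
    calc _ ≤ (DD u n i + m + 1) / (S n i) ^ 2 := by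
          have := p.hD0
          gcongr; exact p.hsib
      _ ≤ ((1 + ε/4) * (u * S n i)) / (S n i) ^ 2 := by
          gcongr
          have := p.hDu
          nlinarith
      _ = _ := by field_simp
  have x4 : binpmf n (bb u n i) i * (1 - ε / 4) ≤ (1 + ε / 4) * (u / S n i) * Real.exp (-u ^ 2 / 2) := by
    calc _ ≤ binpmf n (bb u n i) i * (1 - Real.exp (-(m * (DD u n i / (i * (1 - bb u n i)))))) := by gcongr
      _ ≤ _ := h
      _ ≤ _ := by gcongr
  have hus' : 0 ≤ u / S n i := by positivity
  set X := Real.exp (-u ^ 2 / 2) * (u / S n i) with hX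
  have hX0 : 0 ≤ X := by positivity
  have x5 : binpmf n (bb u n i) i * (1 - ε / 4) ≤ (1 + ε / 4) * X := by rw [hX]; linarith
  have : (1 + ε / 4) ≤ (1 + ε) * (1 - ε / 4) := by nlinarith
  have h4 : 0 < 1 - ε / 4 := by linarith
  refine le_of_mul_le_mul_right ?_ h4
  nlinarith

/-- exact integral identity in the form of a comparison, upper side -/
lemma E3_aux1 {n i : ℕ} {b h : ℝ} (hin : i < n) (hb0 : 0 < b) (hh : 0 ≤ h) (hbh : b + h < 1)
    (heq : B n (i + 1) (b + h) = B n i b) :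
    ∀ G : ℝ → ℝ, ∀ g : ℝ → ℝ, (∀ v, HasDerivAt G (g v) v) →
     ((∀ v ∈ Icc 0 h, (1 + v / b) ^ i * (1 - v / (1 - b)) ^ (n - 1 - i) ≤ g v) →
        1 ≤ ((n:ℝ) - i) / (1 - b) * (G h - G 0)) ∧
     ((∀ v ∈ Icc 0 h, g v ≤ (1 + v / b) ^ i * (1 - v / (1 - b)) ^ (n - 1 - i)) →
        ((n:ℝ) - i) / (1 - b) * (G h - G 0) ≤ 1) := by
  intro G g hG
  have h1b : 0 < 1 - b := by linarith
  have hbp : 0 < binpmf n b i := binpmf_pos hb0 (by linarith) hin.le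
  have hinR : (0:ℝ) < (n:ℝ) - i := by
    have : (i:ℝ) < n := by exact_mod_cast hin
    linarith
  have hB : B n i b = binpmf n b i + B n (i+1) b := by
    unfold B
    rw [← Finset.add_sum_Ioc_eq_sum_Icc hin.le]
    congr 2; ext k; simp only [Finset.mem_Ioc, Finset.mem_Icc]; omega
  set lam := ((n:ℝ) - i) / (1 - b) with hlam
  set f : ℝ → ℝ := fun v => B n (i+1) (b + v) with hf
  set g0 : ℝ → ℝ := fun v => (1 + v / b) ^ i * (1 - v / (1 - b)) ^ (n - 1 - i) with hg0
  have hder : ∀ v, HasDerivAt f (binpmf n b i * lam * g0 v) v := by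
    intro v
    obtain ⟨n', rfl⟩ : ∃ n', n = n' + 1 := ⟨n - 1, by omega⟩
    have h1 := hasDerivAt_B n' (i+1) (by omega) (by omega) (b + v)
    have h2 := h1.comp_const_add b v
    refine h2.congr_deriv ?_
    simp only [Nat.add_sub_cancel, hlam, hg0]
    unfold binpmf
    have e1 : ((n'+1).choose i : ℝ) * ((n' + 1 : ℕ) - i) = (n' + 1) * n'.choose i := by
      have h3 := Nat.add_one_mul_choose_eq n' i
      have h4 := Nat.choose_succ_right_eq (n'+1) i
      have h5 : (((n' + 1 : ℕ) - i : ℕ) : ℝ) = ((n' + 1 : ℕ) : ℝ) - i := by rw [Nat.cast_sub hin.le]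
      rw [← h5]
      have : (n' + 1).choose i * (n' + 1 - i) = (n' + 1) * n'.choose i := by rw [← h4, h3]
      exact_mod_cast this
    have e2 : (1 + v / b) ^ i * b ^ i = (b + v) ^ i := by
      rw [← mul_pow]; congr 1; field_simp
    have e3 : (1 - v / (1 - b)) ^ (n' - i) * (1 - b) ^ (n' - i) = (1 - (b + v)) ^ (n' - i) := by
      rw [← mul_pow]; congr 1; field_simp; ring
    have e4 : (1 - b) ^ (n' + 1 - i) = (1 - b) ^ (n' - i) * (1 - b) := by
      rw [← pow_succ]; congr 1; omega
    rw [e4, ← e2, ← e3]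
    have e5 : (1 - b) * (((n' + 1 : ℕ):ℝ) - i) / (1 - b) = ((n' + 1 : ℕ):ℝ) - i := by field_simp
    calc _ = ((n' : ℝ) + 1) * n'.choose i * ((1 + v / b) ^ i * b ^ i * ((1 - v / (1 - b)) ^ (n' - i) * (1 - b) ^ (n' - i))) := by ring
      _ = (((n'+1).choose i : ℝ) * ((n' + 1 : ℕ) - i)) * ((1 + v / b) ^ i * b ^ i * ((1 - v / (1 - b)) ^ (n' - i) * (1 - b) ^ (n' - i))) := by rw [e1]
      _ = (((n'+1).choose i : ℝ) * ((1 - b) * (((n' + 1 : ℕ):ℝ) - i) / (1 - b))) * ((1 + v / b) ^ i * b ^ i * ((1 - v / (1 - b)) ^ (n' - i) * (1 - b) ^ (n' - i))) := by rw [e5]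
      _ = _ := by ring
  have hff : f h - f 0 = binpmf n b i := by
    simp only [hf, add_zero]; rw [heq, hB]; ring
  have hPl : 0 < binpmf n b i * lam := by positivity
  constructor
  · intro hv
    -- f - P λ G antitone
    have hd : ∀ v, HasDerivAt (fun v => binpmf n b i * lam * G v - f v)
        (binpmf n b i * lam * g v - binpmf n b i * lam * g0 v) v := fun v =>
      ((hG v).const_mul _).sub (hder v)
    have hmono : MonotoneOn (fun v => binpmf n b i * lam * G v - f v) (Icc 0 h) := by
      refine monotoneOn_of_deriv_nonneg (convex_Icc 0 h) (fun v _ => (hd v).continuousAt.continuousWithinAt)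
        (fun v _ => (hd v).differentiableAt.differentiableWithinAt) ?_
      intro v hv'
      rw [(hd v).deriv]
      have := hv v (interior_subset hv')
      have := mul_le_mul_of_nonneg_left this hPl.le
      simp only [hg0]; linarith
    have := hmono (left_mem_Icc.2 hh) (right_mem_Icc.2 hh) hh
    simp only at this
    have h6 : binpmf n b i * 1 ≤ binpmf n b i * (lam * (G h - G 0)) := by linarith
    exact le_of_mul_le_mul_left h6 hbp
  · intro hv
    have hd : ∀ v, HasDerivAt (fun v => f v - binpmf n b i * lam * G v)
        (binpmf n b i * lam * g0 v - binpmf n b i * lam * g v) v := fun v =>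
      (hder v).sub ((hG v).const_mul _)
    have hmono : MonotoneOn (fun v => f v - binpmf n b i * lam * G v) (Icc 0 h) := by
      refine monotoneOn_of_deriv_nonneg (convex_Icc 0 h) (fun v _ => (hd v).continuousAt.continuousWithinAt)
        (fun v _ => (hd v).differentiableAt.differentiableWithinAt) ?_
      intro v hv'
      rw [(hd v).deriv]
      have := hv v (interior_subset hv')
      have := mul_le_mul_of_nonneg_left this hPl.le
      simp only [hg0]; linarith
    have := hmono (left_mem_Icc.2 hh) (right_mem_Icc.2 hh) hh
    simp only at this
    have h6 : binpmf n b i * (lam * (G h - G 0)) ≤ binpmf n b i * 1 := by linarith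
    exact le_of_mul_le_mul_left h6 hbp

lemma delta_upper {n i : ℕ} {b h : ℝ} (hin : i < n) (hb0 : 0 < b) (hh : 0 ≤ h) (hbh : b + h < 1)
    (heq : B n (i + 1) (b + h) = B n i b) (hD : 0 ≤ i - n * b) :
    1 - ((n:ℝ) - i) / (1 - b) * h ≤ (i - n * b + b) / (2 * b * (n - i)) := by
  have h1b : 0 < 1 - b := by linarith
  have hinR : (0:ℝ) < (n:ℝ) - i := by
    have : (i:ℝ) < n := by exact_mod_cast hin
    linarith
  have hcast : ((n - 1 - i : ℕ) : ℝ) = n - 1 - i := by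
    rw [Nat.sub_sub, Nat.cast_sub (by omega)]; push_cast; ring
  set a := (i - n * b + b) / (b * (1 - b)) with ha
  have ha0 : 0 < a := by apply div_pos (by linarith) (by positivity)
  have ha' : a = i / b - (n - 1 - i) / (1 - b) := by rw [ha]; field_simp; ring
  have hG : ∀ v : ℝ, HasDerivAt (fun v => Real.exp (a * v) / a) (Real.exp (a * v)) v := by
    intro v
    have h1 : HasDerivAt (fun v : ℝ => a * v) (a * 1) v := (hasDerivAt_id v).const_mul a
    have := (h1.exp).div_const a
    refine this.congr_deriv ?_
    field_simp
  have key := (E3_aux1 hin hb0 hh hbh heq _ _ hG).1 ?_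
  · set lam := ((n:ℝ) - i) / (1 - b) with hlam
    have hl0 : 0 < lam := by positivity
    simp only [mul_zero, Real.exp_zero] at key
    have k1 : 1 + a / lam ≤ Real.exp (a * h) := by
      have : a / lam * 1 ≤ a / lam * (lam * (Real.exp (a * h) / a - 1 / a)) := by gcongr
      have e : a / lam * (lam * (Real.exp (a * h) / a - 1 / a)) = Real.exp (a * h) - 1 := by field_simp
      linarith
    have k2 : Real.log (1 + a / lam) ≤ a * h := by
      rw [Real.log_le_iff_le_exp (by positivity)]; exact k1
    have hx0 : 0 ≤ a / lam := by positivity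
    have k3 := Real.le_log_one_add_of_nonneg hx0
    set x := a / lam with hx
    have k4 : x - x ^ 2 / 2 ≤ 2 * x / (x + 2) := by
      rw [le_div_iff₀ (by positivity)]
      nlinarith [pow_nonneg hx0 3]
    have e1 : a * h = x * (lam * h) := by rw [hx]; field_simp
    have hxp : 0 < x := by positivity
    have k5 : x * (1 - x / 2) ≤ x * (lam * h) := by rw [← e1]; nlinarith
    have k6 := le_of_mul_le_mul_left k5 hxp
    have e2 : x / 2 = (i - n * b + b) / (2 * b * (n - i)) := by
      rw [hx, ha, hlam]; field_simp
    linarith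
  · intro v hv
    have hv1 : v < 1 - b := by linarith [hv.2]
    have x1 : (1 + v / b) ^ i ≤ Real.exp (i * (v / b)) := by
      rw [Real.exp_nat_mul]
      refine pow_le_pow_left₀ ?_ ?_ _
      · have := div_nonneg hv.1 hb0.le; linarith
      · have := Real.add_one_le_exp (v / b); linarith
    have x2 : (1 - v / (1 - b)) ^ (n - 1 - i) ≤ Real.exp ((n - 1 - i : ℕ) * (-(v / (1 - b)))) := by
      rw [Real.exp_nat_mul]
      refine pow_le_pow_left₀ ?_ ?_ _
      · have := (div_lt_one h1b).2 hv1; linarith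
      · have := Real.add_one_le_exp (-(v / (1 - b))); linarith
    have x3 : 0 ≤ (1 - v / (1 - b)) ^ (n - 1 - i) := by
      apply pow_nonneg
      have := (div_lt_one h1b).2 hv1; linarith
    calc _ ≤ Real.exp (i * (v / b)) * Real.exp ((n - 1 - i : ℕ) * (-(v / (1 - b)))) := by gcongr
      _ = _ := by
        rw [← Real.exp_add, hcast, ha']; congr 1; ring

lemma delta_lower {n i : ℕ} {b h : ℝ} (hin : i < n) (hb0 : 0 < b) (hh : 0 ≤ h) (hbh : b + h < 1)
    (heq : B n (i + 1) (b + h) = B n i b) :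
    ((n:ℝ) - i) / (1 - b) * (h + (i - (n - 1) * (b + h)) / ((b + h) * (1 - (b + h))) * h ^ 2 / 2) ≤ 1 := by
  have h1b : 0 < 1 - b := by linarith
  have hbp : 0 < b + h := by linarith
  have hbm : 0 < 1 - (b + h) := by linarith
  have hcast : ((n - 1 - i : ℕ) : ℝ) = n - 1 - i := by
    rw [Nat.sub_sub, Nat.cast_sub (by omega)]; push_cast; ring
  set a := (i - (n - 1) * (b + h)) / ((b + h) * (1 - (b + h))) with ha
  have ha' : a = i / (b + h) - (n - 1 - i) / (1 - (b + h)) := by rw [ha]; field_simp; ring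
  have hG : ∀ v : ℝ, HasDerivAt (fun v => v + a * v ^ 2 / 2) (1 + a * v) v := by
    intro v
    have h1 := (hasDerivAt_id v).add ((((hasDerivAt_id v).pow 2).const_mul a).div_const 2)
    refine (h1.congr_deriv ?_)
    simp; ring
  have key := (E3_aux1 hin hb0 hh hbh heq _ _ hG).2 ?_
  · simpa using key
  · intro v hv
    have hv1 : v < 1 - b := by linarith [hv.2]
    have x1 : Real.exp (i * (v / (b + h))) ≤ (1 + v / b) ^ i := by
      rw [Real.exp_nat_mul]
      refine pow_le_pow_left₀ (Real.exp_pos _).le ?_ _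
      have h0 : 0 < 1 + v / b := by have := div_nonneg hv.1 hb0.le; linarith
      rw [← Real.le_log_iff_exp_le h0]
      refine le_trans ?_ (Real.one_sub_inv_le_log_of_pos h0)
      have hv0 := hv.1
      have hbv : 0 < b + v := by linarith
      have : 1 - (1 + v / b)⁻¹ = v / (b + v) := by
        have e : 1 + v / b = (b + v) / b := by field_simp
        rw [e]; field_simp; ring
      rw [this]
      gcongr
      exact hv.2
    have x2 : Real.exp ((n - 1 - i : ℕ) * (-(v / (1 - (b + h))))) ≤ (1 - v / (1 - b)) ^ (n - 1 - i) := by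
      rw [Real.exp_nat_mul]
      refine pow_le_pow_left₀ (Real.exp_pos _).le ?_ _
      have h0 : 0 < 1 - v / (1 - b) := by have := (div_lt_one h1b).2 hv1; linarith
      rw [← Real.le_log_iff_exp_le h0]
      refine le_trans ?_ (Real.one_sub_inv_le_log_of_pos h0)
      have hv0 := hv.1
      have hbv : 0 < 1 - b - v := by linarith
      have : 1 - (1 - v / (1 - b))⁻¹ = - (v / (1 - b - v)) := by
        have e : 1 - v / (1 - b) = (1 - b - v) / (1 - b) := by field_simp
        rw [e]; field_simp; ring
      rw [this]
      apply neg_le_neg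
      apply div_le_div_of_nonneg_left hv0 hbm
      linarith [hv.2]
    calc 1 + a * v ≤ Real.exp (a * v) := by linarith [Real.add_one_le_exp (a * v)]
      _ = Real.exp (i * (v / (b + h))) * Real.exp ((n - 1 - i : ℕ) * (-(v / (1 - (b + h))))) := by
        rw [← Real.exp_add, hcast, ha']; congr 1; ring
      _ ≤ _ := mul_le_mul x1 x2 (Real.exp_pos _).le ((Real.exp_pos _).le.trans x1)

end

end BJ

open MeasureTheory Filter Set

namespace BJ

noncomputable section

lemma good_between {u : ℝ} {n i j k : ℕ} (hi : Good u n i) (hj : Good u n j) (hik : i ≤ k) (hkj : k ≤ j) :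
    Good u n k := by
  have h1 : (i:ℝ) ≤ k := by exact_mod_cast hik
  have h2 : (k:ℝ) ≤ j := by exact_mod_cast hkj
  exact ⟨hi.1.trans h1, by have := hj.2; linarith⟩

lemma S_window {ε u κ : ℝ} {n i j : ℕ} (p : Pack ε u n i) (q : Pack ε u n j) (hκ0 : 0 ≤ κ) (hκ : κ ≤ 1)
    (hij : i ≤ j) (hj : (j:ℝ) ≤ i + κ * (S n i) ^ 2) :
    (1 - κ) * (S n i) ^ 2 ≤ (S n j) ^ 2 ∧ (S n j) ^ 2 ≤ (1 + κ) * (S n i) ^ 2 ∧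
    (1 - κ) * S n i ≤ S n j ∧ S n j ≤ (1 + κ) * S n i ∧ (1 - κ) * ((n:ℝ) - i) ≤ n - j := by
  have hij' : (i:ℝ) ≤ j := by exact_mod_cast hij
  have h1 : (1 - κ) * ((n:ℝ) - i) ≤ n - j := by
    have := mul_le_mul_of_nonneg_left p.hsni hκ0; linarith
  have h2 : (j:ℝ) ≤ (1 + κ) * i := by
    have := mul_le_mul_of_nonneg_left p.hsi hκ0; linarith
  have a1 : (1 - κ) * (S n i) ^ 2 ≤ (S n j) ^ 2 := by
    refine le_of_mul_le_mul_right ?_ p.hn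
    have hi := p.hi
    have hni := q.hni
    calc (1 - κ) * S n i ^ 2 * n = i * ((1 - κ) * ((n:ℝ) - i)) := by linear_combination (1 - κ) * p.hsn
      _ ≤ j * (n - j) := mul_le_mul hij' h1 (mul_nonneg (by linarith) p.hni.le) (by linarith)
      _ = _ := q.hsn.symm
  have a2 : (S n j) ^ 2 ≤ (1 + κ) * (S n i) ^ 2 := by
    refine le_of_mul_le_mul_right ?_ p.hn
    have hi := p.hi
    have hni := q.hni
    calc S n j ^ 2 * n = j * (n - j) := q.hsn
      _ ≤ ((1 + κ) * i) * (n - i) := by gcongr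
      _ = _ := by linear_combination -(1 + κ) * p.hsn
  have hs := p.hs
  have hs' := q.hs
  refine ⟨a1, a2, ?_, ?_, h1⟩
  · refine le_of_sq_le_sq ?_ hs'.le
    refine le_trans ?_ a1
    rw [mul_pow]
    have : 0 ≤ S n i ^ 2 := sq_nonneg _
    nlinarith
  · refine le_of_sq_le_sq ?_ (by positivity)
    refine a2.trans ?_
    rw [mul_pow]
    have : 0 ≤ S n i ^ 2 := sq_nonneg _
    nlinarith

/-- increments of the quantiles -/
def hh (u : ℝ) (n i : ℕ) : ℝ := bb u n (i + 1) - bb u n i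

/-- local intensity -/
def lam (u : ℝ) (n i : ℕ) : ℝ := ((n:ℝ) - i) / (1 - bb u n i)

lemma hh_facts {ε u : ℝ} {n i : ℕ} (p : Pack ε u n i) (q : Pack ε u n (i + 1)) :
    0 < hh u n i ∧ bb u n i + hh u n i = bb u n (i + 1) ∧
    B n (i + 1) (bb u n i + hh u n i) = B n i (bb u n i) := by
  have e : bb u n i + hh u n i = bb u n (i + 1) := by unfold hh; ring
  refine ⟨?_, e, by rw [e, p.hB, q.hB]⟩
  have := bq_lt_succ p.hc0 p.hc1 p.hi0 (show i < n from p.hin)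
  unfold hh bb; linarith

lemma E3_upper {ε : ℝ} (hε : 0 < ε) (hε1 : ε ≤ 1) : ∀ᶠ u : ℝ in atTop, ∀ n i : ℕ, Good u n i → Good u n (i+1) →
    1 - lam u n i * hh u n i ≤ (1 + ε) * (u / (2 * S n i)) := by
  filter_upwards [pack (show 0 < ε / 8 by linarith)] with u hpk n i hg hg'
  have p := hpk n i hg
  have q := hpk n (i+1) hg'
  obtain ⟨h0, h1, h2⟩ := hh_facts p q
  have hs := p.hs
  have h := delta_upper p.hin p.hb0 h0.le (by rw [h1]; exact q.hb1) h2 (by have := p.hD0; unfold DD at this; linarith)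
  refine h.trans ?_
  have hb0 := p.hb0
  have hni := p.hni
  have hn := p.hn
  rw [div_le_iff₀ (by positivity)]
  change DD u n i + bb u n i ≤ _
  have hu := p.hu
  have hk : (1 - ε / 8) * (S n i) ^ 2 ≤ bb u n i * (n - i) := by
    refine le_of_mul_le_mul_right ?_ p.hn
    calc (1 - ε / 8) * S n i ^ 2 * n = ((1 - ε / 8) * i) * (n - i) := by linear_combination (1 - ε / 8) * p.hsn
      _ ≤ (n * bb u n i) * (n - i) := mul_le_mul_of_nonneg_right p.hnb hni.le
      _ = _ := by ring
  calc DD u n i + bb u n i ≤ (1 + ε/8) * (u * S n i) + ε / 8 * (u * S n i) := by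
        have := p.hDu; have := p.hb1; have := p.h1us; linarith
    _ ≤ (1 + ε) * (1 - ε / 8) * (u * S n i) := by
        have : 0 < u * S n i := by positivity
        rw [← add_mul]
        gcongr
        nlinarith
    _ = (1 + ε) * (u / S n i) * ((1 - ε / 8) * S n i ^ 2) := by field_simp
    _ ≤ (1 + ε) * (u / S n i) * (bb u n i * (n - i)) := by gcongr
    _ = _ := by field_simp

set_option maxHeartbeats 2000000 in
lemma E3_lower {ε : ℝ} (hε : 0 < ε) (hε1 : ε ≤ 1) : ∀ᶠ u : ℝ in atTop, ∀ n i : ℕ, Good u n i → Good u n (i+1) →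
    (1 - ε) * (u / (2 * S n i)) ≤ 1 - lam u n i * hh u n i := by
  filter_upwards [pack (show 0 < ε / 32 by linarith), E3_upper one_pos le_rfl] with u hpk h3 n i hg hg'
  have p := hpk n i hg
  have q := hpk n (i+1) hg'
  have h3 := h3 n i hg hg'
  obtain ⟨h0, h1, h2⟩ := hh_facts p q
  have hs := p.hs
  have h := delta_lower p.hin p.hb0 h0.le (by rw [h1]; exact q.hb1) h2
  rw [h1] at h
  change lam u n i * (hh u n i + _) ≤ 1 at h
  have hu := p.hu
  have hn := p.hn
  have hs' := q.hs
  have h1us := p.h1us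
  have hus := p.hus
  have hus0 : 0 < u * S n i := by positivity
  have hS2 : 0 < S n i ^ 2 := by positivity
  have hw := S_window p q (κ := ε / 32) (by linarith) (by linarith) (by omega) (by
    push_cast; nlinarith)
  -- lam ≤ n
  have h1b : 0 < 1 - bb u n i := by linarith [p.hb1]
  have hl0 : 0 < lam u n i := div_pos p.hni h1b
  have hl : lam u n i ≤ n := by
    unfold lam; rw [div_le_iff₀ h1b]; have := p.hn1b'; linarith
  -- u / s small
  have hth : u / S n i ≤ ε / 32 := by rw [div_le_iff₀ hs]; nlinarith
  have hlh : 1 - ε / 32 ≤ lam u n i * hh u n i := by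
    have : (1 + 1) * (u / (2 * S n i)) = u / S n i := by field_simp; ring
    linarith
  -- slope
  set b' := bb u n (i + 1) with hb'
  have hb'0 : 0 < b' := q.hb0
  have hb'1 : 0 < 1 - b' := by linarith [q.hb1]
  set a := ((i:ℝ) - (n - 1) * b') / (b' * (1 - b')) with ha
  have hnum : (1 - 3 * (ε / 32)) * (u * S n i) ≤ (i:ℝ) - (n - 1) * b' := by
    have h5 := q.hDl
    unfold DD at h5
    push_cast at h5
    have h6 : (1 - ε / 32) * (u * S n i) ≤ u * S n (i + 1) := by
      have := mul_le_mul_of_nonneg_left hw.2.2.1 (show 0 ≤ u by linarith)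
      linarith
    have h7 : (1 - ε / 32) * ((1 - ε / 32) * (u * S n i)) ≤ (1 - ε / 32) * (u * S n (i+1)) := by
      apply mul_le_mul_of_nonneg_left h6; linarith
    nlinarith
  have hden : n * (b' * (1 - b')) ≤ (1 + 3 * (ε / 32)) * S n i ^ 2 := by
    have h5 := q.hsib'
    have h6 := q.hnb'
    calc n * (b' * (1 - b')) = (n * b') * (1 - b') := by ring
      _ ≤ ((i + 1 : ℕ):ℝ) * (1 - b') := by gcongr
      _ ≤ (1 + ε / 32) * S n (i+1) ^ 2 := h5
      _ ≤ (1 + ε / 32) * ((1 + ε / 32) * S n i ^ 2) := by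
        apply mul_le_mul_of_nonneg_left hw.2.1; linarith
      _ ≤ _ := by rw [← mul_assoc]; gcongr; nlinarith
  have ha1 : (1 - 6 * (ε / 32)) * (u / S n i) * n ≤ a := by
    rw [ha, le_div_iff₀ (by positivity)]
    refine le_trans ?_ hnum
    calc (1 - 6 * (ε / 32)) * (u / S n i) * n * (b' * (1 - b')) = (1 - 6 * (ε / 32)) * (u / S n i) * (n * (b' * (1 - b'))) := by ring
      _ ≤ (1 - 6 * (ε / 32)) * (u / S n i) * ((1 + 3 * (ε / 32)) * S n i ^ 2) := by
        apply mul_le_mul_of_nonneg_left hden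
        apply mul_nonneg (by linarith) (by positivity)
      _ = (1 - 6 * (ε / 32)) * (1 + 3 * (ε / 32)) * (u * S n i) := by field_simp
      _ ≤ _ := by gcongr; nlinarith
  set x := (1 - 8 * (ε / 32)) * (u / S n i) with hx
  have hx0 : 0 ≤ x := by apply mul_nonneg (by linarith) (by positivity)
  have hah : x ≤ a * hh u n i := by
    calc x ≤ (1 - 6 * (ε / 32)) * (u / S n i) * (1 - ε / 32) := by
          rw [hx, mul_right_comm]
          gcongr
          nlinarith
      _ ≤ (1 - 6 * (ε / 32)) * (u / S n i) * (n * hh u n i) := by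
          apply mul_le_mul_of_nonneg_left
          · refine hlh.trans ?_; gcongr
          · apply mul_nonneg (by linarith) (by positivity)
      _ = (1 - 6 * (ε / 32)) * (u / S n i) * n * hh u n i := by ring
      _ ≤ _ := by gcongr
  set y := lam u n i * hh u n i with hy
  have hy0 : 0 < y := by positivity
  have h8 : y * (1 + x / 2) ≤ 1 := by
    calc y * (1 + x / 2) ≤ y * (1 + (a * hh u n i) / 2) := by gcongr
      _ = lam u n i * (hh u n i + a * hh u n i ^ 2 / 2) := by rw [hy]; ring
      _ ≤ 1 := h
  -- 1 - y ≥ y x/2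
  have h9 : (1 - ε) * (u / (2 * S n i)) ≤ y * (x / 2) := by
    have e : (1 - ε) * (u / (2 * S n i)) = (1 - ε) * (u / S n i) / 2 := by field_simp
    rw [e]
    calc (1 - ε) * (u / S n i) / 2 ≤ (1 - ε / 32) * ((1 - 8 * (ε / 32)) * (u / S n i) / 2) := by
          have hA : 1 - ε ≤ (1 - ε / 32) * (1 - 8 * (ε / 32)) := by nlinarith
          have hB : 0 ≤ u / S n i := by positivity
          have := mul_le_mul_of_nonneg_right hA hB
          linarith
      _ ≤ _ := by rw [hx]; gcongr
  linarith

/-- scale for the odds -/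
def T (n i : ℕ) : ℝ := n * S n i / (n - i)

lemma Z_bounds {η u : ℝ} {n i : ℕ} (hη : 0 < η) (hη1 : η ≤ 1/4) (p : Pack η u n i) :
    (1 - 2 * η) * (u * T n i) ≤ n - lam u n i ∧ n - lam u n i ≤ (1 + η) * (u * T n i) ∧
    n - lam u n i = DD u n i / (1 - bb u n i) ∧ 0 < T n i ∧ n * (1 - η) ≤ lam u n i ∧ lam u n i ≤ n := by
  have h1b : 0 < 1 - bb u n i := by linarith [p.hb1]
  have hn := p.hn
  have hni := p.hni
  have hs := p.hs
  have hu := p.hu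
  have e : n - lam u n i = DD u n i / (1 - bb u n i) := by
    unfold lam DD; field_simp; ring
  have hT : 0 < T n i := by unfold T; positivity
  have hD := p.hD0
  have e2 : DD u n i / (1 - bb u n i) = n * DD u n i / (n * (1 - bb u n i)) := by field_simp
  have hl1 : n * (1 - η) ≤ lam u n i := by
    unfold lam; rw [le_div_iff₀ h1b]
    have := p.hn1b
    calc n * (1 - η) * (1 - bb u n i) = (1 - η) * (n * (1 - bb u n i)) := by ring
      _ ≤ (1 - η) * ((1 + η) * (n - i)) := by apply mul_le_mul_of_nonneg_left this; linarith
      _ ≤ _ := by nlinarith [mul_nonneg (sq_nonneg η) hni.le]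
  have hl2 : lam u n i ≤ n := by
    have : 0 ≤ DD u n i / (1 - bb u n i) := by positivity
    linarith
  refine ⟨?_, ?_, e, hT, hl1, hl2⟩
  · rw [e, e2, le_div_iff₀ (by positivity)]
    calc (1 - 2 * η) * (u * T n i) * (n * (1 - bb u n i)) ≤ (1 - 2 * η) * (u * T n i) * ((1 + η) * (n - i)) := by
          apply mul_le_mul_of_nonneg_left p.hn1b
          apply mul_nonneg (by linarith) (by positivity)
      _ = (1 - 2 * η) * (1 + η) * (n * (u * S n i)) := by unfold T; field_simp
      _ ≤ (1 - η) * (n * (u * S n i)) := by gcongr; nlinarith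
      _ = n * ((1 - η) * (u * S n i)) := by ring
      _ ≤ _ := by gcongr; exact p.hDl
  · rw [e, e2, div_le_iff₀ (by positivity)]
    calc n * DD u n i ≤ n * ((1 + η) * (u * S n i)) := by gcongr; exact p.hDu
      _ = (1 + η) * (u * T n i) * (n - i) := by unfold T; field_simp
      _ ≤ _ := by gcongr; exact p.hn1b'

lemma num_aux {η : ℝ} (h0 : 0 < η) (h1 : η ≤ 1 / 100) :
    (1 + η) ≤ (1 + 3 * η) * (1 - η) ∧ 1 ≤ (1 + 2 * η) * (1 - η) ∧ (1 - η) * (1 + η) ≤ 1 ∧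
    (1 + 10 * η) * (1 + 2 * η) ≤ 1 + 20 * η ∧ 1 - 20 * η ≤ (1 - 10 * η) * (1 - η) ∧
    (1 + η) * (1 + 3 * η) ≤ 1 + 5 * η ∧ 1 - 4 * η ≤ (1 - 2 * η) * (1 - η) := by
  refine ⟨?_, ?_, ?_, ?_, ?_, ?_, ?_⟩ <;> nlinarith

set_option maxHeartbeats 2000000 in
lemma W {ε : ℝ} (hε : 0 < ε) (hε1 : ε ≤ 1) : ∀ᶠ u : ℝ in atTop, ∀ n i j : ℕ, Good u n i → Good u n (j+1) →
    i ≤ j → (j:ℝ) ≤ i + ε / 100 * (S n i) ^ 2 →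
    (1 - ε) * (u / (2 * S n i)) ≤ 1 - lam u n i * hh u n j ∧
    1 - lam u n i * hh u n j ≤ (1 + ε) * (u / (2 * S n i)) := by
  filter_upwards [pack (show 0 < ε / 100 by linarith), E3_upper (show 0 < ε/10 by linarith) (by linarith),
    E3_lower (show 0 < ε/10 by linarith) (by linarith)] with u hpk h3u h3l n i j hgi hgj' hij hjw
  have hgj := good_between hgi hgj' hij (by omega)
  have p := hpk n i hgi
  have q := hpk n j hgj
  have q' := hpk n (j+1) hgj'
  have hu3 := h3u n j hgj hgj'
  have hl3 := h3l n j hgj hgj'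
  obtain ⟨w1, w2, w3, w4, w5⟩ := S_window p q (κ := ε / 100) (by linarith) (by linarith) hij hjw
  obtain ⟨zi1, zi2, _, hTi, _, _⟩ := Z_bounds (by linarith) (by linarith) p
  obtain ⟨zj1, zj2, _, hTj, lj1, lj2⟩ := Z_bounds (by linarith) (by linarith) q
  obtain ⟨hh0, _, _⟩ := hh_facts q q'
  set η := ε / 100 with hη
  have hu := p.hu
  have hs := p.hs
  have hsj := q.hs
  have hn := p.hn
  have hni := p.hni
  have hnj := q.hni
  have hη1 : η ≤ 1 / 100 := by linarith
  have hη0 : 0 < η := by linarith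
  obtain ⟨m1, m2, m3, m4, m5, m6, m7⟩ := num_aux hη0 hη1
  have hij' : (i:ℝ) ≤ j := by exact_mod_cast hij
  -- T comparison
  have t1 : T n j ≤ (1 + 3 * η) * T n i := by
    unfold T
    calc n * S n j / (n - j) ≤ n * ((1 + η) * S n i) / ((1 - η) * (n - i)) := by
          have : 0 < (1 - η) * ((n:ℝ) - i) := mul_pos (by linarith) hni
          gcongr
      _ = (1 + η) / (1 - η) * (n * S n i / (n - i)) := by
          have : 1 - η ≠ 0 := by linarith
          field_simp
      _ ≤ _ := by
          gcongr
          rw [div_le_iff₀ (by linarith)]; exact m1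
  have t2 : (1 - η) * T n i ≤ T n j := by
    unfold T
    calc (1 - η) * (n * S n i / (n - i)) = n * ((1 - η) * S n i) / (n - i) := by ring
      _ ≤ n * S n j / (n - j) := by gcongr
  have huT : 0 < u * T n i := by positivity
  have t1' : u * T n j ≤ (1 + 3 * η) * (u * T n i) := by
    have := mul_le_mul_of_nonneg_left t1 (show 0 ≤ u by linarith); linarith
  have t2' : (1 - η) * (u * T n i) ≤ u * T n j := by
    have := mul_le_mul_of_nonneg_left t2 (show 0 ≤ u by linarith); linarith
  have d1 : lam u n i - lam u n j ≤ 7 * η * (u * T n i) := by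
    have := mul_le_mul_of_nonneg_left t1' (show 0 ≤ 1 + η by linarith)
    have h7 := mul_le_mul_of_nonneg_right m6 huT.le
    linarith
  have d2 : -(7 * η * (u * T n i)) ≤ lam u n i - lam u n j := by
    have := mul_le_mul_of_nonneg_left t2' (show 0 ≤ 1 - 2 * η by linarith)
    have h7 := mul_le_mul_of_nonneg_right m7 huT.le
    have h8 : 0 ≤ η * (u * T n i) := by positivity
    linarith
  set x := u / (2 * S n i) with hx
  have hx0 : 0 < x := by positivity
  have hlj : 0 < lam u n j := by
    have : 0 < n * (1 - η) := mul_pos hn (by linarith)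
    linarith
  have d3 : 7 * η * (u * T n i) ≤ 28 * η * x * lam u n j := by
    have : u * T n i ≤ 2 * x * n := by
      unfold T; rw [hx]
      rw [mul_div_assoc', div_le_iff₀ hni]
      have e : 2 * (u / (2 * S n i)) * n * (n - i) = u * n * ((n - i) / S n i) := by field_simp
      rw [e]
      have : S n i ≤ (n - i) / S n i := by
        rw [le_div_iff₀ hs]; have := p.hsni; nlinarith
      calc u * (n * S n i) = u * n * S n i := by ring
        _ ≤ _ := by gcongr
    have h2 : (n:ℝ) ≤ 2 * lam u n j := by
      have := mul_le_mul_of_nonneg_left hη1 hn.le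
      linarith
    calc 7 * η * (u * T n i) ≤ 7 * η * (2 * x * n) := by gcongr
      _ ≤ 7 * η * (2 * x * (2 * lam u n j)) := by gcongr
      _ = _ := by ring
  set y := lam u n j * hh u n j with hy
  set ρ := (lam u n i - lam u n j) / lam u n j with hρ
  have hρ1 : ρ ≤ 28 * η * x := by
    rw [hρ, div_le_iff₀ hlj]; linarith
  have hρ2 : -(28 * η * x) ≤ ρ := by
    rw [hρ, le_div_iff₀ hlj]; linarith
  have e : 1 - lam u n i * hh u n j = (1 - y) - ρ * y := by
    rw [hy, hρ]; field_simp; ring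
  have hy0 : 0 < y := by positivity
  have xs1 : u / (2 * S n j) ≤ (1 + 2 * η) * x := by
    rw [hx, div_le_iff₀ (by positivity)]
    calc u ≤ (1 + 2 * η) * (1 - η) * u := by
          exact le_mul_of_one_le_left (by linarith) m2
      _ = (1 + 2 * η) * (u / (2 * S n i)) * (2 * ((1 - η) * S n i)) := by field_simp
      _ ≤ _ := by gcongr
  have xs2 : (1 - η) * x ≤ u / (2 * S n j) := by
    rw [hx, le_div_iff₀ (by positivity)]
    calc (1 - η) * (u / (2 * S n i)) * (2 * S n j) ≤ (1 - η) * (u / (2 * S n i)) * (2 * ((1 + η) * S n i)) := by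
          apply mul_le_mul_of_nonneg_left _ (mul_nonneg (by linarith) (by positivity))
          linarith
      _ = (1 - η) * (1 + η) * u := by field_simp
      _ ≤ u := mul_le_of_le_one_left (by linarith) m3
  have hy1 : y ≤ 1 := by
    have : 0 ≤ (1 - ε / 10) * (u / (2 * S n j)) := mul_nonneg (by linarith) (by positivity)
    linarith
  have r1 : ρ * y ≤ 28 * η * x := by
    have : 0 ≤ 28 * η * x := by positivity
    calc ρ * y ≤ 28 * η * x * y := by gcongr
      _ ≤ _ := mul_le_of_le_one_right this hy1
  have r2 : -(28 * η * x) ≤ ρ * y := by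
    have : 0 ≤ 28 * η * x := by positivity
    have h7 := mul_le_of_le_one_right this hy1
    have h8 := mul_le_mul_of_nonneg_right hρ2 hy0.le
    linarith
  have he10 : ε / 10 = 10 * η := by rw [hη]; ring
  have he5 : ε / 5 = 20 * η := by rw [hη]; ring
  have hηx : ε * x = 100 * (η * x) := by rw [hη]; ring
  have hηx0 : 0 < η * x := by positivity
  rw [e]
  have f1 : 1 - y ≤ (1 + ε / 5) * x := by
    calc 1 - y ≤ (1 + ε / 10) * (u / (2 * S n j)) := hu3
      _ ≤ (1 + ε / 10) * ((1 + 2 * η) * x) := by gcongr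
      _ ≤ _ := by rw [← mul_assoc, he10, he5]; exact mul_le_mul_of_nonneg_right m4 hx0.le
  have f2 : (1 - ε / 5) * x ≤ 1 - y := by
    refine le_trans ?_ hl3
    calc _ ≤ (1 - ε / 10) * ((1 - η) * x) := by rw [← mul_assoc, he10, he5]; exact mul_le_mul_of_nonneg_right m5 hx0.le
      _ ≤ _ := by apply mul_le_mul_of_nonneg_left xs2; linarith
  constructor <;> linarith

end

end BJ

open MeasureTheory Filter Set

namespace BJ

noncomputable section

lemma line_ott {N i W : ℕ} {a d h δ : ℝ} (had : a < d) (hh : 0 < h) (hδ0 : 0 < δ)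
    (hNh : N * h = (1 - δ) * (d - a)) (hW0 : 0 < W) (hWN : W ≤ N) (h8 : 8 ≤ W * δ ^ 2) :
    1 - 8 / (W * δ ^ 2) ≤ pr N a d (NC (Finset.Ioc (i + W) (N + i)) (fun j => a + ((j : ℝ) - i) * h) i) := by
  have hW : (0:ℝ) < W := by exact_mod_cast hW0
  have hWN' : (W:ℝ) ≤ N := by exact_mod_cast hWN
  have hda : 0 < d - a := by linarith
  have hδ1 : δ ≤ 1 := by
    have : 0 ≤ N * h := by positivity
    by_contra hc
    push Not at hc
    nlinarith
  have hNd : N * h < d - a := by rw [hNh]; nlinarith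
  have hWh : W * h ≤ N * h := by gcongr
  have hWh0 : 0 < W * h := by positivity
  have hp0 : N * ((a + W * h - a) / (d - a)) = W * (1 - δ) := by
    have : N * ((a + W * h - a) / (d - a)) = W * (N * h) / (d - a) := by ring
    rw [this, hNh]; field_simp
  have hmuj : ∀ j : ℕ, i + W < j → ((j : ℝ) - i) * ((a + W * h - a) / (a + ((j:ℝ) - i) * h - a)) = W := by
    intro j hj
    have : (i:ℝ) + W < j := by exact_mod_cast hj
    have : (0:ℝ) < (j:ℝ) - i := by linarith
    rw [add_sub_cancel_left, add_sub_cancel_left]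
    field_simp
  have key := ottaviani_cheb (N := N) (i := i) (s := i + W) (e := N + i) (a := a) (d := d) (t0 := a + W * h)
    (m0 := W * (1 - δ / 2)) (by omega) le_rfl (fun j => a + ((j : ℝ) - i) * h) (by linarith) (by linarith)
    (by
      intro j j' _ hjj _
      have : (j:ℝ) ≤ j' := by exact_mod_cast hjj
      gcongr)
    (by
      intro j hj _
      have : (i:ℝ) + W < j := by exact_mod_cast hj
      have : (W:ℝ) < (j:ℝ) - i := by linarith
      gcongr)
    (by
      intro j _ hj
      have : (j:ℝ) ≤ N + i := by exact_mod_cast hj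
      have : ((j:ℝ) - i) * h ≤ N * h := by gcongr; linarith
      linarith)
    (mul_nonneg hW.le (by linarith))
    (by rw [hp0]; nlinarith)
    (by
      intro j hj _
      rw [hmuj j hj]; nlinarith)
    (by
      intro j hj _
      rw [hmuj j hj]
      have hji : (i:ℝ) + W < j := by exact_mod_cast hj
      have hq : 0 ≤ (a + W * h - a) / (a + ((j:ℝ) - i) * h - a) := by
        apply div_nonneg
        · linarith
        · have : 0 ≤ ((j:ℝ) - i) * h := mul_nonneg (by linarith) hh.le
          linarith
      have e : (W - W * (1 - δ / 2)) ^ 2 / 2 = W * (W * δ ^ 2) / 8 := by ring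
      rw [e]
      nlinarith [mul_nonneg hW.le hq])
  refine le_trans ?_ key
  rw [hp0]
  have hfr : 0 ≤ (a + W * h - a) / (d - a) := by
    apply div_nonneg _ hda.le; linarith
  have hfr1 : (a + W * h - a) / (d - a) ≤ 1 := by
    rw [div_le_one hda]; linarith
  have e1 : 2 * (W * (1 - δ) * (1 - (a + W * h - a) / (d - a)) / (W * (1 - δ / 2) - W * (1 - δ)) ^ 2) ≤ 8 / (W * δ ^ 2) := by
    have e2 : (W * (1 - δ / 2) - W * (1 - δ)) ^ 2 = W * (W * δ ^ 2) / 4 := by ring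
    rw [e2]
    have : W * (1 - δ) * (1 - (a + W * h - a) / (d - a)) ≤ W := by
      have h1 : (1 - δ) * (1 - (a + W * h - a) / (d - a)) ≤ 1 := by
        have : 0 ≤ 1 - δ := by linarith
        nlinarith
      nlinarith
    calc _ ≤ 2 * (W / (W * (W * δ ^ 2) / 4)) := by gcongr
      _ = _ := by field_simp; norm_num
  linarith

lemma window_upper {N i W : ℕ} {a d h δ : ℝ} (y : ℕ → ℝ) (had : a < d) (hh : 0 < h) (hδ0 : 0 < δ)
    (hNh : N * h = (1 - δ) * (d - a)) (hW0 : 0 < W) (hWN : W ≤ N) (h8 : 8 ≤ W * δ ^ 2)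
    (hy : ∀ j ∈ Finset.Ioc i (i + W), a + ((j : ℝ) - i) * h ≤ y j) :
    pr N a d (NC (Finset.Ioc i (i + W)) y i) * (1 - 8 / (W * δ ^ 2)) ≤ δ := by
  have hda : 0 < d - a := by linarith
  have h1 := line_ott (i := i) had hh hδ0 hNh hW0 hWN h8
  have h2 : pr N a d (NC (Finset.Ioc i (i + W)) y i) ≤
      pr N a d (NC (Finset.Ioc i (i + W)) (fun j => a + ((j : ℝ) - i) * h) i) :=
    pr_mono (NC_mono subset_rfl hy le_rfl)
  have h3 := harris_NC (m := N) had (Finset.Ioc i (i + W)) (Finset.Ioc (i + W) (N + i))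
    (fun j => a + ((j : ℝ) - i) * h) (fun j => a + ((j : ℝ) - i) * h) i i
  rw [← NC_union, Finset.Ioc_union_Ioc_eq_Ioc (by omega) (by omega), daniels hh N i a d (by nlinarith)] at h3
  have e : 1 - N * h / (d - a) = δ := by rw [hNh]; field_simp; ring
  rw [e] at h3
  refine le_trans ?_ h3
  have := pr_nonneg N a d (NC (Finset.Ioc i (i + W)) y i)
  refine mul_le_mul h2 h1 ?_ (pr_nonneg _ _ _ _)
  have : 8 / (W * δ ^ 2) ≤ 1 := by rw [div_le_one (by linarith)]; exact h8
  linarith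

lemma window_lower {N i W : ℕ} {a d h : ℝ} (y : ℕ → ℝ) (hh : 0 < h)
    (hNh : a + N * h < d) (hWN : W ≤ N)
    (hy : ∀ j ∈ Finset.Ioc i (i + W), y j ≤ a + ((j : ℝ) - i) * h) :
    1 - N * h / (d - a) ≤ pr N a d (NC (Finset.Ioc i (i + W)) y i) := by
  rw [← daniels hh N i a d hNh]
  exact pr_mono (NC_mono (Finset.Ioc_subset_Ioc_right (by omega)) hy le_rfl)

/-- window length -/
def win (ε : ℝ) (n i : ℕ) : ℕ := ⌊ε / 100 * (S n i) ^ 2⌋₊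

lemma bb_sum (u : ℝ) (n i k : ℕ) : bb u n (i + k) - bb u n i = ∑ l ∈ Finset.range k, hh u n (i + l) := by
  induction k with
  | zero => simp
  | succ k ih => rw [Finset.sum_range_succ, ← ih]; unfold hh; rw [← add_assoc]; ring

lemma bb_window {ε : ℝ} (hε : 0 < ε) (hε1 : ε ≤ 1) : ∀ᶠ u : ℝ in atTop, ∀ n i : ℕ, Good u n i →
    Good u n (i + win ε n i) → ∀ j ∈ Finset.Ioc i (i + win ε n i),
    lam u n i * (bb u n j - bb u n i) ≤ ((j:ℝ) - i) * (1 - (1 - ε) * (u / (2 * S n i))) ∧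
    ((j:ℝ) - i) * (1 - (1 + ε) * (u / (2 * S n i))) ≤ lam u n i * (bb u n j - bb u n i) := by
  filter_upwards [W hε hε1] with u hW n i hg hg' j hj
  simp only [Finset.mem_Ioc] at hj
  obtain ⟨k, rfl⟩ : ∃ k, j = i + k := ⟨j - i, by omega⟩
  have hk : ∀ l ∈ Finset.range k, (1 - ε) * (u / (2 * S n i)) ≤ 1 - lam u n i * hh u n (i + l) ∧
    1 - lam u n i * hh u n (i + l) ≤ (1 + ε) * (u / (2 * S n i)) := by
    intro l hl
    simp only [Finset.mem_range] at hl
    refine hW n i (i + l) hg (good_between hg hg' (by omega) (by omega)) (by omega) ?_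
    have : (l:ℝ) ≤ win ε n i := by exact_mod_cast (by omega : l ≤ win ε n i)
    have h2 : (win ε n i : ℝ) ≤ ε / 100 * (S n i) ^ 2 := Nat.floor_le (by positivity)
    push_cast; linarith
  rw [bb_sum, Finset.mul_sum]
  have e : (((i + k : ℕ) : ℝ) - i) = k := by push_cast; ring
  rw [e]
  constructor
  · have := Finset.sum_le_card_nsmul (Finset.range k) (fun l => lam u n i * hh u n (i + l))
      (1 - (1 - ε) * (u / (2 * S n i))) (fun l hl => by linarith [(hk l hl).1])
    simpa using this
  · have := Finset.card_nsmul_le_sum (Finset.range k) (fun l => lam u n i * hh u n (i + l))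
      (1 - (1 + ε) * (u / (2 * S n i))) (fun l hl => by linarith [(hk l hl).2])
    simpa using this

lemma win_facts {ε : ℝ} (hε : 0 < ε) (hε1 : ε ≤ 1) : ∀ᶠ u : ℝ in atTop, ∀ n i : ℕ, Good u n i →
    0 < win ε n i ∧ (win ε n i : ℝ) ≤ ε / 100 * (S n i) ^ 2 ∧ ε / 200 * (S n i) ^ 2 ≤ win ε n i ∧
    i + win ε n i ≤ n := by
  filter_upwards [pack (show 0 < ε / 200 by linarith)] with u hpk n i hg
  have p := hpk n i hg
  have h1 : (win ε n i : ℝ) ≤ ε / 100 * (S n i) ^ 2 := Nat.floor_le (by positivity)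
  have h2 : ε / 100 * (S n i) ^ 2 < win ε n i + 1 := Nat.lt_floor_add_one _
  have h3 := p.hus
  have h4 := p.h1us
  have hS2 : 0 < (S n i) ^ 2 := by have := p.hs; positivity
  have h5 : 1 ≤ ε / 200 * (S n i) ^ 2 := by nlinarith
  have h6 : ε / 200 * (S n i) ^ 2 ≤ win ε n i := by linarith
  refine ⟨?_, h1, h6, ?_⟩
  · have : (0:ℝ) < win ε n i := by linarith
    exact_mod_cast this
  · have := p.hsni
    have : (i:ℝ) + win ε n i ≤ n := by nlinarith
    exact_mod_cast this

lemma WL {ε : ℝ} (hε : 0 < ε) (hε1 : ε < 1) : ∀ᶠ u : ℝ in atTop, ∀ n i : ℕ, Good u n i →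
    Good u n (i + win ε n i) →
    (1 - ε) * (u / (2 * S n i)) ≤ pr (n - i) (bb u n i) 1 (NC (Finset.Ioc i (i + win ε n i)) (bb u n) i) := by
  filter_upwards [pack hε, bb_window hε hε1.le, win_facts hε hε1.le] with u hpk hbw hwf n i hg hg'
  have p := hpk n i hg
  obtain ⟨f1, f2, f3, f4⟩ := hwf n i hg
  have h1b : 0 < 1 - bb u n i := by linarith [p.hb1]
  have hl : 0 < lam u n i := div_pos p.hni h1b
  have hs := p.hs
  have hu := p.hu
  set x := u / (2 * S n i) with hx
  have hx0 : 0 < x := by positivity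
  have hx1 : x ≤ ε := by
    rw [hx, div_le_iff₀ (by positivity)]
    have := p.hus
    nlinarith
  have hcast : ((n - i : ℕ) : ℝ) = n - i := by rw [Nat.cast_sub p.hin.le]
  set h := (1 - (1 - ε) * x) / lam u n i with hh'
  have hnum : 0 < 1 - (1 - ε) * x := by nlinarith
  have hNh : ((n - i : ℕ) : ℝ) * h = (1 - (1 - ε) * x) * (1 - bb u n i) := by
    rw [hcast, hh', lam]
    have := p.hni
    field_simp
  have key := window_lower (N := n - i) (i := i) (W := win ε n i) (a := bb u n i) (d := 1) (h := h) (bb u n)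
    (by positivity)
    (by rw [hNh]
        have : 0 < (1 - ε) * x := by apply mul_pos _ hx0; linarith
        nlinarith)
    (by omega)
    (by
      intro j hj
      have h1 := (hbw n i hg hg' j hj).1
      have : bb u n j - bb u n i ≤ ((j:ℝ) - i) * h := by
        rw [hh', ← mul_div_assoc, le_div_iff₀ hl]; linarith
      linarith)
  refine le_trans (le_of_eq ?_) key
  rw [hNh]; field_simp; ring

lemma WU {ε : ℝ} (hε : 0 < ε) (hε1 : ε < 1) : ∀ᶠ u : ℝ in atTop, ∀ n i : ℕ, Good u n i →
    Good u n (i + win ε n i) →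
    (1 - ε) * pr (n - i) (bb u n i) 1 (NC (Finset.Ioc i (i + win ε n i)) (bb u n) i) ≤ (1 + ε) * (u / (2 * S n i)) := by
  filter_upwards [pack (show 0 < ε / 4 by linarith), bb_window hε hε1.le, win_facts hε hε1.le,
    ev_inv (show 0 < ε ^ 2 / 10000 by positivity)] with u hpk hbw hwf hbig n i hg hg'
  have p := hpk n i hg
  obtain ⟨f1, f2, f3, f4⟩ := hwf n i hg
  have h1b : 0 < 1 - bb u n i := by linarith [p.hb1]
  have hl : 0 < lam u n i := div_pos p.hni h1b
  have hs := p.hs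
  have hu := p.hu
  set x := u / (2 * S n i) with hx
  have hx0 : 0 < x := by positivity
  have hx1 : x ≤ ε / 4 := by
    rw [hx, div_le_iff₀ (by positivity)]
    have := p.hus
    nlinarith
  have hcast : ((n - i : ℕ) : ℝ) = n - i := by rw [Nat.cast_sub p.hin.le]
  set h := (1 - (1 + ε) * x) / lam u n i with hh'
  have hnum : 0 < 1 - (1 + ε) * x := by nlinarith
  have hNh : ((n - i : ℕ) : ℝ) * h = (1 - (1 + ε) * x) * (1 - bb u n i) := by
    rw [hcast, hh', lam]
    have := p.hni
    field_simp
  have hWd : 8 / ε ≤ win ε n i * ((1 + ε) * x) ^ 2 := by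
    have h1 : 8 / ε ≤ ε * u ^ 2 / 800 := by
      rw [div_le_iff₀ hε]
      have h2 := hbig.2
      have h3 : u ≤ u ^ 2 := by nlinarith
      have h4 : ε ^ 2 / 10000 * u ≤ ε ^ 2 / 10000 * u ^ 2 := by gcongr
      nlinarith
    calc 8 / ε ≤ ε * u ^ 2 / 800 := h1
      _ = (ε / 200 * S n i ^ 2) * x ^ 2 := by rw [hx]; field_simp; norm_num
      _ ≤ win ε n i * ((1 + ε) * x) ^ 2 := by
        gcongr
        nlinarith
  have h8e : 8 ≤ 8 / ε := by rw [le_div_iff₀ hε]; linarith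
  have key := window_upper (N := n - i) (i := i) (W := win ε n i) (a := bb u n i) (d := 1) (h := h)
    (δ := (1 + ε) * x) (bb u n) p.hb1 (by positivity) (by positivity) hNh f1 (by omega) (by linarith)
    (by
      intro j hj
      have h1 := (hbw n i hg hg' j hj).2
      have : ((j:ℝ) - i) * h ≤ bb u n j - bb u n i := by
        rw [hh', ← mul_div_assoc, div_le_iff₀ hl]; linarith
      linarith)
  refine le_trans ?_ key
  rw [mul_comm]
  apply mul_le_mul_of_nonneg_left _ (pr_nonneg _ _ _ _)
  have : 8 / (win ε n i * ((1 + ε) * x) ^ 2) ≤ ε := by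
    rw [div_le_iff₀ (by linarith)]
    rw [div_le_iff₀ hε] at hWd; linarith
  linarith

end

end BJ


open MeasureTheory Filter Set

namespace BJ

noncomputable section

lemma ot_A {a t b X γ u n T : ℝ} (ha : 0 ≤ a) (hat : a < t) (htb : t < b) (hb : b < 1) (hT : 0 < T)
    (hγ : 0 < γ) (hu : 0 < u) (hn : 0 < n) (hX : γ * (u * T) ≤ X) (ho : b * n ≤ (1 - b) * T ^ 2) :
    (t - a) / (1 - a) * (γ * u * n / T) ≤ (t - a) / (b - a) * ((1 - b) * X) := by
  have h1 : 0 < b - a := by linarith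
  have h2 : 0 < 1 - a := by linarith
  have h3 : 0 < t - a := by linarith
  have h4 : 0 < 1 - b := by linarith
  have h5 : b - a ≤ b * (1 - a) := by nlinarith
  have h6 : (b - a) * n ≤ (1 - b) * T ^ 2 * (1 - a) := by
    calc (b - a) * n ≤ b * (1 - a) * n := by gcongr
      _ = b * n * (1 - a) := by ring
      _ ≤ _ := by gcongr
  have h7 : (t - a) / (b - a) * ((1 - b) * (γ * (u * T))) ≤ (t - a) / (b - a) * ((1 - b) * X) := by
    gcongr
  refine le_trans ?_ h7
  rw [div_mul_eq_mul_div, div_mul_eq_mul_div, div_le_div_iff₀ h2 h1, mul_div_assoc', div_mul_eq_mul_div,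
    div_le_iff₀ hT]
  have := mul_le_mul_of_nonneg_left h6 (show 0 ≤ (t - a) * γ * u by positivity)
  calc _ = (t - a) * γ * u * ((b - a) * n) := by ring
    _ ≤ _ := this
    _ = _ := by ring

lemma ot_B {a t b X γ u n T J κ q τ M : ℝ} (ha : 0 ≤ a) (hat : a < t) (htb : t < b) (hb : b < 1)
    (hT : 0 < T) (hγ : 0 < γ) (hu : 0 < u) (hn : 0 < n) (hX : γ * (u * T) ≤ X)
    (ho : b * n ≤ (1 - b) * T ^ 2) (hJ : J ≤ 2 * n * (b - a)) (hq : 0 < q) (hκ : 0 < κ)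
    (hκq : κ * q * ((1 - t) * (1 - a)) ≤ t - a) (hτ : T ^ 2 ≤ τ * q * n)
    (hτu : 16 * τ ≤ κ * γ ^ 2 * u ^ 2) (hM : (t - a) / (b - a) * ((1 - b) * X) / 2 ≤ M) :
    J * ((t - a) / (b - a)) * (1 - (t - a) / (b - a)) ≤ M ^ 2 / 2 := by
  have h1 : 0 < b - a := by linarith
  have h2 : 0 < 1 - a := by linarith
  have h3 : 0 < t - a := by linarith
  have h4 : 0 < 1 - b := by linarith
  have h4t : 0 < 1 - t := by linarith
  have h5 : b - a ≤ b * (1 - a) := by nlinarith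
  have hX0 : 0 < X := lt_of_lt_of_le (by positivity) hX
  have h6 : (b - a) * n ≤ (1 - b) * T ^ 2 * (1 - a) := by
    calc (b - a) * n ≤ b * (1 - a) * n := by gcongr
      _ = b * n * (1 - a) := by ring
      _ ≤ _ := by gcongr
  have hM2 : ((t - a) / (b - a) * ((1 - b) * X) / 2) ^ 2 ≤ M ^ 2 := by
    apply pow_le_pow_left₀ _ hM; positivity
  have h7 : (b - t) * (1 - a) ≤ (b - a) * (1 - t) := by nlinarith
  have hp : 1 - (t - a) / (b - a) = (b - t) / (b - a) := by field_simp; ring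
  have hbt : 0 < b - t := by linarith
  have hX2 : γ ^ 2 * u ^ 2 * T ^ 2 ≤ X ^ 2 := by
    calc _ = (γ * (u * T)) ^ 2 := by ring
      _ ≤ _ := pow_le_pow_left₀ (by positivity) hX 2
  -- main inequality
  have main : 16 * n * (b - t) * (b - a) ≤ (t - a) * ((1 - b) ^ 2 * X ^ 2) := by
    have e1 : 16 * n * (b - t) * (b - a) * (n * (1 - a)) ≤ 16 * ((1 - b) * T ^ 2 * (1 - a)) ^ 2 * (1 - t) := by
      calc 16 * n * (b - t) * (b - a) * (n * (1 - a)) = 16 * n ^ 2 * (b - a) * ((b - t) * (1 - a)) := by ring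
        _ ≤ 16 * n ^ 2 * (b - a) * ((b - a) * (1 - t)) := by gcongr
        _ = 16 * ((b - a) * n) ^ 2 * (1 - t) := by ring
        _ ≤ _ := by gcongr
    have e2 : 16 * ((1 - b) * T ^ 2 * (1 - a)) ^ 2 * (1 - t) ≤
        (t - a) * ((1 - b) ^ 2 * X ^ 2) * (n * (1 - a)) := by
      calc 16 * ((1 - b) * T ^ 2 * (1 - a)) ^ 2 * (1 - t)
          = 16 * T ^ 2 * ((1 - b) ^ 2 * T ^ 2 * (1 - a) ^ 2 * (1 - t)) := by ring
        _ ≤ 16 * (τ * q * n) * ((1 - b) ^ 2 * T ^ 2 * (1 - a) ^ 2 * (1 - t)) := by gcongr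
        _ = 16 * τ * (q * n * ((1 - b) ^ 2 * T ^ 2 * (1 - a) ^ 2 * (1 - t))) := by ring
        _ ≤ κ * γ ^ 2 * u ^ 2 * (q * n * ((1 - b) ^ 2 * T ^ 2 * (1 - a) ^ 2 * (1 - t))) := by gcongr
        _ = κ * q * ((1 - t) * (1 - a)) * (γ ^ 2 * u ^ 2 * T ^ 2 * ((1 - b) ^ 2 * n * (1 - a))) := by ring
        _ ≤ (t - a) * (X ^ 2 * ((1 - b) ^ 2 * n * (1 - a))) := by gcongr
        _ = _ := by ring
    exact le_of_mul_le_mul_right (e1.trans e2) (by positivity)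
  rw [hp]
  calc J * ((t - a) / (b - a)) * ((b - t) / (b - a))
      ≤ 2 * n * (b - a) * ((t - a) / (b - a)) * ((b - t) / (b - a)) := by gcongr
    _ = (16 * n * (b - t) * (b - a)) * ((t - a) / (8 * (b - a) ^ 2)) := by field_simp; ring
    _ ≤ ((t - a) * ((1 - b) ^ 2 * X ^ 2)) * ((t - a) / (8 * (b - a) ^ 2)) := by gcongr
    _ = ((t - a) / (b - a) * ((1 - b) * X) / 2) ^ 2 / 2 := by field_simp; ring
    _ ≤ M ^ 2 / 2 := by linarith

lemma ot_C {a t γ u n T N κ q τ : ℝ} (hat : a < t) (ht : t < 1)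
    (hT : 0 < T) (hγ : 0 < γ) (hu : 0 < u) (hn : 0 < n) (hq : 0 < q) (hκ : 0 < κ)
    (hκq : κ * q * ((1 - t) * (1 - a)) ≤ t - a) (hτ : T ^ 2 ≤ τ * q * n) (hN : N ≤ n * (1 - a)) :
    N * ((t - a) / (1 - a)) * (1 - (t - a) / (1 - a)) / ((t - a) / (1 - a) * (γ * u * n / T) / 2) ^ 2 ≤
      4 * τ / (κ * γ ^ 2 * u ^ 2) := by
  have h2 : 0 < 1 - a := by linarith
  have h3 : 0 < t - a := by linarith
  have h4t : 0 < 1 - t := by linarith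
  have hp : 1 - (t - a) / (1 - a) = (1 - t) / (1 - a) := by field_simp; ring
  rw [hp]
  calc _ ≤ n * (1 - a) * ((t - a) / (1 - a)) * ((1 - t) / (1 - a)) /
        ((t - a) / (1 - a) * (γ * u * n / T) / 2) ^ 2 := by gcongr
    _ = 4 * T ^ 2 * ((1 - t) * (1 - a)) / (γ ^ 2 * u ^ 2 * n * (t - a)) := by field_simp; ring
    _ ≤ 4 * (τ * q * n) * ((1 - t) * (1 - a)) / (γ ^ 2 * u ^ 2 * n * (κ * q * ((1 - t) * (1 - a)))) := by
        have : 0 ≤ τ * q * n := le_trans (by positivity) hτ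
        gcongr
    _ = _ := by field_simp

/-- Ottaviani on a piece. -/
lemma OT {u γ κ τ : ℝ} {n i0 j1 e : ℕ} (hu : 0 < u) (hγ : 0 < γ) (hκ : 0 < κ)
    (h01 : i0 < j1) (h1e : j1 < e) (hen : e < n)
    (ha : 0 ≤ bb u n i0) (hat : bb u n i0 < bb u n j1)
    (hmono : ∀ j j', j1 ≤ j → j < j' → j' ≤ e → bb u n j < bb u n j') (hb1 : bb u n e < 1)
    (hT : ∀ j, j1 < j → j ≤ e → 0 < T n j ∧ T n j ≤ T n e)
    (hZ : ∀ j, j1 < j → j ≤ e → γ * (u * T n j) ≤ lam u n i0 - lam u n j)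
    (ho : ∀ j, j1 < j → j ≤ e → bb u n j * n ≤ (1 - bb u n j) * T n j ^ 2)
    (hJ : ∀ j, j1 < j → j ≤ e → (j:ℝ) - i0 ≤ 2 * n * (bb u n j - bb u n i0))
    {q : ℝ} (hq : 0 < q) (hκq : κ * q * ((1 - bb u n j1) * (1 - bb u n i0)) ≤ bb u n j1 - bb u n i0)
    (hτ : T n e ^ 2 ≤ τ * q * n) (hτu : 16 * τ ≤ κ * γ ^ 2 * u ^ 2)
    (hN : (n:ℝ) - i0 ≤ n * (1 - bb u n i0)) :
    1 - 8 * τ / (κ * γ ^ 2 * u ^ 2) ≤ pr (n - i0) (bb u n i0) 1 (NC (Finset.Ioc j1 e) (bb u n) i0) := by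
  have hcast : ((n - i0 : ℕ) : ℝ) = n - i0 := by rw [Nat.cast_sub (by omega)]
  have hn : (0:ℝ) < n := by exact_mod_cast (by omega : 0 < n)
  have hTe := (hT e h1e le_rfl).1
  set a := bb u n i0 with hadef
  set t := bb u n j1 with htdef
  have ht1 : t < 1 := (hmono j1 e le_rfl h1e le_rfl).trans hb1
  have hbj : ∀ j, j1 < j → j ≤ e → t < bb u n j ∧ bb u n j < 1 := by
    intro j h1 h2
    refine ⟨hmono j1 j le_rfl h1 h2, ?_⟩
    rcases h2.eq_or_lt with h | h
    · rw [h]; exact hb1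
    · exact (hmono j e h1.le h le_rfl).trans hb1
  set g := (t - a) / (1 - a) * (γ * u * n / T n e) / 2 with hg
  have hp0 : 0 < (t - a) / (1 - a) := div_pos (by linarith) (by linarith)
  have hg0 : 0 < g := by positivity
  set N : ℝ := ((n - i0 : ℕ) : ℝ) with hNdef
  set m0 := N * ((t - a) / (1 - a)) + g with hm0
  have hN0 : 0 ≤ N := Nat.cast_nonneg _
  have key : ∀ j, j1 < j → j ≤ e → ((j:ℝ) - i0) * ((t - a) / (bb u n j - a)) - N * ((t - a) / (1 - a)) =
      (t - a) / (bb u n j - a) * ((1 - bb u n j) * (lam u n i0 - lam u n j)) := by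
    intro j h1 h2
    obtain ⟨q1, q2⟩ := hbj j h1 h2
    have z1 : bb u n j - a ≠ 0 := by linarith
    have z2 : 1 - a ≠ 0 := by linarith
    have z3 : 1 - bb u n j ≠ 0 := by linarith
    rw [hcast]; unfold lam; rw [← hadef]
    field_simp; ring
  have low : ∀ j, j1 < j → j ≤ e → 2 * g ≤ (t - a) / (bb u n j - a) * ((1 - bb u n j) * (lam u n i0 - lam u n j)) := by
    intro j h1 h2
    obtain ⟨q1, q2⟩ := hbj j h1 h2
    refine le_trans ?_ (ot_A ha hat q1 q2 (hT j h1 h2).1 hγ hu hn (hZ j h1 h2) (ho j h1 h2))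
    rw [hg]
    have : γ * u * n / T n e ≤ γ * u * n / T n j := by
      have := hT j h1 h2
      have h3 := this.1; have h4 := this.2
      gcongr
    have := mul_le_mul_of_nonneg_left this hp0.le
    linarith
  have main := ottaviani_cheb (N := n - i0) (i := i0) (s := j1) (e := e) (a := a) (d := 1) (t0 := t) (m0 := m0)
    h01.le (by omega) (bb u n) hat ht1
    (by
      intro j j' h1 h2 h3
      rcases h2.eq_or_lt with h | h
      · rw [h]
      · exact (hmono j j' h1.le h h3).le)
    (fun j h1 h2 => (hbj j h1 h2).1) (fun j h1 h2 => (hbj j h1 h2).2) (by positivity)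
    (by rw [hm0]; linarith)
    (by intro j h1 h2
        have := key j h1 h2
        have := low j h1 h2
        rw [hm0]; linarith)
    (by intro j h1 h2
        obtain ⟨q1, q2⟩ := hbj j h1 h2
        have e1 := key j h1 h2
        have e2 := low j h1 h2
        have hTT := hT j h1 h2
        refine ot_B (n := n) (κ := κ) (q := q) (τ := τ) (γ := γ) (u := u) ha hat q1 q2 (hT j h1 h2).1 hγ hu hn
          (hZ j h1 h2) (ho j h1 h2) (hJ j h1 h2) hq hκ hκq ?_ hτu ?_
        · refine le_trans ?_ hτ
          exact pow_le_pow_left₀ hTT.1.le hTT.2 2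
        · rw [hm0]; linarith)
  refine le_trans ?_ main
  have hC := ot_C (N := N) hat ht1 hTe hγ hu hn hq hκ hκq hτ (by rw [hcast]; exact hN)
  rw [show m0 - N * ((t - a) / (1 - a)) = g by rw [hm0]; ring]
  have : 8 * τ / (κ * γ ^ 2 * u ^ 2) = 2 * (4 * τ / (κ * γ ^ 2 * u ^ 2)) := by ring
  rw [this]
  linarith

end

end BJ


open MeasureTheory Filter Set

namespace BJ

noncomputable section

lemma T_sq {ε u : ℝ} {n i : ℕ} (p : Pack ε u n i) : T n i ^ 2 * (n - i) = n * i ∧ 0 < T n i := by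
  have h1 := p.hni
  have h2 := p.hs
  have h3 := p.hn
  refine ⟨?_, by unfold T; positivity⟩
  unfold T
  have := p.hsn
  field_simp
  linear_combination this

lemma T_le {ε u : ℝ} {n i j : ℕ} (p : Pack ε u n i) (q : Pack ε u n j) (hij : i ≤ j) : T n i ≤ T n j := by
  obtain ⟨h1, h2⟩ := T_sq p
  obtain ⟨h3, h4⟩ := T_sq q
  have hij' : (i:ℝ) ≤ j := by exact_mod_cast hij
  refine le_of_sq_le_sq' ?_ h4.le
  have e1 : T n i ^ 2 = n * i / (n - i) := by rw [eq_div_iff p.hni.ne']; exact h1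
  have e2 : T n j ^ 2 = n * j / (n - j) := by rw [eq_div_iff q.hni.ne']; exact h3
  rw [e1, e2]
  have := q.hni; have := p.hn
  gcongr
where
  le_of_sq_le_sq' {x y : ℝ} (h : x ^ 2 ≤ y ^ 2) (hy : 0 ≤ y) : x ≤ y := by
    by_contra hc
    nlinarith

/-- `T_i² (1+ε/200) ≤ T_j²` -/
lemma T_gap {ε' ε u : ℝ} {n i j : ℕ} (p : Pack ε' u n i) (q : Pack ε' u n j)
    (hij : (i:ℝ) + ε / 200 * S n i ^ 2 ≤ j) (hε : 0 < ε) : (1 + ε / 200) * T n i ^ 2 ≤ T n j ^ 2 := by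
  obtain ⟨h1, h2⟩ := T_sq p
  obtain ⟨h3, h4⟩ := T_sq q
  have hs := p.hs
  have e1 : T n i ^ 2 = n * i / (n - i) := by rw [eq_div_iff p.hni.ne']; exact h1
  have e2 : T n j ^ 2 = n * j / (n - j) := by rw [eq_div_iff q.hni.ne']; exact h3
  rw [e1, e2, ← mul_div_assoc, div_le_div_iff₀ p.hni q.hni]
  have hn := p.hn
  have hsn := p.hsn
  have hnj := q.hni
  have hij' : (i:ℝ) ≤ j := by
    have : 0 ≤ ε / 200 * S n i ^ 2 := by positivity
    linarith
  -- n*(1+e) i (n-j) ≤ n j (n-i)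
  have k1 : ε / 200 * ((i:ℝ) * (n - j)) ≤ n * (j - i) := by
    calc ε / 200 * ((i:ℝ) * (n - j)) ≤ ε / 200 * ((i:ℝ) * (n - i)) := by gcongr
      _ = n * (ε / 200 * S n i ^ 2) := by rw [← hsn]; ring
      _ ≤ n * (j - i) := by gcongr; linarith
  have k2 : (1 + ε / 200) * (i * ((n:ℝ) - j)) ≤ j * (n - i) := by linarith
  calc _ = n * ((1 + ε / 200) * (i * ((n:ℝ) - j))) := by ring
    _ ≤ n * (j * (n - i)) := by gcongr
    _ = _ := by ring

lemma bT {ε u : ℝ} {n i : ℕ} (p : Pack ε u n i) : bb u n i * n ≤ (1 - bb u n i) * T n i ^ 2 := by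
  obtain ⟨h1, h2⟩ := T_sq p
  have hni := p.hni
  have e1 : T n i ^ 2 = n * i / (n - i) := by rw [eq_div_iff p.hni.ne']; exact h1
  rw [e1, ← mul_div_assoc, le_div_iff₀ hni]
  have k1 := p.hnb'
  have k2 := p.hn1b'
  have hb := p.hb0
  have hb1 := p.hb1
  calc bb u n i * n * (n - i) ≤ bb u n i * n * (n * (1 - bb u n i)) := by
        have := p.hn; gcongr
    _ = n * bb u n i * (n * (1 - bb u n i)) := by ring
    _ ≤ i * (n * (1 - bb u n i)) := by
        have : 0 ≤ n * (1 - bb u n i) := mul_nonneg p.hn.le (by linarith)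
        gcongr
    _ = _ := by ring

lemma bT' {ε u : ℝ} {n i : ℕ} (hε : 0 < ε) (hε1 : ε ≤ 1 / 4) (p : Pack ε u n i) :
    (1 - 2 * ε) * ((1 - bb u n i) * T n i ^ 2) ≤ bb u n i * n := by
  obtain ⟨h1, h2⟩ := T_sq p
  have hni := p.hni
  have hn := p.hn
  have e1 : T n i ^ 2 = n * i / (n - i) := by rw [eq_div_iff p.hni.ne']; exact h1
  rw [e1, ← mul_div_assoc, ← mul_div_assoc, div_le_iff₀ hni]
  have k1 := p.hnb
  have k2 := p.hn1b
  have hi := p.hi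
  have hb := p.hb0
  calc (1 - 2 * ε) * ((1 - bb u n i) * (n * i)) = (1 - 2 * ε) * i * (n * (1 - bb u n i)) := by ring
    _ ≤ (1 - 2 * ε) * i * ((1 + ε) * (n - i)) := by
        have : 0 ≤ (1 - 2 * ε) * i := mul_nonneg (by linarith) hi.le
        gcongr
    _ = ((1 - 2 * ε) * (1 + ε)) * (i * (n - i)) := by ring
    _ ≤ (1 - ε) * (i * (n - i)) := by
        have : 0 ≤ (i:ℝ) * (n - i) := by positivity
        gcongr
        nlinarith
    _ = (1 - ε) * i * (n - i) := by ring
    _ ≤ n * bb u n i * (n - i) := by gcongr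
    _ = _ := by ring

/-- increments beyond the window -/
lemma far {η u : ℝ} {n i j : ℕ} (hη : 0 < η) (hη1 : η ≤ 1 / 8000) (p : Pack η u n i) (q : Pack η u n j)
    (hij : (i:ℝ) + (8000 * η) / 200 * S n i ^ 2 ≤ j) :
    4 * η * (T n j ^ 2 / n) * ((1 - bb u n j) * (1 - bb u n i)) ≤ bb u n j - bb u n i ∧
    4 * η * (u * T n j) ≤ lam u n i - lam u n j ∧
    (j:ℝ) - i ≤ 2 * n * (bb u n j - bb u n i) := by
  have hg := T_gap p q hij (by linarith)
  have hn := p.hn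
  have b1 := bT p
  have b2 := bT' hη (by linarith) q
  have hTi := (T_sq p).2
  have hTj := (T_sq q).2
  have hi1 : 0 < 1 - bb u n i := by linarith [p.hb1]
  have hj1 : 0 < 1 - bb u n j := by linarith [q.hb1]
  have hg2 : T n i ^ 2 ≤ (1 - 8 * η) ^ 2 * T n j ^ 2 := by
    have : 1 ≤ (1 - 8 * η) ^ 2 * (1 + 8000 * η / 200) := by nlinarith [sq_nonneg η]
    have h3 : 0 ≤ T n i ^ 2 := by positivity
    calc T n i ^ 2 ≤ (1 - 8 * η) ^ 2 * (1 + 8000 * η / 200) * T n i ^ 2 := by nlinarith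
      _ = (1 - 8 * η) ^ 2 * ((1 + 8000 * η / 200) * T n i ^ 2) := by ring
      _ ≤ _ := by gcongr
  have hg3 : T n i ≤ (1 - 8 * η) * T n j := by
    apply le_of_sq_le_sq2
    · rw [mul_pow]; exact hg2
    · apply mul_nonneg _ hTj.le; linarith
  have hg4 : T n i ^ 2 ≤ (1 - 8 * η) * T n j ^ 2 := by
    refine hg2.trans ?_
    have : (1 - 8 * η) ^ 2 ≤ 1 - 8 * η := by nlinarith
    gcongr
  have r1 : 4 * η * (T n j ^ 2 / n) * ((1 - bb u n j) * (1 - bb u n i)) ≤ bb u n j - bb u n i := by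
    rw [← mul_div_assoc, div_mul_eq_mul_div, div_le_iff₀ hn]
    have e1 : (1 - 2 * η) * ((1 - bb u n j) * T n j ^ 2) * (1 - bb u n i) ≤ bb u n j * n * (1 - bb u n i) := by
      gcongr
    have e2 : bb u n i * n * (1 - bb u n j) ≤ (1 - bb u n i) * ((1 - 8 * η) * T n j ^ 2) * (1 - bb u n j) := by
      refine mul_le_mul_of_nonneg_right (b1.trans ?_) hj1.le
      gcongr
    have e3 : 0 ≤ η * (T n j ^ 2 * ((1 - bb u n j) * (1 - bb u n i))) := by positivity
    linarith
  refine ⟨r1, ?_, ?_⟩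
  · obtain ⟨z1, z2, z3, z4, z5, z6⟩ := Z_bounds hη (by linarith) p
    obtain ⟨y1, y2, y3, y4, y5, y6⟩ := Z_bounds hη (by linarith) q
    have hu := p.hu
    have : u * T n i ≤ u * ((1 - 8 * η) * T n j) := by gcongr
    have h2 : (1 + η) * (u * T n i) ≤ (1 + η) * (u * ((1 - 8 * η) * T n j)) := by gcongr
    have h3 : 0 ≤ η * (u * T n j) := by positivity
    have h4 : 0 ≤ η * (η * (u * T n j)) := by positivity
    linarith
  · have hDi := p.hD0
    have hDj := q.hDu
    have hus := q.hus
    have hus2 := mul_le_mul_of_nonneg_left hus (show 0 ≤ 1 + η by linarith)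
    have hsj := q.hs
    have d1 : (1 + η) * (η * S n j ^ 2) ≤ 4 * η * S n j ^ 2 := by
      have : 0 ≤ η * S n j ^ 2 := by positivity
      nlinarith
    have d2 : 4 * η * S n j ^ 2 ≤ n * (bb u n j - bb u n i) := by
      have k1 := q.hn1b'
      have k2 := p.hn1b'
      have hnj := q.hni
      have hni := p.hni
      have k3 : (n:ℝ) - j ≤ n - i := by
        have : 0 ≤ (8000 * η) / 200 * S n i ^ 2 := by positivity
        linarith
      obtain ⟨t1, _⟩ := T_sq q
      have hS : S n j ^ 2 * n = T n j ^ 2 / n * (n - j) ^ 2 := by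
        rw [q.hsn]
        field_simp
        linear_combination -t1
      have k4 : ((n:ℝ) - j) ^ 2 ≤ (n * (1 - bb u n j)) * (n * (1 - bb u n i)) := by
        rw [sq]
        apply mul_le_mul k1 (k3.trans k2) hnj.le
        positivity
      have k5 : 4 * η * S n j ^ 2 * n ≤ n * (bb u n j - bb u n i) * n := by
        calc 4 * η * S n j ^ 2 * n = 4 * η * (T n j ^ 2 / n * (n - j) ^ 2) := by rw [← hS]; ring
          _ ≤ 4 * η * (T n j ^ 2 / n * ((n * (1 - bb u n j)) * (n * (1 - bb u n i)))) := by gcongr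
          _ = n * n * (4 * η * (T n j ^ 2 / n) * ((1 - bb u n j) * (1 - bb u n i))) := by ring
          _ ≤ n * n * (bb u n j - bb u n i) := by gcongr
          _ = _ := by ring
      exact le_of_mul_le_mul_right k5 hn
    unfold DD at hDi hDj
    linarith
where
  le_of_sq_le_sq2 {x y : ℝ} (h : x ^ 2 ≤ y ^ 2) (hy : 0 ≤ y) : x ≤ y := by
    by_contra hc
    nlinarith

lemma bb_lt {u : ℝ} (hu : 0 < u) {n i j : ℕ} (hi : 0 < i) (hij : i < j) (hj : j ≤ n) : bb u n i < bb u n j := by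
  obtain ⟨hc0, hc1⟩ := cexp hu
  exact bq_strictMono hc0 hc1 hi hij hj

lemma ev_sqrt {C η : ℝ} (hη : 0 < η) : ∀ᶠ u : ℝ in atTop, 0 < u ∧ C * (u * √u) ≤ η * u ^ 2 := by
  have h := Real.tendsto_sqrt_atTop.eventually_ge_atTop (C / η)
  filter_upwards [h, eventually_gt_atTop 0] with u h1 h2
  refine ⟨h2, ?_⟩
  rw [div_le_iff₀ hη] at h1
  have e : u ^ 2 = u * √u * √u := by rw [mul_assoc, Real.mul_self_sqrt h2.le]; ring
  rw [e]
  have := mul_le_mul_of_nonneg_left h1 (show 0 ≤ u * √u by positivity)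
  linarith

lemma OTg {ε η : ℝ} (hε : 0 < ε) (hε1 : ε ≤ 1) (hη : 0 < η) : ∀ᶠ u : ℝ in atTop, ∀ n i j1 e : ℕ,
    Good u n i → Good u n e → i + win ε n i ≤ j1 → j1 < e → T n e ^ 2 ≤ u * √u * T n j1 ^ 2 →
    1 - η ≤ pr (n - i) (bb u n i) 1 (NC (Finset.Ioc j1 e) (bb u n) i) := by
  set ζ := ε / 8000 with hζ
  have hζ0 : 0 < ζ := by positivity
  have hk : 0 < 4 * ζ * (4 * ζ) ^ 2 := by positivity
  filter_upwards [pack hζ0, win_facts hε hε1, ev_sqrt (C := 16) hk, ev_sqrt (C := 8) (mul_pos hη hk)]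
    with u hpk hwf hs1 hs2 n i j1 e hg hge hij hje hT
  obtain ⟨f1, f2, f3, f4⟩ := hwf n i hg
  have hu := hs1.1
  have p := hpk n i hg
  have hgj : ∀ j, j1 ≤ j → j ≤ e → Good u n j := fun j h1 h2 => good_between hg hge (by omega) h2
  have hfar : ∀ j, j1 ≤ j → j ≤ e → _ := fun j h1 h2 => far hζ0 (by linarith) p (hpk n j (hgj j h1 h2)) (by
    have : ((i + win ε n i : ℕ) : ℝ) ≤ j := by exact_mod_cast hij.trans h1
    push_cast at this
    rw [show 8000 * ζ = ε by rw [hζ]; ring]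
    linarith)
  have p1 := hpk n j1 (hgj j1 le_rfl hje.le)
  have hn := p.hn
  have pe := hpk n e hge
  have hT1 := (T_sq p1).2
  have key := OT (u := u) (γ := 4 * ζ) (κ := 4 * ζ) (τ := u * √u) (n := n) (i0 := i) (j1 := j1) (e := e) hu
    (by positivity) (by positivity) (by omega) hje pe.hin p.hb0.le (bb_lt hu p.hi0 (by omega) p1.hin.le)
    (fun j j' h1 h2 h3 => bb_lt hu (by have := p1.hi0; omega) h2 (h3.trans pe.hin.le)) pe.hb1
    (fun j h1 h2 => ⟨(T_sq (hpk n j (hgj j h1.le h2))).2, T_le (hpk n j (hgj j h1.le h2)) pe h2⟩)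
    (fun j h1 h2 => (hfar j h1.le h2).2.1)
    (fun j h1 h2 => bT (hpk n j (hgj j h1.le h2)))
    (fun j h1 h2 => (hfar j h1.le h2).2.2)
    (q := T n j1 ^ 2 / n) (by positivity)
    (hfar j1 le_rfl hje.le).1
    (by rw [mul_assoc, div_mul_cancel₀ _ hn.ne']; exact hT) hs1.2 p.hn1b'
  refine le_trans ?_ key
  have : 8 * (u * √u) / (4 * ζ * (4 * ζ) ^ 2 * u ^ 2) ≤ η := by
    rw [div_le_iff₀ (by positivity)]
    calc _ ≤ _ := hs2.2
      _ = _ := by ring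
  linarith

lemma bb_zero {u : ℝ} (hu : 0 < u) (n : ℕ) : bb u n 0 = 0 := by
  unfold bb bq
  rw [dif_neg]
  rintro ⟨t, ⟨h0, h1⟩, hB⟩
  have : B n 0 t = 1 := by
    rw [B_eq_pr h0 h1]
    simp only [zero_le]
    exact pr_univ (by norm_num) n
  have := (cexp hu).2
  linarith

lemma OT0 {η : ℝ} (hη : 0 < η) : ∀ᶠ u : ℝ in atTop, ∀ n j1 e : ℕ,
    Good u n j1 → Good u n e → j1 < e → T n e ^ 2 ≤ u * √u * T n j1 ^ 2 →
    1 - η ≤ pr n 0 1 (NC (Finset.Ioc j1 e) (bb u n) 0) := by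
  have hζ0 : (0:ℝ) < 1 / 4 := by norm_num
  have hk : (0:ℝ) < 1 / 4 * (1 / 4) ^ 2 := by positivity
  filter_upwards [pack hζ0, ev_sqrt (C := 16) hk, ev_sqrt (C := 8) (mul_pos hη hk)]
    with u hpk hs1 hs2 n j1 e hg hge hje hT
  have hu := hs1.1
  have hgj : ∀ j, j1 ≤ j → j ≤ e → Good u n j := fun j h1 h2 => good_between hg hge (by omega) h2
  have p1 := hpk n j1 (hgj j1 le_rfl hje.le)
  have hn := p1.hn
  have pe := hpk n e hge
  have hT1 := (T_sq p1).2
  have h0 := bb_zero hu n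
  have key := OT (u := u) (γ := 1 / 4) (κ := 1 / 4) (τ := u * √u) (n := n) (i0 := 0) (j1 := j1) (e := e) hu
    (by positivity) (by positivity) p1.hi0 hje pe.hin (by rw [h0]) (by rw [h0]; exact p1.hb0)
    (fun j j' h1 h2 h3 => bb_lt hu (by have := p1.hi0; omega) h2 (h3.trans pe.hin.le)) pe.hb1
    (fun j h1 h2 => ⟨(T_sq (hpk n j (hgj j h1.le h2))).2, T_le (hpk n j (hgj j h1.le h2)) pe h2⟩)
    (fun j h1 h2 => by
      have z := Z_bounds hζ0 (by norm_num) (hpk n j (hgj j h1.le h2))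
      have hl : lam u n 0 = n := by unfold lam; rw [h0]; simp
      rw [hl]
      have : 0 < u * T n j := mul_pos hu z.2.2.2.1
      linarith [z.1])
    (fun j h1 h2 => bT (hpk n j (hgj j h1.le h2)))
    (fun j h1 h2 => by
      have q := hpk n j (hgj j h1.le h2)
      rw [h0]
      have := q.hnb; have := q.hi
      push_cast; linarith)
    (q := T n j1 ^ 2 / n) (by positivity)
    (by
      rw [h0, sub_zero, sub_zero, mul_one]
      have := bT' hζ0 (by norm_num) p1
      rw [← mul_div_assoc, div_mul_eq_mul_div, div_le_iff₀ hn]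
      have h3 : 0 ≤ T n j1 ^ 2 * (1 - bb u n j1) := mul_nonneg (by positivity) (by linarith [p1.hb1])
      linarith)
    (by rw [mul_assoc, div_mul_cancel₀ _ hn.ne']; exact hT) hs1.2 (by rw [h0]; simp)
  rw [h0] at key
  refine le_trans ?_ key
  have : 8 * (u * √u) / (1 / 4 * (1 / 4) ^ 2 * u ^ 2) ≤ η := by
    rw [div_le_iff₀ (by positivity)]
    calc _ ≤ _ := hs2.2
      _ = _ := by ring
  linarith

end

end BJ


open MeasureTheory Filter Set

namespace BJ

noncomputable section

lemma NC_step {n k E : ℕ} (y : ℕ → ℝ) (hkE : k + 1 < E) (hy : y (k + 1) ≤ y (k + 2)) {a d : ℝ} (had : a < d) :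
    pr n a d (NC (Finset.Ioc (k + 1) E) y 0) - pr n a d (NC (Finset.Ioc k E) y 0) =
      pr n a d {u | cnt u (y (k + 1)) = k + 1 ∧ u ∈ NC (Finset.Ioc (k + 1) E) y 0} := by
  have := uni_prob had
  have h1 : (NC (Finset.Ioc k E) y 0 : Set (Fin n → ℝ)) ⊆ NC (Finset.Ioc (k + 1) E) y 0 :=
    NC_mono (Finset.Ioc_subset_Ioc_left (by omega)) (fun _ _ => le_rfl) le_rfl
  have h2 : {u : Fin n → ℝ | cnt u (y (k + 1)) = k + 1 ∧ u ∈ NC (Finset.Ioc (k + 1) E) y 0} =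
      NC (Finset.Ioc (k + 1) E) y 0 \ NC (Finset.Ioc k E) y 0 := by
    ext u
    simp only [mem_ofPred_eq, Set.mem_sdiff]
    constructor
    · rintro ⟨a1, a2⟩
      refine ⟨a2, fun hc => ?_⟩
      have := hc (k + 1) (by simp only [Finset.mem_Ioc]; omega)
      omega
    · rintro ⟨a1, a2⟩
      refine ⟨?_, a1⟩
      have b1 := a1 (k + 2) (by simp only [Finset.mem_Ioc]; omega)
      have b2 := cnt_mono u hy
      by_contra hc
      apply a2
      intro j hj
      simp only [Finset.mem_Ioc] at hj
      rcases Nat.eq_or_lt_of_le hj.1 with h | h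
      · have : j = k + 1 := by omega
        subst this; omega
      · exact a1 j (by simp only [Finset.mem_Ioc]; omega)
  rw [h2]
  unfold pr
  rw [measureReal_sdiff h1 (measurableSet_NC _ _ _)]

lemma NC_tele {n s e E : ℕ} (y : ℕ → ℝ) (hse : s ≤ e) (heE : e < E)
    (hy : ∀ j, s < j → j < E → y j ≤ y (j + 1)) {a d : ℝ} (had : a < d) :
    pr n a d (NC (Finset.Ioc e E) y 0) - pr n a d (NC (Finset.Ioc s E) y 0) =
      ∑ i ∈ Finset.Ioc s e, pr n a d {u | cnt u (y i) = i ∧ u ∈ NC (Finset.Ioc i E) y 0} := by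
  induction e, hse using Nat.le_induction with
  | base => simp
  | succ k hk ih =>
    rw [← Finset.insert_Ioc_right_eq_Ioc_add_one hk, Finset.sum_insert (by simp), ← ih (by omega),
      ← NC_step y heE (hy (k + 1) (by omega) heE) had]
    ring

/-- local crossing rate -/
def rr (u : ℝ) (n i : ℕ) : ℝ := Real.exp (-u ^ 2 / 2) * u ^ 2 / (2 * S n i ^ 2)

lemma good_win {ε u : ℝ} (hε : 0 < ε) (hε1 : ε ≤ 1) {n i : ℕ} (hu : 2 ≤ u) (hg : u ^ 12 ≤ (i:ℝ))
    (h2 : 2 * u ^ 12 ≤ (n:ℝ) - i) : Good u n i ∧ Good u n (i + win ε n i) := by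
  have h12 : 0 < u ^ 12 := by positivity
  have hg' : Good u n i := ⟨hg, by linarith⟩
  have hb := good_base hu hg'
  have h1 : (win ε n i : ℝ) ≤ ε / 100 * (S n i) ^ 2 := Nat.floor_le (by positivity)
  refine ⟨hg', ?_, ?_⟩
  · push_cast; have : (0:ℝ) ≤ win ε n i := Nat.cast_nonneg _
    linarith
  · push_cast
    have h3 := hb.2.2.2.2.2.2.1
    have h4 : ε / 100 * (S n i) ^ 2 ≤ 1 / 100 * (S n i) ^ 2 := by gcongr
    linarith

lemma win_mono {ε u : ℝ} (hε : 0 < ε) (hε1 : ε ≤ 1) {n i e : ℕ} (hu : 2 ≤ u) (hi : Good u n i) (he : Good u n e)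
    (hie : i ≤ e) : i + win ε n i ≤ e + win ε n e := by
  have bi := good_base hu hi
  have be := good_base hu he
  have hn := bi.2.2.1
  have s1 := bi.2.2.2.2.1
  have s2 := be.2.2.2.2.1
  have hie' : (i:ℝ) ≤ e := by exact_mod_cast hie
  have h1 : S n i ^ 2 ≤ S n e ^ 2 + (e - i) := by
    have : S n i ^ 2 * n ≤ (S n e ^ 2 + (e - i)) * n := by
      rw [s1, add_mul, s2]
      have h3 := bi.1
      have h4 := be.1
      nlinarith
    exact le_of_mul_le_mul_right this hn
  have h2 : (win ε n i : ℝ) ≤ ε / 100 * (S n i) ^ 2 := Nat.floor_le (by positivity)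
  have h3 : ε / 100 * (S n e) ^ 2 < win ε n e + 1 := Nat.lt_floor_add_one _
  have h4 : ε / 100 * (S n i) ^ 2 ≤ ε / 100 * (S n e ^ 2 + (e - i)) := by gcongr
  have h5 : ε / 100 * ((e:ℝ) - i) ≤ e - i := by nlinarith
  have : ((i + win ε n i : ℕ) : ℝ) < ((e + win ε n e + 1 : ℕ) : ℝ) := by push_cast; linarith
  have := Nat.cast_lt.1 this
  omega

lemma T_win {ε' ε u : ℝ} (hε : 0 < ε) (hε1 : ε ≤ 1) {n i : ℕ} (p : Pack ε' u n i) (q : Pack ε' u n (i + win ε n i)) :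
    T n (i + win ε n i) ^ 2 ≤ 2 * T n i ^ 2 := by
  have hs := p.hs
  have h1 : (win ε n i : ℝ) ≤ ε / 100 * (S n i) ^ 2 := Nat.floor_le (by positivity)
  have h4 : ε / 100 * (S n i) ^ 2 ≤ 1 / 100 * (S n i) ^ 2 := by gcongr
  have t1 := (T_sq p).1
  have t2 := (T_sq q).1
  have e1 : T n i ^ 2 = n * i / (n - i) := by rw [eq_div_iff p.hni.ne']; exact t1
  have e2 : T n (i + win ε n i) ^ 2 = n * (i + win ε n i : ℕ) / (n - (i + win ε n i : ℕ)) := by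
    rw [eq_div_iff q.hni.ne']; exact t2
  rw [e1, e2, ← mul_div_assoc, div_le_div_iff₀ q.hni p.hni]
  have a1 := p.hsi
  have a2 := p.hsni
  have hn := p.hn
  have hi := p.hi
  have hni := p.hni
  push_cast
  have k1 : (i:ℝ) + win ε n i ≤ 101 / 100 * i := by linarith
  have k2 : 99 / 100 * ((n:ℝ) - i) ≤ n - (i + win ε n i) := by linarith
  calc (n:ℝ) * (i + win ε n i) * (n - i) ≤ n * (101 / 100 * i) * (n - i) := by gcongr
    _ = 101 / 100 * (n * i * (n - i)) := by ring
    _ ≤ 2 * (99 / 100) * (n * i * (n - i)) := by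
        have : 0 ≤ (n:ℝ) * i * (n - i) := by positivity
        linarith
    _ = 2 * (n * i) * (99 / 100 * (n - i)) := by ring
    _ ≤ _ := by gcongr

lemma bb_succ_le {u : ℝ} (hu : 0 < u) {n j : ℕ} (hj : 0 < j) (hjn : j < n) : bb u n j ≤ bb u n (j + 1) :=
  (bb_lt hu hj (by omega) (by omega)).le

lemma term_split {u : ℝ} (hu : 0 < u) {n i E : ℕ} (hi : 0 < i) (hin : i < n) (hE : E ≤ n) :
    pr n 0 1 {v | cnt v (bb u n i) = i ∧ v ∈ NC (Finset.Ioc i E) (bb u n) 0} =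
      binpmf n (bb u n i) i * pr (n - i) (bb u n i) 1 (NC (Finset.Ioc i E) (bb u n) i) := by
  obtain ⟨hc0, hc1⟩ := cexp hu
  have hs := bq_spec hc0 hc1 hi hin.le
  have := split_NC (a := 0) (b := bb u n i) (d := 1) hs.1 hs.2.1 n i hin.le (Finset.Ioc i E) (bb u n)
    (by intro j hj
        simp only [Finset.mem_Ioc] at hj
        exact (bb_lt hu hi hj.1 (hj.2.trans hE)).le) 0
  rw [this]
  simp

lemma lemmaU {ε : ℝ} (hε : 0 < ε) (hε1 : ε ≤ 1) : ∀ᶠ u : ℝ in atTop, ∀ n s e : ℕ, u ^ 12 ≤ (s:ℝ) + 1 → s < e →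
    2 * u ^ 12 ≤ (n:ℝ) - e →
    1 - (1 + ε) * ∑ i ∈ Finset.Ioc s e, rr u n i - ε ≤ pr n 0 1 (NC (Finset.Ioc s e) (bb u n) 0) := by
  have h10 : 0 < ε / 10 := by linarith
  filter_upwards [pack h10, win_facts h10 (by linarith), E2_upper h10 (by linarith), WU h10 (by linarith), OT0 hε,
    eventually_ge_atTop 4] with u hpk hwf hE2 hWU hOT hu4 n s e hs hse he
  have hu : 2 ≤ u := by linarith
  have hu0 : 0 < u := by linarith
  have hgood : ∀ i, s < i → i ≤ e → Good u n i ∧ Good u n (i + win (ε / 10) n i) := by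
    intro i h1 h2
    apply good_win h10 (by linarith) hu
    · have : ((s + 1 : ℕ):ℝ) ≤ i := by exact_mod_cast h1
      push_cast at this; linarith
    · have : (i:ℝ) ≤ e := by exact_mod_cast h2
      linarith
  obtain ⟨ge, ge'⟩ := hgood e hse le_rfl
  have pe := hpk n e ge
  have pe' := hpk n _ ge'
  set e' := e + win (ε / 10) n e with he'
  have hee' : e < e' := by have := (hwf n e ge).1; omega
  have h1 := hOT n e e' ge ge' hee' (by
    refine (T_win h10 (by linarith) pe pe').trans ?_
    have : 2 ≤ u * √u := by
      have : 2 ≤ √u := by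
        apply Real.le_sqrt_of_sq_le; linarith
      nlinarith
    have h3 : 0 ≤ T n e ^ 2 := by positivity
    nlinarith)
  have h2 := NC_tele (n := n) (s := s) (e := e) (E := e') (bb u n) hse.le hee'
    (fun j h1 h2 => bb_succ_le hu0 (by omega) (by have := pe'.hin; omega)) (show (0:ℝ) < 1 by norm_num)
  have h3 : pr n 0 1 (NC (Finset.Ioc s e') (bb u n) 0) ≤ pr n 0 1 (NC (Finset.Ioc s e) (bb u n) 0) := by
    apply pr_mono
    exact NC_mono (Finset.Ioc_subset_Ioc_right hee'.le) (fun _ _ => le_rfl) le_rfl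
  have h4 : ∑ i ∈ Finset.Ioc s e, pr n 0 1 {v | cnt v (bb u n i) = i ∧ v ∈ NC (Finset.Ioc i e') (bb u n) 0} ≤
      (1 + ε) * ∑ i ∈ Finset.Ioc s e, rr u n i := by
    rw [Finset.mul_sum]
    apply Finset.sum_le_sum
    intro i hi
    simp only [Finset.mem_Ioc] at hi
    obtain ⟨gi, gi'⟩ := hgood i hi.1 hi.2
    have p := hpk n i gi
    rw [term_split hu0 p.hi0 p.hin pe'.hin.le]
    have w1 := hE2 n i gi
    have w2 := hWU n i gi gi'
    have w3 : pr (n - i) (bb u n i) 1 (NC (Finset.Ioc i e') (bb u n) i) ≤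
        pr (n - i) (bb u n i) 1 (NC (Finset.Ioc i (i + win (ε / 10) n i)) (bb u n) i) := by
      apply pr_mono
      refine NC_mono (Finset.Ioc_subset_Ioc_right ?_) (fun _ _ => le_rfl) le_rfl
      exact win_mono h10 (by linarith) hu gi ge hi.2
    set P := pr (n - i) (bb u n i) 1 (NC (Finset.Ioc i (i + win (ε / 10) n i)) (bb u n) i) with hP
    have hP0 : 0 ≤ P := pr_nonneg _ _ _ _
    have hpos : 0 < u / (2 * S n i) := by have := p.hs; positivity
    have w4 : P ≤ (1 + ε / 10) / (1 - ε / 10) * (u / (2 * S n i)) := by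
      rw [div_mul_eq_mul_div, le_div_iff₀ (by linarith)]; linarith
    have hsS := p.hs
    have hc0 := p.hc0
    have hfac : (1 + ε / 10) * ((1 + ε / 10) / (1 - ε / 10)) ≤ 1 + ε := by
      rw [← mul_div_assoc, div_le_iff₀ (by linarith)]; nlinarith
    calc binpmf n (bb u n i) i * pr (n - i) (bb u n i) 1 (NC (Finset.Ioc i e') (bb u n) i)
        ≤ ((1 + ε / 10) * (Real.exp (-u ^ 2 / 2) * (u / S n i))) * P :=
          mul_le_mul w1 w3 (pr_nonneg _ _ _ _) (by positivity)
      _ ≤ ((1 + ε / 10) * (Real.exp (-u ^ 2 / 2) * (u / S n i))) *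
          ((1 + ε / 10) / (1 - ε / 10) * (u / (2 * S n i))) := by gcongr
      _ = ((1 + ε / 10) * ((1 + ε / 10) / (1 - ε / 10))) * rr u n i := by
          unfold rr
          have : 1 - ε / 10 ≠ 0 := by linarith
          field_simp
      _ ≤ (1 + ε) * rr u n i := by
          have : 0 ≤ rr u n i := by unfold rr; positivity
          gcongr
  linarith

end

end BJ


open MeasureTheory Filter Set

namespace BJ

noncomputable section

lemma pick (P : ℕ → Prop) {j1 E : ℕ} (h1 : P j1) (hE : j1 ≤ E) :
    ∃ j2, j1 ≤ j2 ∧ j2 ≤ E ∧ P j2 ∧ (j2 = E ∨ (j2 < E ∧ ¬ P (j2 + 1))) := by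
  induction E, hE using Nat.le_induction with
  | base => exact ⟨j1, le_rfl, le_rfl, h1, Or.inl rfl⟩
  | succ E hE ih =>
    obtain ⟨j2, a1, a2, a3, a4⟩ := ih
    rcases a4 with h | ⟨h, h'⟩
    · subst h
      by_cases hP : P (j2 + 1)
      · exact ⟨j2 + 1, by omega, le_rfl, hP, Or.inl rfl⟩
      · exact ⟨j2, a1, by omega, a3, Or.inr ⟨by omega, hP⟩⟩
    · exact ⟨j2, a1, by omega, a3, Or.inr ⟨by omega, h'⟩⟩

lemma f_anti {a d : ℝ} (had : a < d) {n : ℕ} (J : Finset ℕ) (y : ℕ → ℝ) {k k' : ℕ} (h : k ≤ k') (hk : k' ≤ n) :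
    pr (n - k') a d (NC J y k') ≤ pr (n - k) a d (NC J y k) := by
  induction k', h using Nat.le_induction with
  | base => exact le_rfl
  | succ m hm ih =>
    refine le_trans ?_ (ih (by omega))
    have := drop_point (n - (m + 1)) had J y m
    rwa [show n - (m + 1) + 1 = n - m by omega] at this

lemma f_mix {a t d : ℝ} (hat : a < t) (htd : t < d) {n : ℕ} (J : Finset ℕ) (y : ℕ → ℝ)
    (hy : ∀ j ∈ J, t ≤ y j) {k i : ℕ} (h : k ≤ i) (hi : i < n) :
    pr (n - k) a d (NC J y k) - pr (n - i) a d (NC J y i) ≤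
      ((i:ℝ) - k) * √((1 - (t - a) / (d - a)) / (((n:ℝ) - i) * ((t - a) / (d - a)))) := by
  obtain ⟨p0, p1⟩ := frac_mem hat htd
  have gen : ∀ m, k ≤ m → m ≤ i → pr (n - k) a d (NC J y k) - pr (n - m) a d (NC J y m) ≤
      ((m:ℝ) - k) * √((1 - (t - a) / (d - a)) / (((n:ℝ) - i) * ((t - a) / (d - a)))) := by
    intro m hm
    induction m, hm using Nat.le_induction with
    | base => intro _; simp
    | succ m hm ih =>
      intro hmi
      have h1 := ih (by omega)
      have h2 := mixing hat htd (n - (m + 1)) J y hy m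
      rw [show n - (m + 1) + 1 = n - m by omega] at h2
      have h3 : √((1 - (t - a) / (d - a)) / ((((n - (m + 1) : ℕ) : ℝ) + 1) * ((t - a) / (d - a)))) ≤
          √((1 - (t - a) / (d - a)) / (((n:ℝ) - i) * ((t - a) / (d - a)))) := by
        apply Real.sqrt_le_sqrt
        have hni : (0:ℝ) < n - i := by
          have : (i:ℝ) < n := by exact_mod_cast hi
          linarith
        have hle : (n:ℝ) - i ≤ ((n - (m + 1) : ℕ) : ℝ) + 1 := by
          rw [Nat.cast_sub (by omega)]
          push_cast
          have : ((m + 1 : ℕ) : ℝ) ≤ i := by exact_mod_cast hmi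
          push_cast at this
          linarith
        have : 0 ≤ 1 - (t - a) / (d - a) := by linarith
        gcongr
      push_cast
      linarith
  exact gen i h le_rfl

lemma q_le {a t : ℝ} (ha : 0 < a) (hat : a < t) (ht : t < 1) {n : ℕ} (J : Finset ℕ) (y : ℕ → ℝ)
    (hy : ∀ j ∈ J, t ≤ y j) (k0 : ℕ) (hk0 : k0 ≤ n) :
    pr n 0 1 (NC J y 0) ≤ pr n 0 1 {u | cnt u a < k0} + pr (n - k0) a 1 (NC J y k0) := by
  classical
  have ha1 : a < 1 := by linarith
  rw [pr_NC_eq_sum ha ha1 n J y (fun j hj => hat.le.trans (hy j hj)), pr_cnt_mem ha ha1 n (fun k => k < k0)]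
  simp only [sub_zero, div_one, zero_add]
  rw [Finset.sum_filter]
  have h1 : pr (n - k0) a 1 (NC J y k0) =
      ∑ k ∈ Finset.range (n + 1), binpmf n a k * pr (n - k0) a 1 (NC J y k0) := by
    rw [← Finset.sum_mul, binpmf_sum, one_mul]
  rw [h1, ← Finset.sum_add_distrib]
  apply Finset.sum_le_sum
  intro k hk
  simp only [Finset.mem_range] at hk
  have hb := binpmf_nonneg (n := n) ha.le ha1.le k
  have f0 := pr_nonneg (n - k0) a 1 (NC J y k0)
  split_ifs with h
  · have := pr_le_one ha1 (n - k) (NC J y k)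
    have := mul_le_mul_of_nonneg_left this hb
    have := mul_nonneg hb f0
    linarith
  · have := f_anti ha1 (n := n) J y (not_lt.1 h) (by omega)
    have := mul_le_mul_of_nonneg_left this hb
    linarith

set_option maxHeartbeats 2000000 in
lemma mixmain {ε η : ℝ} (hε : 0 < ε) (hε1 : ε ≤ 1) (hη : 0 < η) : ∀ᶠ u : ℝ in atTop, ∀ n i m E : ℕ,
    Good u n i → Good u n (m + 1) → i + win ε n i ≤ m + 1 → E ≤ n → u ^ 3 / 4 * T n i ^ 2 ≤ T n (m + 1) ^ 2 →
    pr n 0 1 (NC (Finset.Ioc m E) (bb u n) 0) - η ≤ pr (n - i) (bb u n i) 1 (NC (Finset.Ioc m E) (bb u n) i) := by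
  set ζ := ε / 8000 with hζ
  have hζ0 : 0 < ζ := by positivity
  filter_upwards [pack hζ0, win_facts hε hε1, ev_inv (show 0 < η / 4 by positivity),
    ev_inv (show 0 < η ^ 2 * ζ / 64 by positivity)] with u hpk hwf hs1 hs2 n i m E hg hgm him hE hT
  have p := hpk n i hg
  have q := hpk n (m + 1) hgm
  obtain ⟨f1, f2, f3, f4⟩ := hwf n i hg
  have hu := p.hu
  have hu0 : 0 < u := by linarith
  have hfar := far hζ0 (by linarith) p q (by
    have : ((i + win ε n i : ℕ) : ℝ) ≤ (m + 1 : ℕ) := by exact_mod_cast him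
    rw [show 8000 * ζ = ε by rw [hζ]; ring]
    push_cast at this ⊢
    linarith)
  set a := bb u n i with ha
  set t := bb u n (m + 1) with ht
  have hat : a < t := bb_lt hu0 p.hi0 (by omega) q.hin.le
  have ht1 : t < 1 := q.hb1
  have hJ : ∀ j ∈ Finset.Ioc m E, t ≤ bb u n j := by
    intro j hj
    simp only [Finset.mem_Ioc] at hj
    rcases Nat.eq_or_lt_of_le hj.1 with h | h
    · rw [ht, ← h]
    · exact (bb_lt hu0 (by omega) h (hj.2.trans hE)).le
  have hs := p.hs
  have hDu := p.hDu
  have hD0 := p.hD0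
  have h1us := p.h1us
  have hus0 : 0 < u * S n i := by positivity
  have hpos : 0 ≤ n * a - u * S n i := by
    have h1 := p.hus
    have h2 := p.hnb
    have h3 := p.hsi
    have h4 := p.hi
    have : ζ * S n i ^ 2 ≤ ζ * i := by gcongr
    nlinarith
  set k0 := ⌊n * a - u * S n i⌋₊ with hk0
  have hk0l : (k0:ℝ) ≤ n * a - u * S n i := Nat.floor_le hpos
  have hk0u : n * a - u * S n i < k0 + 1 := Nat.lt_floor_add_one _
  have hDD : DD u n i = i - n * a := rfl
  have hk0i : k0 ≤ i := by
    have : (k0:ℝ) ≤ i := by linarith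
    exact_mod_cast this
  have e1 := q_le p.hb0 hat ht1 (n := n) (Finset.Ioc m E) (bb u n) hJ k0 (hk0i.trans p.hin.le)
  have e2 := f_mix hat ht1 (n := n) (Finset.Ioc m E) (bb u n) hJ hk0i p.hin
  -- Chebyshev
  have e3 : pr n 0 1 {v | cnt v a < k0} ≤ η / 2 := by
    have c1 : pr n 0 1 {v | cnt v a < k0} ≤ pr n 0 1 {v | (cnt v a : ℝ) < n * a - u * S n i} := by
      apply pr_mono
      intro v hv
      simp only [mem_ofPred_eq] at hv ⊢
      have : ((cnt v a : ℕ) : ℝ) < k0 := by exact_mod_cast hv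
      linarith
    have c2 := cheb_lower (a := 0) (d := 1) p.hb0 p.hb1 n (m0 := n * a - u * S n i)
      (by simp only [sub_zero, div_one]; rw [← ha]; linarith)
    simp only [sub_zero, div_one] at c2
    rw [← ha] at c2
    refine c1.trans (c2.trans ?_)
    rw [show n * a - (n * a - u * S n i) = u * S n i by ring]
    have c3 : n * a * (1 - a) ≤ 2 * S n i ^ 2 := by
      have h1 := p.hsib'
      have h2 := p.hnb'
      have h3 : 0 ≤ 1 - a := by linarith
      calc n * a * (1 - a) ≤ i * (1 - a) := by gcongr
        _ ≤ _ := h1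
        _ ≤ _ := by gcongr; linarith
    rw [div_le_iff₀ (by positivity)]
    have c4 : 2 ≤ η / 2 * u ^ 2 := by nlinarith [hs1.2]
    calc _ ≤ _ := c3
      _ ≤ η / 2 * u ^ 2 * S n i ^ 2 := by gcongr
      _ = _ := by ring
  -- mixing error
  have e4 : ((i:ℝ) - k0) * √((1 - (t - a) / (1 - a)) / (((n:ℝ) - i) * ((t - a) / (1 - a)))) ≤ η / 2 := by
    have c1 : (i:ℝ) - k0 ≤ 4 * (u * S n i) := by
      have z1 : ζ * (u * S n i) ≤ 1 * (u * S n i) := by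
        gcongr; linarith
      linarith
    have hni := p.hni
    have hn := p.hn
    have ha1 : 0 < 1 - a := by linarith
    have hta : 0 < t - a := by linarith
    have h1t : 0 < 1 - t := by linarith
    have hTm := (T_sq q).2
    have hTi := (T_sq p).2
    have c2 : (1 - (t - a) / (1 - a)) / (((n:ℝ) - i) * ((t - a) / (1 - a))) ≤
        n ^ 2 / (4 * ζ * T n (m + 1) ^ 2 * (n - i) ^ 2) := by
      have : (1 - (t - a) / (1 - a)) / (((n:ℝ) - i) * ((t - a) / (1 - a))) = (1 - t) / ((n - i) * (t - a)) := by
        field_simp; ring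
      rw [this, div_le_div_iff₀ (by positivity) (by positivity)]
      have g1 := hfar.1
      have g2 := p.hn1b'
      rw [← ha] at g2
      calc (1 - t) * (4 * ζ * T n (m + 1) ^ 2 * (n - i) ^ 2)
          = (1 - t) * (4 * ζ * T n (m + 1) ^ 2 * (n - i)) * (n - i) := by ring
        _ ≤ (1 - t) * (4 * ζ * T n (m + 1) ^ 2 * (n - i)) * (n * (1 - a)) := by gcongr
        _ = n ^ 2 * ((n - i) * (4 * ζ * (T n (m + 1) ^ 2 / n) * ((1 - t) * (1 - a)))) := by field_simp
        _ ≤ n ^ 2 * ((n - i) * (t - a)) := by gcongr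
    have c3 : (4 * (u * S n i)) ^ 2 * (n ^ 2 / (4 * ζ * T n (m + 1) ^ 2 * (n - i) ^ 2)) ≤ (η / 2) ^ 2 := by
      have hTdef : (u * S n i) ^ 2 * n ^ 2 = u ^ 2 * T n i ^ 2 * (n - i) ^ 2 := by
        unfold T; field_simp
      rw [← mul_div_assoc, div_le_iff₀ (by positivity)]
      calc (4 * (u * S n i)) ^ 2 * (n:ℝ) ^ 2 = 16 * ((u * S n i) ^ 2 * n ^ 2) := by ring
        _ = 16 * u ^ 2 * (n - i) ^ 2 * T n i ^ 2 := by rw [hTdef]; ring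
        _ ≤ (η ^ 2 * ζ / 64 * u) * (16 * u ^ 2 * (n - i) ^ 2 * T n i ^ 2) :=
            le_mul_of_one_le_left (by positivity) hs2.2
        _ = η ^ 2 * ζ * (n - i) ^ 2 * (u ^ 3 / 4 * T n i ^ 2) := by ring
        _ ≤ η ^ 2 * ζ * (n - i) ^ 2 * T n (m + 1) ^ 2 := by gcongr
        _ = _ := by ring
    have c4 : √((1 - (t - a) / (1 - a)) / (((n:ℝ) - i) * ((t - a) / (1 - a)))) ≤
        √(n ^ 2 / (4 * ζ * T n (m + 1) ^ 2 * (n - i) ^ 2)) := Real.sqrt_le_sqrt c2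
    calc _ ≤ 4 * (u * S n i) * √(n ^ 2 / (4 * ζ * T n (m + 1) ^ 2 * (n - i) ^ 2)) := by gcongr
      _ = √((4 * (u * S n i)) ^ 2 * (n ^ 2 / (4 * ζ * T n (m + 1) ^ 2 * (n - i) ^ 2))) := by
          rw [Real.sqrt_mul (by positivity), Real.sqrt_sq (by positivity)]
      _ ≤ √((η / 2) ^ 2) := Real.sqrt_le_sqrt c3
      _ = η / 2 := Real.sqrt_sq (by positivity)
  linarith

end

end BJ


open MeasureTheory Filter Set

namespace BJ

noncomputable section

lemma harris_Ioc {m : ℕ} {a d : ℝ} (had : a < d) {s e E : ℕ} (hse : s ≤ e) (heE : e ≤ E) (y : ℕ → ℝ) (i : ℕ) :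
    pr m a d (NC (Finset.Ioc s e) y i) * pr m a d (NC (Finset.Ioc e E) y i) ≤ pr m a d (NC (Finset.Ioc s E) y i) := by
  rw [← Finset.Ioc_union_Ioc_eq_Ioc hse heE, NC_union]
  exact harris_NC had _ _ _ _ _ _

lemma T_succ {ε u : ℝ} {n j : ℕ} (p : Pack ε u n j) (q : Pack ε u n (j + 1)) : T n (j + 1) ^ 2 ≤ 4 * T n j ^ 2 := by
  have t1 := (T_sq p).1
  have t2 := (T_sq q).1
  have e1 : T n j ^ 2 = n * j / (n - j) := by rw [eq_div_iff p.hni.ne']; exact t1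
  have e2 : T n (j + 1) ^ 2 = n * (j + 1 : ℕ) / (n - (j + 1 : ℕ)) := by
    rw [eq_div_iff q.hni.ne']; exact t2
  rw [e1, e2, ← mul_div_assoc, div_le_div_iff₀ q.hni p.hni]
  have hn := p.hn
  have hni := q.hni
  have hj : (1:ℝ) ≤ j := by exact_mod_cast p.hi0
  have hnj : (1:ℝ) ≤ n - (j + 1 : ℕ) := by
    have : ((j + 1 + 1 : ℕ) : ℝ) ≤ n := by exact_mod_cast q.hin
    push_cast at this ⊢
    linarith
  push_cast at hnj ⊢
  have k1 : (j:ℝ) + 1 ≤ 2 * j := by linarith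
  have k2 : (n:ℝ) - j ≤ 2 * (n - (j + 1)) := by linarith
  calc (n:ℝ) * (j + 1) * (n - j) ≤ n * (2 * j) * (2 * (n - (j + 1))) := by
        have := p.hni
        gcongr
    _ = _ := by ring

lemma pr_NC_empty {m : ℕ} {a d : ℝ} (had : a < d) (e E : ℕ) (h : E ≤ e) (y : ℕ → ℝ) (i : ℕ) :
    pr m a d (NC (Finset.Ioc e E) y i) = 1 := by
  rw [Finset.Ioc_eq_empty (by omega)]
  have : (NC ∅ y i : Set (Fin m → ℝ)) = univ := by ext v; simp [NC]
  rw [this, pr_univ had]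

lemma tail {ε η : ℝ} (hε : 0 < ε) (hε1 : ε ≤ 1) (hη : 0 < η) (hη1 : η ≤ 1) : ∀ᶠ u : ℝ in atTop, ∀ n s i E : ℕ,
    Good u n i → Good u n E → s ≤ i → i + win ε n i ≤ E →
    (1 - η) ^ 2 * (pr n 0 1 (NC (Finset.Ioc s E) (bb u n) 0) - η) ≤
      pr (n - i) (bb u n i) 1 (NC (Finset.Ioc (i + win ε n i) E) (bb u n) i) := by
  filter_upwards [pack hη, OTg hε hε1 hη, mixmain hε hε1 hη, eventually_ge_atTop 2]
    with u hpk hOT hmix hu n s i E hg hgE hsi hiE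
  have p := hpk n i hg
  have pE := hpk n E hgE
  have hb1 := p.hb1
  have hq1 := pr_le_one (show (0:ℝ) < 1 by norm_num) n (NC (Finset.Ioc s E) (bb u n) 0)
  set q := pr n 0 1 (NC (Finset.Ioc s E) (bb u n) 0) with hq
  set j1 := i + win ε n i with hj1
  have h1η : 0 ≤ 1 - η := by linarith
  have hgj : ∀ j, i ≤ j → j ≤ E → Good u n j := fun j h1 h2 => good_between hg hgE h1 h2
  have hw : 1 ≤ u * √u := by
    have : 1 ≤ √u := Real.one_le_sqrt.2 (by linarith)
    nlinarith
  have self : ∀ j, T n j ^ 2 ≤ u * √u * T n j ^ 2 := fun j =>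
    le_mul_of_one_le_left (by positivity) hw
  have piece : ∀ j k, j1 ≤ j → j ≤ k → k ≤ E → T n k ^ 2 ≤ u * √u * T n j ^ 2 →
      1 - η ≤ pr (n - i) (bb u n i) 1 (NC (Finset.Ioc j k) (bb u n) i) := by
    intro j k h1 h2 h3 h4
    rcases h2.eq_or_lt with h | h
    · rw [pr_NC_empty hb1 _ _ h.ge]; linarith
    · exact hOT n i j k hg (hgj k (by omega) h3) h1 h h4
  obtain ⟨j2, a1, a2, a3, a4⟩ := pick (fun j => T n j ^ 2 ≤ u * √u * T n j1 ^ 2) (self j1) hiE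
  have q1 := piece j1 j2 le_rfl a1 a2 a3
  have cube : (1 - η) ^ 2 * (q - η) ≤ (1 - η) ^ 2 := by
    have : 0 ≤ (1 - η) ^ 2 := by positivity
    nlinarith
  have sqle : (1 - η) ^ 2 ≤ 1 - η := by nlinarith
  rcases a4 with h | ⟨h, h'⟩
  · subst h; linarith
  obtain ⟨j3, b1, b2, b3, b4⟩ := pick (fun j => T n j ^ 2 ≤ u * √u * T n j2 ^ 2) (self j2) a2
  have q2 := piece j2 j3 a1 b1 b2 b3
  have q12 : (1 - η) ^ 2 ≤ pr (n - i) (bb u n i) 1 (NC (Finset.Ioc j1 j3) (bb u n) i) := by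
    refine le_trans ?_ (harris_Ioc hb1 a1 b1 (bb u n) i)
    rw [sq]
    exact mul_le_mul q1 q2 h1η (pr_nonneg _ _ _ _)
  rcases b4 with h3 | ⟨h3, h3'⟩
  · subst h3; linarith
  have r1 := T_succ (hpk n j2 (hgj j2 (by omega) a2)) (hpk n (j2 + 1) (hgj (j2 + 1) (by omega) (by omega)))
  have r2 := T_le p (hpk n j1 (hgj j1 (by omega) hiE)) (by omega)
  have r3 : u ^ 3 / 4 * T n i ^ 2 ≤ T n (j3 + 1) ^ 2 := by
    push Not at h' h3'
    have hTi := (T_sq p).2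
    have e : u ^ 3 = (u * √u) * (u * √u) := by
      have := Real.mul_self_sqrt (show 0 ≤ u by linarith)
      calc u ^ 3 = u * u * u := by ring
        _ = u * u * (√u * √u) := by rw [this]
        _ = _ := by ring
    have hx : 0 ≤ u * √u := by linarith
    calc u ^ 3 / 4 * T n i ^ 2 ≤ u ^ 3 / 4 * T n j1 ^ 2 := by gcongr
      _ = u * √u / 4 * (u * √u * T n j1 ^ 2) := by rw [e]; ring
      _ ≤ u * √u / 4 * (T n (j2 + 1) ^ 2) := by gcongr
      _ ≤ u * √u / 4 * (4 * T n j2 ^ 2) := by gcongr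
      _ = u * √u * T n j2 ^ 2 := by ring
      _ ≤ _ := h3'.le
  have m1 := hmix n i j3 E hg (hgj (j3 + 1) (by omega) (by omega)) (by omega) pE.hin.le r3
  have m2 : q ≤ pr n 0 1 (NC (Finset.Ioc j3 E) (bb u n) 0) := by
    apply pr_mono
    exact NC_mono (Finset.Ioc_subset_Ioc_left (by omega)) (fun _ _ => le_rfl) le_rfl
  refine le_trans ?_ (harris_Ioc hb1 (a1.trans b1) b2 (bb u n) i)
  calc (1 - η) ^ 2 * (q - η)
      ≤ (1 - η) ^ 2 * pr (n - i) (bb u n i) 1 (NC (Finset.Ioc j3 E) (bb u n) i) := by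
        gcongr; linarith
    _ ≤ _ := by
        apply mul_le_mul_of_nonneg_right q12 (pr_nonneg _ _ _ _)

lemma lemmaL {ε : ℝ} (hε : 0 < ε) (hε1 : ε ≤ 1) : ∀ᶠ u : ℝ in atTop, ∀ n s i E : ℕ, u ^ 12 ≤ (i:ℝ) → s ≤ i → i < E →
    2 * u ^ 12 ≤ (n:ℝ) - E →
    (1 - ε) * rr u n i * (pr n 0 1 (NC (Finset.Ioc s E) (bb u n) 0) - ε) ≤
      pr n 0 1 {v | cnt v (bb u n i) = i ∧ v ∈ NC (Finset.Ioc i E) (bb u n) 0} := by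
  have h10 : 0 < ε / 10 := by linarith
  filter_upwards [pack h10, E2_lower h10 (by linarith), WL h10 (by linarith),
    tail h10 (by linarith) h10 (by linarith), eventually_ge_atTop 2]
    with u hpk hE2 hWL htail hu n s i E hi hsi hiE hE
  have hu0 : 0 < u := by linarith
  have hu12 : 0 < u ^ 12 := by positivity
  have hiE' : (i:ℝ) < E := by exact_mod_cast hiE
  obtain ⟨gi, gi'⟩ := good_win h10 (by linarith) hu hi (by linarith : 2 * u ^ 12 ≤ (n:ℝ) - i)
  have gE : Good u n E := ⟨by linarith, by linarith⟩
  have p := hpk n i gi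
  have pE := hpk n E gE
  have hb1 := p.hb1
  rw [term_split hu0 p.hi0 p.hin pE.hin.le]
  have hq1 := pr_le_one (show (0:ℝ) < 1 by norm_num) n (NC (Finset.Ioc s E) (bb u n) 0)
  set q := pr n 0 1 (NC (Finset.Ioc s E) (bb u n) 0) with hq
  have hs := p.hs
  have hr0 : 0 ≤ rr u n i := by unfold rr; positivity
  have hbin : 0 ≤ binpmf n (bb u n i) i := binpmf_nonneg p.hb0.le hb1.le i
  by_cases hqε : q ≤ ε
  · refine le_trans ?_ (mul_nonneg hbin (pr_nonneg _ _ _ _))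
    have : 0 ≤ (1 - ε) * rr u n i := mul_nonneg (by linarith) hr0
    nlinarith
  push Not at hqε
  have w1 := hE2 n i gi
  have w2 := hWL n i gi gi'
  have main : (1 - ε / 10) * (u / (2 * S n i)) * ((1 - ε / 10) ^ 2 * (q - ε)) ≤
      pr (n - i) (bb u n i) 1 (NC (Finset.Ioc i E) (bb u n) i) := by
    have hx : 0 ≤ (1 - ε / 10) * (u / (2 * S n i)) := mul_nonneg (by linarith) (by positivity)
    rcases le_total (i + win (ε / 10) n i) E with hc | hc
    · have w3 := htail n s i E gi gE hsi hc
      refine le_trans ?_ (harris_Ioc hb1 (by omega : i ≤ i + win (ε / 10) n i) hc (bb u n) i)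
      refine mul_le_mul w2 (le_trans ?_ w3) ?_ (pr_nonneg _ _ _ _)
      · gcongr; linarith
      · apply mul_nonneg (by positivity); linarith
    · have w3 : pr (n - i) (bb u n i) 1 (NC (Finset.Ioc i (i + win (ε / 10) n i)) (bb u n) i) ≤
          pr (n - i) (bb u n i) 1 (NC (Finset.Ioc i E) (bb u n) i) := by
        apply pr_mono
        exact NC_mono (Finset.Ioc_subset_Ioc_right hc) (fun _ _ => le_rfl) le_rfl
      refine le_trans (mul_le_of_le_one_right hx ?_) (w2.trans w3)
      have k1 : (1 - ε / 10) ^ 2 ≤ 1 := by nlinarith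
      have k2 : q - ε ≤ 1 := by linarith
      exact mul_le_one₀ k1 (by linarith) k2
  have hc0 := p.hc0
  have f4 : 1 - ε ≤ (1 - ε / 10) ^ 4 := by
    have h1 : 1 - ε / 5 ≤ (1 - ε / 10) ^ 2 := by nlinarith
    have h2 : (1 - ε / 5) ^ 2 ≤ ((1 - ε / 10) ^ 2) ^ 2 := pow_le_pow_left₀ (by linarith) h1 2
    calc 1 - ε ≤ (1 - ε / 5) ^ 2 := by nlinarith
      _ ≤ _ := h2
      _ = _ := by ring
  have hqe : 0 ≤ q - ε := by linarith
  calc (1 - ε) * rr u n i * (q - ε) ≤ (1 - ε / 10) ^ 4 * rr u n i * (q - ε) := by gcongr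
    _ = ((1 - ε / 10) * (Real.exp (-u ^ 2 / 2) * (u / S n i))) *
        ((1 - ε / 10) * (u / (2 * S n i)) * ((1 - ε / 10) ^ 2 * (q - ε))) := by
        unfold rr; field_simp
    _ ≤ _ := by
        apply mul_le_mul w1 main _ hbin
        apply mul_nonneg
        · exact mul_nonneg (by linarith) (by positivity)
        · exact mul_nonneg (by positivity) hqe

/-- summed version -/
lemma lemmaLs {ε : ℝ} (hε : 0 < ε) (hε1 : ε ≤ 1) : ∀ᶠ u : ℝ in atTop, ∀ n s e E : ℕ, u ^ 12 ≤ (s:ℝ) + 1 → s ≤ e → e < E →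
    2 * u ^ 12 ≤ (n:ℝ) - E →
    (1 - ε) * (∑ i ∈ Finset.Ioc s e, rr u n i) * (pr n 0 1 (NC (Finset.Ioc s E) (bb u n) 0) - ε) ≤
      pr n 0 1 (NC (Finset.Ioc e E) (bb u n) 0) - pr n 0 1 (NC (Finset.Ioc s E) (bb u n) 0) := by
  filter_upwards [lemmaL hε hε1, eventually_ge_atTop 2] with u hL hu n s e E hs hse heE hE
  have hu0 : 0 < u := by linarith
  have hu12 : 0 < u ^ 12 := by positivity
  have hEn : E ≤ n := by
    have : (E:ℝ) ≤ n := by linarith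
    exact_mod_cast this
  rw [NC_tele (n := n) (s := s) (e := e) (E := E) (bb u n) hse heE
    (fun j h1 h2 => bb_succ_le hu0 (by omega) (by omega)) (show (0:ℝ) < 1 by norm_num), Finset.mul_sum,
    Finset.sum_mul]
  apply Finset.sum_le_sum
  intro i hi
  simp only [Finset.mem_Ioc] at hi
  apply hL n s i E _ hi.1.le (by omega) hE
  have : ((s + 1 : ℕ):ℝ) ≤ i := by exact_mod_cast hi.1
  push_cast at this; linarith

end

end BJ


open MeasureTheory Filter Set

namespace BJ

noncomputable section

/-- splitting a range of indices into `K` blocks of almost equal mass -/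
lemma blocks (r : ℕ → ℝ) {s E K : ℕ} (hsE : s ≤ E) (hK : 0 < K) {δ : ℝ} (hδ : 0 < δ)
    (hr : ∀ i ∈ Finset.Ioc s E, 0 < r i ∧ r i ≤ δ)
    (hR : δ < (∑ i ∈ Finset.Ioc s E, r i) / K) :
    ∃ e : ℕ → ℕ, e 0 = s ∧ e K = E ∧ ∀ k < K, s ≤ e k ∧ e k < e (k + 1) ∧ e (k + 1) ≤ E ∧
      (∑ i ∈ Finset.Ioc s E, r i) / K - δ ≤ ∑ i ∈ Finset.Ioc (e k) (e (k + 1)), r i ∧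
      ∑ i ∈ Finset.Ioc (e k) (e (k + 1)), r i ≤ (∑ i ∈ Finset.Ioc s E, r i) / K + δ := by
  classical
  set R := ∑ i ∈ Finset.Ioc s E, r i with hRdef
  have hKr : (0:ℝ) < K := by exact_mod_cast hK
  have hR0 : 0 < R / K := hδ.trans hR
  let f : ℕ → ℝ := fun e => ∑ i ∈ Finset.Ioc s e, r i
  have hfd : ∀ a b, s ≤ a → a ≤ b → f b - f a = ∑ i ∈ Finset.Ioc a b, r i := by
    intro a b ha hab
    have := Finset.sum_Ioc_consecutive r ha hab
    simp only [f]; linarith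
  have hmono : ∀ a b, s ≤ a → a ≤ b → b ≤ E → f a ≤ f b := by
    intro a b ha hab hb
    have h1 := hfd a b ha hab
    have : 0 ≤ ∑ i ∈ Finset.Ioc a b, r i := Finset.sum_nonneg (fun i hi => by
      rw [Finset.mem_Ioc] at hi
      exact (hr i (by rw [Finset.mem_Ioc]; omega)).1.le)
    linarith
  have hsm : ∀ a b, s ≤ a → a < b → b ≤ E → f a < f b := by
    intro a b ha hab hb
    have h1 := hfd a b ha hab.le
    have : 0 < ∑ i ∈ Finset.Ioc a b, r i := Finset.sum_pos (fun i hi => by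
      rw [Finset.mem_Ioc] at hi
      exact (hr i (by rw [Finset.mem_Ioc]; omega)).1) ⟨b, by rw [Finset.mem_Ioc]; omega⟩
    linarith
  have hfs : f s = 0 := by simp [f]
  have hfE : f E = R := rfl
  have key : ∀ k : ℕ, ∃ e, k ≤ K → s ≤ e ∧ e ≤ E ∧ k * (R / K) ≤ f e ∧ f e ≤ k * (R / K) + δ ∧
      (k = 0 → e = s) := by
    intro k
    by_cases hk : k ≤ K
    · have hkr : (k:ℝ) ≤ K := by exact_mod_cast hk
      have hex : ∃ e, s ≤ e ∧ k * (R / K) ≤ f e := ⟨E, hsE, by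
        rw [hfE]
        calc (k:ℝ) * (R / K) ≤ K * (R / K) := by gcongr
          _ = R := by field_simp⟩
      have h1 := Nat.find_spec hex
      have h2 : Nat.find hex ≤ E := Nat.find_min' hex ⟨hsE, by
        rw [hfE]
        calc (k:ℝ) * (R / K) ≤ K * (R / K) := by gcongr
          _ = R := by field_simp⟩
      refine ⟨Nat.find hex, fun _ => ⟨h1.1, h2, h1.2, ?_, ?_⟩⟩
      · rcases h1.1.eq_or_lt with h | h
        · rw [← h, hfs]; positivity
        · have h3 := Nat.find_min hex (m := Nat.find hex - 1) (by omega)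
          have h4 : f (Nat.find hex - 1) < k * (R / K) := by
            by_contra hh
            exact h3 ⟨by omega, by linarith⟩
          have h5 := hfd (Nat.find hex - 1) (Nat.find hex) (by omega) (by omega)
          have h6 : Finset.Ioc (Nat.find hex - 1) (Nat.find hex) = {Nat.find hex} := by
            ext i; simp only [Finset.mem_Ioc, Finset.mem_singleton]; omega
          rw [h6, Finset.sum_singleton] at h5
          have h7 := (hr (Nat.find hex) (by rw [Finset.mem_Ioc]; omega)).2
          linarith
      · intro h0
        have : Nat.find hex ≤ s := Nat.find_min' hex ⟨le_rfl, by rw [hfs, h0]; simp⟩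
        omega
    · exact ⟨0, fun h => absurd h hk⟩
  choose e he using key
  refine ⟨e, (he 0 (by omega)).2.2.2.2 rfl, ?_, ?_⟩
  · obtain ⟨h1, h2, h3, -, -⟩ := he K le_rfl
    rcases h2.eq_or_lt with h | h
    · exact h
    · have := hsm _ _ h1 h le_rfl
      have h4 : (K:ℝ) * (R / K) = R := by field_simp
      rw [hfE] at this; linarith
  · intro k hk
    obtain ⟨a1, a2, a3, a4, -⟩ := he k hk.le
    obtain ⟨b1, b2, b3, b4, -⟩ := he (k + 1) hk
    push_cast at b3 b4
    have hlt : e k < e (k + 1) := by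
      by_contra hh
      have := hmono _ _ b1 (not_lt.1 hh) a2
      linarith
    have h5 := hfd _ _ a1 hlt.le
    refine ⟨a1, hlt, b2, ?_, ?_⟩ <;> rw [← h5] <;> linarith

lemma rr_pos {u : ℝ} (hu : 0 < u) {n i : ℕ} (h0 : 0 < i) (h1 : i < n) : 0 < rr u n i := by
  have : 0 < S n i := by
    unfold S
    apply Real.sqrt_pos.2
    have a : (0:ℝ) < i := by exact_mod_cast h0
    have b : (i:ℝ) < n := by exact_mod_cast h1
    have c : (0:ℝ) < n - i := by linarith
    have : (0:ℝ) < n := by linarith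
    positivity
  unfold rr; positivity

lemma rr_eq {u : ℝ} {n i : ℕ} (h0 : 0 < i) (h1 : i < n) :
    rr u n i = Real.exp (-u ^ 2 / 2) * (u ^ 2 / 2) * (1 / (i:ℝ) + 1 / ((n - i : ℕ) : ℝ)) := by
  have a : (0:ℝ) < i := by exact_mod_cast h0
  have b : (i:ℝ) < n := by exact_mod_cast h1
  have c : (0:ℝ) < n - i := by linarith
  have d : (0:ℝ) < n := by linarith
  have e : S n i ^ 2 = (i : ℝ) * (n - i) / n := by unfold S; exact Real.sq_sqrt (by positivity)
  unfold rr
  rw [e, Nat.cast_sub h1.le]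
  field_simp
  ring

lemma rr_le {u : ℝ} {n i : ℕ} (h0 : 0 < i) (h1 : i < n) :
    rr u n i ≤ Real.exp (-u ^ 2 / 2) * u ^ 2 := by
  rw [rr_eq h0 h1]
  have a : (1:ℝ) ≤ i := by exact_mod_cast h0
  have b : (1:ℝ) ≤ (n - i : ℕ) := by exact_mod_cast (by omega : 1 ≤ n - i)
  have h2 : 1 / (i:ℝ) ≤ 1 := by rw [div_le_one (by linarith)]; exact a
  have h3 : 1 / ((n - i : ℕ):ℝ) ≤ 1 := by rw [div_le_one (by linarith)]; exact b
  calc _ ≤ Real.exp (-u ^ 2 / 2) * (u ^ 2 / 2) * (1 + 1) := by gcongr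
    _ = _ := by ring

/-- Upper and lower bound with `K` blocks. -/
lemma block_bounds {K : ℕ} (hK : 0 < K) {ε : ℝ} (hε : 0 < ε) (hε1 : ε ≤ 1) :
    ∀ᶠ u in atTop, ∀ n s E : ℕ, u ^ 12 ≤ (s:ℝ) → s ≤ E → 2 * u ^ 12 ≤ (n:ℝ) - E →
      ∀ δ R : ℝ, 0 < δ → Real.exp (-u ^ 2 / 2) * u ^ 2 ≤ δ → R = ∑ i ∈ Finset.Ioc s E, rr u n i →
      δ < R / K → 0 ≤ 1 - (1 + ε) * (R / K + δ) - ε →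
      (1 - (1 + ε) * (R / K + δ) - ε) ^ K ≤ pr n 0 1 (NC (Finset.Ioc s E) (bb u n) 0) ∧
      (1 + (1 - ε) * (R / K - δ)) ^ (K - 1) * (pr n 0 1 (NC (Finset.Ioc s E) (bb u n) 0) - ε) ≤ 1 := by
  filter_upwards [lemmaU hε hε1, lemmaLs hε hε1, eventually_gt_atTop 0] with u hU hL hu
  intro n s E hs hsE hE δ R hδ hcδ hR hRK ha
  have hupos : 0 < u ^ 12 := by positivity
  have hs0 : 0 < s := by
    have : (0:ℝ) < s := by linarith
    exact_mod_cast this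
  have hEn : E < n := by
    have : (E:ℝ) < n := by linarith
    exact_mod_cast this
  have hr : ∀ i ∈ Finset.Ioc s E, 0 < rr u n i ∧ rr u n i ≤ δ := by
    intro i hi
    rw [Finset.mem_Ioc] at hi
    exact ⟨rr_pos hu (by omega) (by omega), (rr_le (by omega) (by omega)).trans hcδ⟩
  obtain ⟨e, he0, heK, he⟩ := blocks (fun i => rr u n i) hsE hK hδ hr (by rw [← hR]; exact hRK)
  simp only [← hR] at he
  have h01 : (0:ℝ) < 1 := one_pos
  set q : ℕ → ℝ := fun k => pr n 0 1 (NC (Finset.Ioc (e k) E) (bb u n) 0) with hq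
  have hq0 : q 0 = pr n 0 1 (NC (Finset.Ioc s E) (bb u n) 0) := by simp only [hq, he0]
  have hqK : q K = 1 := by simp only [hq, heK]; exact pr_NC_empty h01 _ _ le_rfl _ _
  have hqn : ∀ k, 0 ≤ q k := fun k => pr_nonneg _ _ _ _
  have hq1 : ∀ k, q k ≤ 1 := fun k => pr_le_one h01 _ _
  rw [← hq0]
  constructor
  · set a := 1 - (1 + ε) * (R / K + δ) - ε with hadef
    have step : ∀ k < K, a * q (k + 1) ≤ q k := by
      intro k hk
      obtain ⟨h1, h2, h3, h4, h5⟩ := he k hk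
      have hs' : (s:ℝ) ≤ e k := by exact_mod_cast h1
      have hE' : (e (k+1):ℝ) ≤ E := by exact_mod_cast h3
      have u1 := hU n (e k) (e (k + 1)) (by linarith) h2 (by linarith)
      have hh := harris_Ioc (m := n) h01 h2.le h3 (bb u n) 0
      refine le_trans ?_ hh
      apply mul_le_mul_of_nonneg_right _ (hqn _)
      refine le_trans ?_ u1
      have : (1 + ε) * ∑ i ∈ Finset.Ioc (e k) (e (k + 1)), rr u n i ≤ (1 + ε) * (R / K + δ) :=
        mul_le_mul_of_nonneg_left h5 (by linarith)
      linarith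
    have ind : ∀ j ≤ K, a ^ j ≤ q (K - j) := by
      intro j
      induction j with
      | zero => intro _; simp [hqK]
      | succ j ih =>
        intro hj
        have h1 := ih (by omega)
        have h2 := step (K - (j + 1)) (by omega)
        rw [show K - (j + 1) + 1 = K - j by omega] at h2
        calc a ^ (j + 1) = a * a ^ j := by ring
          _ ≤ a * q (K - j) := mul_le_mul_of_nonneg_left h1 ha
          _ ≤ _ := h2
    simpa using ind K le_rfl
  · set b := 1 + (1 - ε) * (R / K - δ) with hbdef
    have hb1 : 1 ≤ b := by
      have : 0 ≤ (1 - ε) * (R / K - δ) := mul_nonneg (by linarith) (by linarith)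
      linarith
    have step : ∀ k < K - 1, b * max (q k - ε) 0 ≤ max (q (k + 1) - ε) 0 := by
      intro k hk
      obtain ⟨h1, h2, h3, h4, h5⟩ := he k (by omega)
      obtain ⟨-, g2, g3, -, -⟩ := he (k + 1) (by omega)
      have hs' : (s:ℝ) ≤ e k := by exact_mod_cast h1
      have l1 := hL n (e k) (e (k + 1)) E (by linarith) h2.le (by omega) hE
      change _ * (q k - ε) ≤ q (k + 1) - q k at l1
      rcases le_total (q k - ε) 0 with h | h
      · rw [max_eq_right h]; simp
      · rw [max_eq_left h]
        apply le_max_of_le_left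
        have h6 : (1 - ε) * (R / K - δ) * (q k - ε) ≤ (1 - ε) * (∑ i ∈ Finset.Ioc (e k) (e (k + 1)), rr u n i) * (q k - ε) :=
          mul_le_mul_of_nonneg_right (mul_le_mul_of_nonneg_left h4 (by linarith)) h
        have h7 : b * (q k - ε) = (q k - ε) + (1 - ε) * (R / K - δ) * (q k - ε) := by rw [hbdef]; ring
        linarith
    have ind : ∀ j ≤ K - 1, b ^ j * max (q 0 - ε) 0 ≤ max (q j - ε) 0 := by
      intro j
      induction j with
      | zero => intro _; simp
      | succ j ih =>
        intro hj
        calc b ^ (j + 1) * max (q 0 - ε) 0 = b * (b ^ j * max (q 0 - ε) 0) := by ring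
          _ ≤ b * max (q j - ε) 0 := mul_le_mul_of_nonneg_left (ih (by omega)) (by linarith)
          _ ≤ _ := step j (by omega)
    have h1 := ind (K - 1) le_rfl
    have h2 : max (q (K - 1) - ε) 0 ≤ 1 := max_le (by linarith [hq1 (K - 1)]) zero_le_one
    have h3 : b ^ (K - 1) * (q 0 - ε) ≤ b ^ (K - 1) * max (q 0 - ε) 0 :=
      mul_le_mul_of_nonneg_left (le_max_left _ _) (by positivity)
    linarith

/-- The edges contribute at most `c` per index. -/
lemma pr_single {u : ℝ} (hu : 0 < u) {n j : ℕ} (h0 : 0 < j) (hj : j ≤ n) :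
    pr n 0 1 (NC (Finset.Ioc (j - 1) j) (bb u n) 0) = 1 - Real.exp (-u ^ 2 / 2) := by
  obtain ⟨c0, c1⟩ := cexp hu
  obtain ⟨b0, b1, b2⟩ := bq_spec c0 c1 h0 hj
  have h6 : Finset.Ioc (j - 1) j = {j} := by
    ext i; simp only [Finset.mem_Ioc, Finset.mem_singleton]; omega
  have h1 : (NC {j} (bb u n) 0 : Set (Fin n → ℝ)) = {v : Fin n → ℝ | j ≤ cnt v (bb u n j)}ᶜ := by
    ext v
    simp [NC]
  rw [h6, h1]
  have h2 := B_eq_pr (n := n) (j := j) b0 b1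
  rw [b2] at h2
  have h3 := pr_compl (m := n) (a := 0) (d := 1) one_pos (E := {v : Fin n → ℝ | j ≤ cnt v (bb u n j)})
    (measurableSet_cnt _ (Set.Ici j))
  rw [h3, h2]; rfl

lemma pr_edge_aux {u : ℝ} (hu : 0 < u) {n : ℕ} (s k : ℕ) (h : s + k ≤ n) :
    1 - k * Real.exp (-u ^ 2 / 2) ≤ pr n 0 1 (NC (Finset.Ioc s (s + k)) (bb u n) 0) := by
  obtain ⟨c0, c1⟩ := cexp hu
  induction k with
  | zero => rw [pr_NC_empty one_pos _ _ (by omega)]; simp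
  | succ k ih =>
    have h1 := ih (by omega)
    have hh := harris_Ioc (m := n) (a := 0) (d := 1) one_pos (s := s) (e := s + k) (E := s + (k + 1))
      (by omega) (by omega) (bb u n) 0
    have h2 := pr_single hu (n := n) (j := s + (k + 1)) (by omega) h
    rw [show s + (k + 1) - 1 = s + k by omega] at h2
    rw [h2] at hh
    refine le_trans ?_ hh
    have h3 := pr_le_one (a := 0) (d := 1) one_pos n (NC (Finset.Ioc s (s + k)) (bb u n) 0)
    have h4 : pr n 0 1 (NC (Finset.Ioc s (s + k)) (bb u n) 0) * Real.exp (-u ^ 2 / 2) ≤ 1 * Real.exp (-u ^ 2 / 2) :=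
      mul_le_mul_of_nonneg_right h3 c0.le
    push_cast
    nlinarith

lemma prod_lb {a b q α β : ℝ} (ha : 1 - α ≤ a) (hb : 1 - β ≤ b) (hq0 : 0 ≤ q) (hq1 : q ≤ 1) (ha1 : a ≤ 1)
    (hb1 : b ≤ 1) (hb0 : 0 ≤ b) : q - α - β ≤ a * (q * b) := by
  have h1 : 0 ≤ (1 - a) * (1 - q * b) := mul_nonneg (by linarith) (by nlinarith)
  have h2 : 0 ≤ (1 - q) * (1 - b) := mul_nonneg (by linarith) (by linarith)
  nlinarith

lemma pr_edges {u : ℝ} (hu : 0 < u) {n s E : ℕ} (hsE : s ≤ E) (hE : E ≤ n) :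
    pr n 0 1 (NC (Finset.Ioc s E) (bb u n) 0) - (s + (n - E)) * Real.exp (-u ^ 2 / 2)
      ≤ pr n 0 1 (NC (Finset.Ioc 0 n) (bb u n) 0) ∧
    pr n 0 1 (NC (Finset.Ioc 0 n) (bb u n) 0) ≤ pr n 0 1 (NC (Finset.Ioc s E) (bb u n) 0) := by
  constructor
  · have a := pr_edge_aux hu (n := n) 0 s (by omega)
    have b := pr_edge_aux hu (n := n) E (n - E) (by omega)
    rw [show E + (n - E) = n by omega, Nat.cast_sub hE] at b
    rw [zero_add] at a
    have h1 := harris_Ioc (m := n) (a := 0) (d := 1) one_pos (Nat.zero_le s) (hsE.trans hE) (bb u n) 0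
    have h2 := harris_Ioc (m := n) (a := 0) (d := 1) one_pos hsE hE (bb u n) 0
    refine le_trans ?_ h1
    refine le_trans ?_ (mul_le_mul_of_nonneg_left h2 (pr_nonneg _ _ _ _))
    have := prod_lb a b (pr_nonneg n 0 1 (NC (Finset.Ioc s E) (bb u n) 0)) (pr_le_one one_pos _ _) (pr_le_one one_pos _ _)
      (pr_le_one one_pos _ _) (pr_nonneg _ _ _ _)
    linarith
  · apply pr_mono
    exact NC_mono (Finset.Ioc_subset_Ioc (Nat.zero_le _) hE) (fun j _ => le_rfl) le_rfl

end

end BJ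


open MeasureTheory Filter Set

namespace BJ

noncomputable section

/-- the level -/
def cc (x : ℝ) (n : ℕ) : ℝ := x / (2 * Real.log n * Real.log (Real.log n))

/-- its logarithm -/
def ww (x : ℝ) (n : ℕ) : ℝ := Real.log (Real.log n) + Real.log (Real.log (Real.log n)) + Real.log (2 / x)

def uu (x : ℝ) (n : ℕ) : ℝ := Real.sqrt (2 * ww x n)

def mm (x : ℝ) (n : ℕ) : ℕ := ⌈2 * uu x n ^ 12⌉₊

lemma tend_L : Tendsto (fun n : ℕ => Real.log n) atTop atTop :=
  Real.tendsto_log_atTop.comp tendsto_natCast_atTop_atTop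

lemma tend_LL : Tendsto (fun n : ℕ => Real.log (Real.log n)) atTop atTop :=
  Real.tendsto_log_atTop.comp tend_L

lemma tend_logdiv : Tendsto (fun l : ℝ => Real.log l / l) atTop (nhds 0) := by
  have := Real.isLittleO_log_id_atTop.tendsto_div_nhds_zero
  simpa using this

lemma tend_wl (x : ℝ) : Tendsto (fun n : ℕ => ww x n / Real.log (Real.log n)) atTop (nhds 1) := by
  have h : Tendsto (fun l : ℝ => 1 + Real.log l / l + Real.log (2 / x) / l) atTop (nhds (1 + 0 + 0)) :=
    (tendsto_const_nhds.add tend_logdiv).add (tendsto_const_nhds.div_atTop tendsto_id)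
  have h2 := h.comp tend_LL
  rw [add_zero, add_zero] at h2
  refine h2.congr' ?_
  filter_upwards [tend_LL.eventually_gt_atTop 0] with n hn
  simp only [Function.comp, ww]
  field_simp

lemma ww_exp {x : ℝ} (hx : 0 < x) : ∀ᶠ n : ℕ in atTop, 0 < ww x n ∧ Real.exp (-ww x n) = cc x n ∧
    Real.exp (-uu x n ^ 2 / 2) = cc x n ∧ uu x n ^ 2 = 2 * ww x n ∧ 0 < uu x n := by
  filter_upwards [(tend_wl x).eventually_const_lt (zero_lt_one), tend_LL.eventually_gt_atTop 0, tend_L.eventually_gt_atTop 0]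
    with n h1 h2 h3
  have hw : 0 < ww x n := by
    by_contra hh
    have := div_nonpos_of_nonpos_of_nonneg (not_lt.1 hh) h2.le
    linarith
  have hu : uu x n ^ 2 = 2 * ww x n := Real.sq_sqrt (by positivity)
  have he : Real.exp (-ww x n) = cc x n := by
    unfold ww cc
    rw [Real.exp_neg, Real.exp_add, Real.exp_add, Real.exp_log h3, Real.exp_log h2, Real.exp_log (by positivity)]
    field_simp
  refine ⟨hw, he, ?_, hu, Real.sqrt_pos.2 (by positivity)⟩
  rw [hu, ← he]; congr 1; ring

lemma tend_w {x : ℝ} : Tendsto (fun n : ℕ => ww x n) atTop atTop := by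
  have := (tend_wl x).pos_mul_atTop one_pos tend_LL
  refine this.congr' ?_
  filter_upwards [tend_LL.eventually_gt_atTop 0] with n hn
  field_simp

lemma tend_u {x : ℝ} : Tendsto (fun n : ℕ => uu x n) atTop atTop := by
  apply Real.tendsto_sqrt_atTop.comp
  exact tend_w.const_mul_atTop two_pos

lemma tend_cw {x : ℝ} (hx : 0 < x) : Tendsto (fun n : ℕ => Real.exp (-uu x n ^ 2 / 2) * uu x n ^ 2) atTop (nhds 0) := by
  have h : Tendsto (fun w : ℝ => w ^ 1 * Real.exp (-w)) atTop (nhds 0) := Real.tendsto_pow_mul_exp_neg_atTop_nhds_zero 1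
  have h2 := (h.comp (tend_w (x := x))).const_mul 2
  rw [mul_zero] at h2
  refine h2.congr' ?_
  filter_upwards [ww_exp hx] with n ⟨_, h1, h2, h3, _⟩
  simp only [Function.comp]
  rw [h2, h1, h3]; ring

lemma mm_le {x : ℝ} (hx : 0 < x) : ∀ᶠ n : ℕ in atTop, (mm x n : ℝ) + 1 ≤ Real.log n := by
  have h : Tendsto (fun l : ℝ => l ^ 6 * Real.exp (-l)) atTop (nhds 0) := Real.tendsto_pow_mul_exp_neg_atTop_nhds_zero 6
  have h2 := h.comp tend_LL
  have h3 := h2.eventually_lt_const (show (0:ℝ) < 1 / (2 * 4 ^ 6 + 2) by norm_num)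
  filter_upwards [h3, ww_exp hx, (tend_wl x).eventually_lt_const (one_lt_two), tend_LL.eventually_ge_atTop 1, tend_L.eventually_gt_atTop 0]
    with n a1 ⟨b1, b2, b3, b4, b5⟩ a3 a4 a5
  simp only [Function.comp] at a1
  rw [Real.exp_neg, Real.exp_log a5] at a1
  set l := Real.log (Real.log n)
  have hw : ww x n ≤ 2 * l := by
    rw [div_lt_iff₀ (by linarith)] at a3; exact a3.le
  have hu12 : uu x n ^ 12 = (2 * ww x n) ^ 6 := by rw [← b4]; ring
  have h6 : (2 * ww x n) ^ 6 ≤ (2 * (2 * l)) ^ 6 := by gcongr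
  have h7 : (mm x n : ℝ) < 2 * uu x n ^ 12 + 1 := Nat.ceil_lt_add_one (by positivity)
  have h8 : 1 ≤ l ^ 6 := one_le_pow₀ a4
  have h9 : l ^ 6 < Real.log n * (1 / (2 * 4 ^ 6 + 2)) := by
    rwa [← div_eq_mul_inv, div_lt_iff₀ a5, mul_comm] at a1
  have h10 : (2 * (2 * l)) ^ 6 = 4 ^ 6 * l ^ 6 := by ring
  rw [h10] at h6
  rw [hu12] at h7
  norm_num at h9 h6
  linarith

lemma mm_ge (x : ℝ) (n : ℕ) : 2 * uu x n ^ 12 ≤ mm x n := Nat.le_ceil _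

lemma sum_split {u : ℝ} {n m : ℕ} (h : 2 * m + 1 ≤ n) :
    ∑ i ∈ Finset.Ioc m (n - m - 1), rr u n i =
      Real.exp (-u ^ 2 / 2) * u ^ 2 * ∑ i ∈ Finset.Ioc m (n - m - 1), 1 / (i:ℝ) := by
  have h1 : ∑ i ∈ Finset.Ioc m (n - m - 1), rr u n i =
      ∑ i ∈ Finset.Ioc m (n - m - 1), Real.exp (-u ^ 2 / 2) * (u ^ 2 / 2) * (1 / (i:ℝ) + 1 / ((n - i : ℕ) : ℝ)) := by
    apply Finset.sum_congr rfl
    intro i hi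
    rw [Finset.mem_Ioc] at hi
    exact rr_eq (by omega) (by omega)
  have h2 : ∑ i ∈ Finset.Ioc m (n - m - 1), 1 / ((n - i : ℕ) : ℝ) = ∑ i ∈ Finset.Ioc m (n - m - 1), 1 / (i:ℝ) := by
    apply Finset.sum_nbij' (fun i => n - i) (fun i => n - i)
    · intro i hi; rw [Finset.mem_Ioc] at *; omega
    · intro i hi; rw [Finset.mem_Ioc] at *; omega
    · intro i hi; rw [Finset.mem_Ioc] at *; omega
    · intro i hi; rw [Finset.mem_Ioc] at *; omega
    · intro i hi; rfl
  rw [h1, ← Finset.mul_sum, Finset.sum_add_distrib, h2]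
  ring

lemma harm_real (n : ℕ) : ((harmonic n : ℚ) : ℝ) = ∑ i ∈ Finset.Ioc 0 n, 1 / (i:ℝ) := by
  rw [harmonic_eq_sum_Icc]
  push_cast
  apply Finset.sum_congr
  · ext i; simp only [Finset.mem_Icc, Finset.mem_Ioc]; omega
  · intro i _; rw [one_div]

lemma harm_diff {a b : ℕ} (ha : 0 < a) (hab : a ≤ b) :
    Real.log (b + 1) - 1 - Real.log a ≤ ∑ i ∈ Finset.Ioc a b, 1 / (i:ℝ) ∧
    ∑ i ∈ Finset.Ioc a b, 1 / (i:ℝ) ≤ 1 + Real.log b := by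
  have h1 := Finset.sum_Ioc_consecutive (fun i : ℕ => 1 / (i:ℝ)) (Nat.zero_le a) hab
  rw [← harm_real, ← harm_real] at h1
  have h2 := log_add_one_le_harmonic b
  have h3 := harmonic_le_one_add_log b
  have h4 := harmonic_le_one_add_log a
  have h5 : (0:ℝ) ≤ (harmonic a : ℚ) := by rw [harm_real]; exact Finset.sum_nonneg (fun i _ => by positivity)
  push_cast at h2
  constructor <;> linarith

lemma small_L : ∀ᶠ n : ℕ in atTop, Real.log n ≤ (n:ℝ) / 4 := by
  have := (tend_logdiv.comp (tendsto_natCast_atTop_atTop (R := ℝ))).eventually_lt_const (show (0:ℝ) < 1 / 4 by norm_num)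
  filter_upwards [this, eventually_gt_atTop 0] with n h hn
  simp only [Function.comp] at h
  have : (0:ℝ) < n := by exact_mod_cast hn
  rw [div_lt_iff₀ this] at h
  linarith

lemma mm_small {x : ℝ} (hx : 0 < x) : ∀ᶠ n : ℕ in atTop, 0 < mm x n ∧ 4 * (mm x n + 1) ≤ n := by
  filter_upwards [mm_le hx, small_L, ww_exp hx] with n h1 h2 ⟨_, _, _, _, h3⟩
  constructor
  · exact Nat.ceil_pos.2 (by positivity)
  · have : (4:ℝ) * (mm x n + 1) ≤ n := by linarith
    exact_mod_cast this

lemma tend_R {x : ℝ} (hx : 0 < x) :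
    Tendsto (fun n : ℕ => ∑ i ∈ Finset.Ioc (mm x n) (n - mm x n - 1), rr (uu x n) n i) atTop (nhds x) := by
  have hH : Tendsto (fun n : ℕ => (∑ i ∈ Finset.Ioc (mm x n) (n - mm x n - 1), 1 / (i:ℝ)) / Real.log n) atTop (nhds 1) := by
    have lo : Tendsto (fun L : ℝ => 1 - (Real.log 2 + 1) / L - Real.log L / L) atTop (nhds (1 - 0 - 0)) :=
      (tendsto_const_nhds.sub (tendsto_const_nhds.div_atTop tendsto_id)).sub tend_logdiv
    have hi : Tendsto (fun L : ℝ => 1 / L + 1) atTop (nhds (0 + 1)) :=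
      (tendsto_const_nhds.div_atTop tendsto_id).add tendsto_const_nhds
    have lo' := lo.comp tend_L
    have hi' := hi.comp tend_L
    rw [sub_zero, sub_zero] at lo'
    rw [zero_add] at hi'
    refine tendsto_of_tendsto_of_tendsto_of_le_of_le' lo' hi' ?_ ?_
    · filter_upwards [mm_le hx, mm_small hx, tend_L.eventually_gt_atTop 0] with n h1 ⟨h2, h3⟩ h4
      have h5 := (harm_diff h2 (show mm x n ≤ n - mm x n - 1 by omega)).1
      have hm0 : (0:ℝ) < mm x n := by exact_mod_cast h2
      have h6 : Real.log (mm x n) ≤ Real.log (Real.log n) := Real.log_le_log hm0 (by linarith)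
      have hn0 : (0:ℝ) < n := by exact_mod_cast (show 0 < n by omega)
      have h7 : Real.log ((n:ℝ) / 2) ≤ Real.log (((n - mm x n - 1 : ℕ) : ℝ) + 1) := by
        apply Real.log_le_log (by positivity)
        have : n ≤ 2 * ((n - mm x n - 1) + 1) := by omega
        have : (n:ℝ) ≤ 2 * (((n - mm x n - 1 : ℕ) : ℝ) + 1) := by exact_mod_cast this
        linarith
      rw [Real.log_div hn0.ne' two_ne_zero] at h7
      simp only [Function.comp]
      rw [le_div_iff₀ h4]
      have : (1 - (Real.log 2 + 1) / Real.log n - Real.log (Real.log n) / Real.log n) * Real.log n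
        = Real.log n - (Real.log 2 + 1) - Real.log (Real.log n) := by field_simp
      rw [this]; linarith
    · filter_upwards [mm_small hx, tend_L.eventually_gt_atTop 0] with n ⟨h2, h3⟩ h4
      have h5 := (harm_diff h2 (show mm x n ≤ n - mm x n - 1 by omega)).2
      have h6 : Real.log ((n - mm x n - 1 : ℕ) : ℝ) ≤ Real.log n := by
        apply Real.log_le_log
        · exact_mod_cast (show 0 < n - mm x n - 1 by omega)
        · exact_mod_cast (show n - mm x n - 1 ≤ n by omega)
      simp only [Function.comp]
      rw [div_le_iff₀ h4]
      have : (1 / Real.log n + 1) * Real.log n = 1 + Real.log n := by field_simp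
      rw [this]; linarith
  have h := ((tend_wl x).mul hH).const_mul x
  rw [mul_one, mul_one] at h
  refine h.congr' ?_
  filter_upwards [mm_small hx, ww_exp hx, tend_LL.eventually_gt_atTop 0, tend_L.eventually_gt_atTop 0] with n ⟨h2, h3⟩ ⟨_, _, b3, b4, _⟩ h5 h6
  rw [sum_split (by omega), b3, b4]
  unfold cc
  field_simp

lemma tend_edge {x : ℝ} (hx : 0 < x) :
    Tendsto (fun n : ℕ => ((mm x n : ℝ) + (n - (n - mm x n - 1 : ℕ))) * Real.exp (-uu x n ^ 2 / 2)) atTop (nhds 0) := by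
  have hi : Tendsto (fun l : ℝ => x / l) atTop (nhds 0) := tendsto_const_nhds.div_atTop tendsto_id
  refine tendsto_of_tendsto_of_tendsto_of_le_of_le' tendsto_const_nhds (hi.comp tend_LL) ?_ ?_
  · filter_upwards [mm_small hx] with n ⟨h2, h3⟩
    have : ((n - mm x n - 1 : ℕ):ℝ) ≤ n := by exact_mod_cast (show n - mm x n - 1 ≤ n by omega)
    apply mul_nonneg _ (Real.exp_pos _).le
    have : (0:ℝ) ≤ mm x n := by positivity
    linarith
  · filter_upwards [mm_small hx, ww_exp hx, mm_le hx, tend_LL.eventually_gt_atTop 0, tend_L.eventually_gt_atTop 0] with n ⟨h2, h3⟩ ⟨_, _, b3, b4, _⟩ h4 h5 h6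
    rw [b3]
    have h7 : ((n - mm x n - 1 : ℕ):ℝ) = n - mm x n - 1 := by
      rw [Nat.cast_sub (by omega), Nat.cast_sub (by omega)]; simp
    rw [h7]
    simp only [Function.comp]
    unfold cc
    calc ((mm x n : ℝ) + (n - (n - mm x n - 1))) * (x / (2 * Real.log n * Real.log (Real.log n)))
        ≤ (2 * Real.log n) * (x / (2 * Real.log n * Real.log (Real.log n))) := by
          apply mul_le_mul_of_nonneg_right _ (by positivity)
          linarith
      _ = _ := by field_simp

lemma lim_lo (x : ℝ) : Tendsto (fun K : ℕ => (1 - x / K) ^ K) atTop (nhds (Real.exp (-x))) := by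
  have := Real.tendsto_one_add_div_pow_exp (-x)
  refine this.congr fun K => ?_
  congr 1; ring

lemma lim_hi {x : ℝ} (hx : 0 < x) : Tendsto (fun K : ℕ => ((1 + x / K) ^ (K - 1))⁻¹) atTop (nhds (Real.exp (-x))) := by
  have h1 := Real.tendsto_one_add_div_pow_exp x
  have h2 : Tendsto (fun K : ℕ => 1 + x / K) atTop (nhds (1 + 0)) :=
    tendsto_const_nhds.add (tendsto_const_nhds.div_atTop tendsto_natCast_atTop_atTop)
  have h3 := (h1.div h2 (by norm_num)).inv₀ (by simp [Real.exp_ne_zero])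
  rw [add_zero, div_one, ← Real.exp_neg] at h3
  refine h3.congr' ?_
  filter_upwards [eventually_gt_atTop 0] with K hK
  have : 0 < 1 + x / K := by positivity
  simp only [Pi.div_apply]
  congr 1
  rw [div_eq_iff this.ne', ← pow_succ]
  congr 1; omega

lemma main_lim {x : ℝ} (hx : 0 < x) :
    Tendsto (fun n : ℕ => pr n 0 1 (NC (Finset.Ioc 0 n) (bb (uu x n) n) 0)) atTop (nhds (Real.exp (-x))) := by
  rw [tendsto_order]
  have hpos : ∀ᶠ K : ℕ in atTop, 0 < K ∧ 0 < 1 - x / K := by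
    have h2 : Tendsto (fun K : ℕ => 1 - x / K) atTop (nhds (1 - 0)) :=
      tendsto_const_nhds.sub (tendsto_const_nhds.div_atTop tendsto_natCast_atTop_atTop)
    filter_upwards [eventually_gt_atTop 0, h2.eventually_const_lt (show (0:ℝ) < 1 - 0 by norm_num)] with K h1 h2
    exact ⟨h1, h2⟩
  constructor <;> intro y hy
  all_goals
    obtain ⟨K, hKy, hK, hK1⟩ := (by
      first
      | exact (((lim_lo x).eventually_const_lt hy).and hpos).exists
      | exact (((lim_hi hx).eventually_lt_const hy).and hpos).exists)
    have hKr : (0:ℝ) < K := by exact_mod_cast hK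
    have hxK : 0 < x / K := by positivity
    have hne : (1 + x / K) ^ (K - 1) ≠ 0 := by positivity
    have t1 : Tendsto (fun ε : ℝ => 1 - (1 + ε) * ((x + ε) / K + ε) - ε) (nhds 0) (nhds (1 - x / K)) := by
      have : Continuous (fun ε : ℝ => 1 - (1 + ε) * ((x + ε) / K + ε) - ε) := by fun_prop
      simpa using this.tendsto 0
    have t2 : Tendsto (fun ε : ℝ => (x - ε) / K - ε) (nhds 0) (nhds (x / K)) := by
      have : Continuous (fun ε : ℝ => (x - ε) / K - ε) := by fun_prop
      simpa using this.tendsto 0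
    have t3 : Tendsto (fun ε : ℝ => 1 + (1 - ε) * ((x - ε) / K - ε)) (nhds 0) (nhds (1 + x / K)) := by
      have : Continuous (fun ε : ℝ => 1 + (1 - ε) * ((x - ε) / K - ε)) := by fun_prop
      simpa using this.tendsto 0
    have t4 : Tendsto (fun ε : ℝ => (1 - (1 + ε) * ((x + ε) / K + ε) - ε) ^ K - ε) (nhds 0) (nhds ((1 - x / K) ^ K - 0)) :=
      (t1.pow K).sub tendsto_id
    have t5 : Tendsto (fun ε : ℝ => ((1 + (1 - ε) * ((x - ε) / K - ε)) ^ (K - 1))⁻¹ + ε) (nhds 0)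
        (nhds (((1 + x / K) ^ (K - 1))⁻¹ + 0)) :=
      ((t3.pow (K - 1)).inv₀ hne).add tendsto_id
    rw [sub_zero] at t4
    rw [add_zero] at t5
  · have ev : ∀ᶠ ε in nhdsWithin (0:ℝ) (Ioi 0), (0 < ε ∧ ε ≤ 1) ∧ 0 < 1 - (1 + ε) * ((x + ε) / K + ε) - ε ∧
        0 < (x - ε) / K - ε ∧ y < (1 - (1 + ε) * ((x + ε) / K + ε) - ε) ^ K - ε := by
      have e1 := (t1.eventually_const_lt hK1).filter_mono (nhdsWithin_le_nhds (s := Ioi (0:ℝ)))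
      have e2 := (t2.eventually_const_lt hxK).filter_mono (nhdsWithin_le_nhds (s := Ioi (0:ℝ)))
      have e3 := (t4.eventually_const_lt hKy).filter_mono (nhdsWithin_le_nhds (s := Ioi (0:ℝ)))
      have e4 := (eventually_le_nhds (show (0:ℝ) < 1 by norm_num)).filter_mono (nhdsWithin_le_nhds (s := Ioi (0:ℝ)))
      filter_upwards [e1, e2, e3, e4, self_mem_nhdsWithin] with ε a b c d e
      exact ⟨⟨e, d⟩, a, b, c⟩
    obtain ⟨ε, ⟨hε, hε1⟩, p1, p2, p3⟩ := ev.exists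
    have hb := tend_u (x := x) |>.eventually (block_bounds hK hε hε1)
    filter_upwards [hb, (tend_R hx).eventually_const_lt (show x - ε < x by linarith),
      (tend_R hx).eventually_lt_const (show x < x + ε by linarith), (tend_cw hx).eventually_lt_const hε,
      (tend_edge hx).eventually_lt_const hε, mm_small hx, ww_exp hx] with n hb r1 r2 r3 r4 ⟨m1, m2⟩ ⟨_, _, _, _, hu⟩
    set R := ∑ i ∈ Finset.Ioc (mm x n) (n - mm x n - 1), rr (uu x n) n i with hR
    have hu12 : 0 < uu x n ^ 12 := by positivity
    have hm := mm_ge x n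
    have hRK1 : (x - ε) / K ≤ R / K := by gcongr
    have hRK2 : R / K ≤ (x + ε) / K := by gcongr
    have hcast : ((n - mm x n - 1 : ℕ):ℝ) = n - mm x n - 1 := by
      rw [Nat.cast_sub (by omega), Nat.cast_sub (by omega)]; simp
    have ha : 1 - (1 + ε) * ((x + ε) / K + ε) - ε ≤ 1 - (1 + ε) * (R / K + ε) - ε := by gcongr
    have hfin := (hb n (mm x n) (n - mm x n - 1) (by linarith) (by omega) (by rw [hcast]; linarith) ε R hε r3.le hR
      (by linarith) (by linarith)).1
    have hed := (pr_edges hu (n := n) (s := mm x n) (E := n - mm x n - 1) (by omega) (by omega)).1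
    have hpow : (1 - (1 + ε) * ((x + ε) / K + ε) - ε) ^ K ≤ (1 - (1 + ε) * (R / K + ε) - ε) ^ K :=
      pow_le_pow_left₀ p1.le ha K
    linarith
  · have ev : ∀ᶠ ε in nhdsWithin (0:ℝ) (Ioi 0), (0 < ε ∧ ε ≤ 1) ∧ 0 < 1 - (1 + ε) * ((x + ε) / K + ε) - ε ∧
        0 < (x - ε) / K - ε ∧ ((1 + (1 - ε) * ((x - ε) / K - ε)) ^ (K - 1))⁻¹ + ε < y := by
      have e1 := (t1.eventually_const_lt hK1).filter_mono (nhdsWithin_le_nhds (s := Ioi (0:ℝ)))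
      have e2 := (t2.eventually_const_lt hxK).filter_mono (nhdsWithin_le_nhds (s := Ioi (0:ℝ)))
      have e3 := (t5.eventually_lt_const hKy).filter_mono (nhdsWithin_le_nhds (s := Ioi (0:ℝ)))
      have e4 := (eventually_le_nhds (show (0:ℝ) < 1 by norm_num)).filter_mono (nhdsWithin_le_nhds (s := Ioi (0:ℝ)))
      filter_upwards [e1, e2, e3, e4, self_mem_nhdsWithin] with ε a b c d e
      exact ⟨⟨e, d⟩, a, b, c⟩
    obtain ⟨ε, ⟨hε, hε1⟩, p1, p2, p3⟩ := ev.exists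
    have hb := tend_u (x := x) |>.eventually (block_bounds hK hε hε1)
    filter_upwards [hb, (tend_R hx).eventually_const_lt (show x - ε < x by linarith),
      (tend_R hx).eventually_lt_const (show x < x + ε by linarith), (tend_cw hx).eventually_lt_const hε,
      mm_small hx, ww_exp hx] with n hb r1 r2 r3 ⟨m1, m2⟩ ⟨_, _, _, _, hu⟩
    set R := ∑ i ∈ Finset.Ioc (mm x n) (n - mm x n - 1), rr (uu x n) n i with hR
    have hu12 : 0 < uu x n ^ 12 := by positivity
    have hm := mm_ge x n
    have hRK1 : (x - ε) / K ≤ R / K := by gcongr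
    have hRK2 : R / K ≤ (x + ε) / K := by gcongr
    have hcast : ((n - mm x n - 1 : ℕ):ℝ) = n - mm x n - 1 := by
      rw [Nat.cast_sub (by omega), Nat.cast_sub (by omega)]; simp
    have ha : 1 - (1 + ε) * ((x + ε) / K + ε) - ε ≤ 1 - (1 + ε) * (R / K + ε) - ε := by gcongr
    have hfin := (hb n (mm x n) (n - mm x n - 1) (by linarith) (by omega) (by rw [hcast]; linarith) ε R hε r3.le hR
      (by linarith) (by linarith)).2
    have hed := (pr_edges hu (n := n) (s := mm x n) (E := n - mm x n - 1) (by omega) (by omega)).2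
    have h1e : 0 ≤ 1 - ε := by linarith
    have hbb : 1 + (1 - ε) * ((x - ε) / K - ε) ≤ 1 + (1 - ε) * (R / K - ε) := by gcongr
    have hb0 : 0 < 1 + (1 - ε) * ((x - ε) / K - ε) := by
      have := mul_nonneg h1e p2.le
      linarith
    have hpow : ((1 + (1 - ε) * (R / K - ε)) ^ (K - 1))⁻¹ ≤ ((1 + (1 - ε) * ((x - ε) / K - ε)) ^ (K - 1))⁻¹ :=
      inv_anti₀ (by positivity) (pow_le_pow_left₀ hb0.le hbb _)
    have hb0' : 0 < (1 + (1 - ε) * (R / K - ε)) ^ (K - 1) := pow_pos (by linarith) _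
    have h8 : pr n 0 1 (NC (Finset.Ioc (mm x n) (n - mm x n - 1)) (bb (uu x n) n) 0) - ε
        ≤ ((1 + (1 - ε) * (R / K - ε)) ^ (K - 1))⁻¹ := by
      rw [← one_div, le_div_iff₀ hb0', mul_comm]; exact hfin
    linarith

end

end BJ

theorem berk_jones_MnPlus_MnMinus_null_limit (x : ℝ) (hx : 0 < x) :
    Filter.Tendsto (fun n : ℕ =>
        ((nullMeasure n) {u | MnPlus u < x / (2 * Real.log n * Real.log (Real.log n))}).toReal)
      Filter.atTop (nhds (1 - Real.exp (-x))) ∧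
    Filter.Tendsto (fun n : ℕ =>
        ((nullMeasure n) {u | MnMinus u < x / (2 * Real.log n * Real.log (Real.log n))}).toReal)
      Filter.atTop (nhds (1 - Real.exp (-x))) := by
  have h := (BJ.main_lim hx).const_sub 1
  have key : ∀ᶠ n : ℕ in atTop, 0 < n ∧ 0 < x / (2 * Real.log n * Real.log (Real.log n)) ∧
      x / (2 * Real.log n * Real.log (Real.log n)) < 1 ∧
      BJ.bb (BJ.uu x n) n = BJ.bq (x / (2 * Real.log n * Real.log (Real.log n))) n := by
    filter_upwards [BJ.ww_exp hx, eventually_gt_atTop 0] with n ⟨_, _, h3, _, h5⟩ hn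
    obtain ⟨c0, c1⟩ := BJ.cexp h5
    rw [h3] at c0 c1
    refine ⟨hn, c0, c1, ?_⟩
    funext i
    unfold BJ.bb
    rw [h3]; rfl
  constructor
  · refine h.congr' ?_
    filter_upwards [key] with n ⟨h1, h2, h3, h4⟩
    rw [BJ.trans_plus h1 h2 h3, h4]
  · refine h.congr' ?_
    filter_upwards [key] with n ⟨h1, h2, h3, h4⟩
    rw [BJ.trans_minus h1 h2 h3, h4]
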